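/- arXiv:1912.00204 — 5 statements merged into one kernel-verified Lean document; each statement's English description precedes it below -/
import Mathlib

section
/- Let a be a real algebraic number with 0 < a < 1. Then the real number 2√2·(1−a⁴)^{1/4}·∫_{√(1−a⁴)}^{1} dv/√(v(1−v)(v² − (1−a⁴))), which equals the total length of the Cassini oval C_a = {z ∈ ℂ : |z² − a²| = 1}, is transcendental over ℚ. -/
open Filter Topology

/-- A branch of the inverse of an elliptic integral of the first kind with parameter `κ` near `0`,
together with the two companion Jacobi functions. -/
structure IsLocalJacobi (κ : ℂ) (s c d : ℂ → ℂ) : Prop where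
  analytic_s : AnalyticAt ℂ s 0
  analytic_c : AnalyticAt ℂ c 0
  analytic_d : AnalyticAt ℂ d 0
  s_zero : s 0 = 0
  c_zero : c 0 = 1
  d_zero : d 0 = 1
  sq_c : ∀ᶠ z in 𝓝 0, c z ^ 2 = 1 - s z ^ 2
  sq_d : ∀ᶠ z in 𝓝 0, d z ^ 2 = 1 - κ * s z ^ 2
  deriv_s : ∀ᶠ z in 𝓝 0, HasDerivAt s (c z * d z) z
  deriv_c : ∀ᶠ z in 𝓝 0, HasDerivAt c (-(s z * d z)) z
  deriv_d : ∀ᶠ z in 𝓝 0, HasDerivAt d (-(κ * s z * c z)) z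
  double_s : ∀ᶠ z in 𝓝 0, s (2 * z) * (1 - κ * s z ^ 4) = 2 * s z * c z * d z
  double_c : ∀ᶠ z in 𝓝 0, c (2 * z) * (1 - κ * s z ^ 4) = c z ^ 2 - s z ^ 2 * d z ^ 2
  double_d : ∀ᶠ z in 𝓝 0, d (2 * z) * (1 - κ * s z ^ 4) = d z ^ 2 - κ * s z ^ 2 * c z ^ 2

lemma cpow_two_inv_sq (x : ℂ) : (x ^ (2⁻¹ : ℂ)) ^ 2 = x := by
  simp

lemma eventually_eq_cpow_two_inv {f g : ℂ → ℂ} {z₀ : ℂ} (hf : ContinuousAt f z₀)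
    (h0 : f z₀ = 1) (hfg : ∀ᶠ z in 𝓝 z₀, f z ^ 2 = g z) :
    ∀ᶠ z in 𝓝 z₀, g z ^ (2⁻¹ : ℂ) = f z := by
  have hpos : ∀ᶠ z in 𝓝 z₀, 0 < (f z).re :=
    (Complex.continuous_re.continuousAt.comp hf).eventually (lt_mem_nhds (by simp [h0]))
  filter_upwards [hpos, hfg] with z hz h
  rw [← h, Complex.sq_cpow_two_inv hz]

lemma analyticAt_sqrt_one_sub (κ x : ℂ) (hx : 1 - κ * x ^ 2 ∈ Complex.slitPlane) :
    AnalyticAt ℂ (fun x : ℂ => (1 - κ * x ^ 2) ^ (2⁻¹ : ℂ)) x := by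
  exact AnalyticAt.cpow (f := fun x : ℂ => 1 - κ * x ^ 2) (by fun_prop) analyticAt_const hx

lemma hasDerivAt_sqrt_one_sub (κ x : ℂ) (hx : 1 - κ * x ^ 2 ∈ Complex.slitPlane) :
    HasDerivAt (fun x : ℂ => (1 - κ * x ^ 2) ^ (2⁻¹ : ℂ))
      (-(κ * x) / (1 - κ * x ^ 2) ^ (2⁻¹ : ℂ)) x := by
  have h := (analyticAt_sqrt_one_sub κ x hx).differentiableAt.hasDerivAt
  have h0 : (1 - κ * x ^ 2) ^ (2⁻¹ : ℂ) ≠ 0 := by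
    intro h0
    have := cpow_two_inv_sq (1 - κ * x ^ 2)
    rw [h0] at this
    apply Complex.slitPlane_ne_zero hx
    rw [← this]; simp
  have h2 := h.pow 2
  have h3 : HasDerivAt (fun x : ℂ => 1 - κ * x ^ 2) (-(κ * (2 * x))) x := by
    simpa using ((hasDerivAt_pow 2 x).const_mul κ).const_sub 1
  have h4 : ((fun x : ℂ => (1 - κ * x ^ 2) ^ (2⁻¹ : ℂ)) ^ 2) = fun x : ℂ => 1 - κ * x ^ 2 := by
    ext y; simp
  rw [h4] at h2
  have := h2.unique h3
  refine h.congr_deriv (Eq.symm ?_)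
  rw [div_eq_iff h0]
  simp at this
  linear_combination (-1/2) * this

lemma jacobi_double_deriv {κ x p q : ℂ} (hp : p ≠ 0) (hq : q ≠ 0)
    (hp2 : p ^ 2 = 1 - 1 * x ^ 2) (hq2 : q ^ 2 = 1 - κ * x ^ 2) :
    (((2 * (p * q) * p + 2 * x * (-(1 * x) / p * (p * q))) * q
        + 2 * x * p * (-(κ * x) / q * (p * q))) * (1 - κ * x ^ 4)
        - 2 * x * p * q * (-(κ * (4 * x ^ 3 * (p * q))))) / (1 - κ * x ^ 4) ^ 2
      = 2 * ((p ^ 2 - x ^ 2 * q ^ 2) / (1 - κ * x ^ 4)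
        * ((q ^ 2 - κ * x ^ 2 * p ^ 2) / (1 - κ * x ^ 4))) := by
  have e1 : -(1 * x) / p * (p * q) = -(x * q) := by field_simp
  have e2 : -(κ * x) / q * (p * q) = -(κ * x * p) := by field_simp
  rw [e1, e2, div_mul_div_comm, ← mul_div_assoc, ← sq]
  congr 1
  have e3 : (2 * (p * q) * p + 2 * x * -(x * q)) * q = 2 * p ^ 2 * q ^ 2 - 2 * x ^ 2 * q ^ 2 := by
    ring
  have e4 : 2 * x * p * -(κ * x * p) = - 2 * κ * x ^ 2 * p ^ 2 := by ring
  have e5 : 2 * x * p * q * (-(κ * (4 * x ^ 3 * (p * q)))) = - 8 * κ * x ^ 4 * p ^ 2 * q ^ 2 := by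
    ring
  rw [e3, e4, e5, hp2, hq2]
  ring

theorem exists_isLocalJacobi {κ : ℂ} {U : ℂ → ℂ} (hU : AnalyticAt ℂ U 0) (hU0 : U 0 = 0)
    (hU' : ∀ᶠ x in 𝓝 0, HasDerivAt U
      (1 / ((1 - 1 * x ^ 2) ^ (2⁻¹ : ℂ) * (1 - κ * x ^ 2) ^ (2⁻¹ : ℂ))) x) :
    ∃ s c d : ℂ → ℂ, IsLocalJacobi κ s c d ∧ ∀ᶠ x in 𝓝 0, s (U x) = x := by
  set P : ℂ → ℂ → ℂ := fun κ x => (1 - κ * x ^ 2) ^ (2⁻¹ : ℂ) with hP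
  have P0 (k : ℂ) : P k 0 = 1 := by simp [hP]
  have hPa (k : ℂ) : AnalyticAt ℂ (P k) 0 := analyticAt_sqrt_one_sub k 0 (by simp)
  have hslit (k : ℂ) : ∀ᶠ x in 𝓝 (0 : ℂ), 1 - k * x ^ 2 ∈ Complex.slitPlane := by
    have : ContinuousAt (fun x : ℂ => 1 - k * x ^ 2) 0 := by fun_prop
    exact this.eventually (Complex.isOpen_slitPlane.mem_nhds (by simp))
  have hPd (k : ℂ) : ∀ᶠ x in 𝓝 (0 : ℂ), HasDerivAt (P k) (-(k * x) / P k x) x := by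
    filter_upwards [hslit k] with x hx using hasDerivAt_sqrt_one_sub k x hx
  have hPsq (k x : ℂ) : P k x ^ 2 = 1 - k * x ^ 2 := cpow_two_inv_sq _
  have hPne (k : ℂ) : ∀ᶠ x in 𝓝 (0 : ℂ), P k x ≠ 0 :=
    (hPa k).continuousAt.eventually_ne (by simp [P0])
  have hd0 : deriv U 0 = 1 := by
    rw [hU'.self_of_nhds.deriv]; simp
  have hd0' : deriv U 0 ≠ 0 := by simp [hd0]
  set s := hU.hasStrictDerivAt.localInverse _ _ _ hd0' with hs
  have sa : AnalyticAt ℂ s 0 := by simpa [hU0] using hU.analyticAt_localInverse hd0'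
  have sU : ∀ᶠ x in 𝓝 0, s (U x) = x :=
    HasStrictFDerivAt.eventually_left_inverse _
  have Us : ∀ᶠ z in 𝓝 0, U (s z) = z := by
    have := HasStrictFDerivAt.eventually_right_inverse
      (hU.hasStrictDerivAt.hasStrictFDerivAt_equiv hd0')
    rwa [hU0] at this
  have s0 : s 0 = 0 := by simpa [hU0] using sU.self_of_nhds
  have st : Tendsto s (𝓝 0) (𝓝 0) := by simpa [s0] using sa.continuousAt.tendsto
  have sderiv : ∀ᶠ z in 𝓝 0, HasDerivAt s (P 1 (s z) * P κ (s z)) z := by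
    filter_upwards [sa.eventually_analyticAt, Us.eventually_nhds, st.eventually hU',
      st.eventually (hPne 1), st.eventually (hPne κ)] with z h1 h2 h3 h4 h5
    have h6 := h1.differentiableAt.hasDerivAt
    have h7 := (HasDerivAt.comp z h3 h6).unique ((hasDerivAt_id z).congr_of_eventuallyEq h2)
    change 1 / (P 1 (s z) * P κ (s z)) * _ = 1 at h7
    refine h6.congr_deriv ?_
    field_simp at h7
    rw [h7]
  have sderivP (k : ℂ) : ∀ᶠ z in 𝓝 0, HasDerivAt (fun z => P k (s z))
      (-(k * s z) / P k (s z) * (P 1 (s z) * P κ (s z))) z := by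
    filter_upwards [sderiv, st.eventually (hPd k)] with z h1 h2
    exact HasDerivAt.comp z h2 h1
  have Psa (k : ℂ) : AnalyticAt ℂ (fun z => P k (s z)) 0 := by
    have := hPa k
    rw [← s0] at this
    exact this.comp sa
  have st4 : Tendsto (fun z => 1 - κ * s z ^ 4) (𝓝 0) (𝓝 1) := by
    have := sa.continuousAt
    have h : ContinuousAt (fun z => 1 - κ * s z ^ 4) 0 := by fun_prop
    simpa [s0] using h.tendsto
  have ne4 : ∀ᶠ z in 𝓝 0, 1 - κ * s z ^ 4 ≠ 0 := st4.eventually_ne one_ne_zero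
  have ea4 : AnalyticAt ℂ (fun z => 1 - κ * s z ^ 4) 0 := by fun_prop
  have e40 : 1 - κ * s 0 ^ 4 ≠ 0 := ne4.self_of_nhds
  set φ : ℂ → ℂ := fun z => 2 * s z * P 1 (s z) * P κ (s z) / (1 - κ * s z ^ 4) with hφ
  set C2 : ℂ → ℂ := fun z => (P 1 (s z) ^ 2 - s z ^ 2 * P κ (s z) ^ 2) / (1 - κ * s z ^ 4) with hC2
  set D2 : ℂ → ℂ := fun z => (P κ (s z) ^ 2 - κ * s z ^ 2 * P 1 (s z) ^ 2) / (1 - κ * s z ^ 4)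
    with hD2
  have φa : AnalyticAt ℂ φ 0 :=
    (((analyticAt_const.mul sa).mul (Psa 1)).mul (Psa κ)).div ea4 e40
  have C2a : AnalyticAt ℂ C2 0 :=
    (((Psa 1).pow 2).sub ((sa.pow 2).mul ((Psa κ).pow 2))).div ea4 e40
  have D2a : AnalyticAt ℂ D2 0 :=
    (((Psa κ).pow 2).sub ((analyticAt_const.mul (sa.pow 2)).mul ((Psa 1).pow 2))).div ea4 e40
  have φ0 : φ 0 = 0 := by simp [hφ, s0]
  have φt : Tendsto φ (𝓝 0) (𝓝 0) := by simpa [φ0] using φa.continuousAt.tendsto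
  have hC2' : ∀ᶠ z in 𝓝 0, P 1 (φ z) = C2 z := by
    apply eventually_eq_cpow_two_inv C2a.continuousAt (by simp [hC2, s0, P0])
    filter_upwards [ne4] with z hz
    simp only [hC2, hφ]
    rw [div_pow, div_pow, mul_pow, mul_pow, hPsq, hPsq]
    generalize hE : 1 - κ * s z ^ 4 = E at hz ⊢
    field_simp
    rw [← hE]; ring
  have hD2' : ∀ᶠ z in 𝓝 0, P κ (φ z) = D2 z := by
    apply eventually_eq_cpow_two_inv D2a.continuousAt (by simp [hD2, s0, P0])
    filter_upwards [ne4] with z hz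
    simp only [hD2, hφ]
    rw [div_pow, div_pow, mul_pow, mul_pow, hPsq, hPsq]
    generalize hE : 1 - κ * s z ^ 4 = E at hz ⊢
    field_simp
    rw [← hE]; ring
  have φderiv : ∀ᶠ z in 𝓝 0, HasDerivAt φ (2 * (C2 z * D2 z)) z := by
    filter_upwards [sderiv, sderivP 1, sderivP κ, ne4, st.eventually (hPne 1),
      st.eventually (hPne κ)] with z h1 h2 h3 h4 h5 h6
    have h7 : HasDerivAt (fun z => 1 - κ * s z ^ 4)
        (-(κ * (4 * s z ^ 3 * (P 1 (s z) * P κ (s z))))) z := by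
      simpa using ((h1.fun_pow 4).const_mul κ).const_sub 1
    have h8 := (((h1.const_mul 2).fun_mul h2).fun_mul h3).fun_div h7 h4
    exact h8.congr_deriv (jacobi_double_deriv h5 h6 (hPsq 1 (s z)) (hPsq κ (s z)))
  have hUφ : ∀ᶠ z in 𝓝 0, U (φ z) = 2 * z := by
    have hd : ∀ᶠ z in 𝓝 0, HasDerivAt (fun z => U (φ z) - 2 * z) 0 z := by
      filter_upwards [φderiv, φt.eventually hU', hC2', hD2', φt.eventually (hPne 1),
        φt.eventually (hPne κ)] with z h1 h2 h3 h4 h5 h6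
      have := (HasDerivAt.comp z h2 h1).sub ((hasDerivAt_id z).const_mul 2)
      refine this.congr_deriv (Eq.symm ?_)
      change 0 = 1 / (P 1 (φ z) * P κ (φ z)) * _ - _
      rw [← h3, ← h4]
      field_simp
      simp
    obtain ⟨ε, hε, hb⟩ := Metric.eventually_nhds_iff_ball.1 hd
    filter_upwards [Metric.ball_mem_nhds 0 hε] with z hz
    have := (convex_ball (0 : ℂ) ε).is_const_of_fderivWithin_eq_zero (𝕜 := ℂ)
      (f := fun z => U (φ z) - 2 * z)
      (fun y hy => (hb y hy).differentiableAt.differentiableWithinAt)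
      (fun y hy => by
        rw [fderivWithin_of_isOpen Metric.isOpen_ball hy]
        ext
        simp [(hb y hy).deriv]) hz (Metric.mem_ball_self hε)
    simp only [φ0, hU0] at this
    linear_combination this
  have hφs : ∀ᶠ z in 𝓝 0, s (2 * z) = φ z := by
    filter_upwards [hUφ, φt.eventually sU] with z h1 h2
    rw [← h1, h2]
  refine ⟨s, fun z => P 1 (s z), fun z => P κ (s z),
    ⟨sa, Psa 1, Psa κ, s0, by simp [s0, P0], by simp [s0, P0], ?_, ?_, sderiv, ?_, ?_, ?_, ?_, ?_⟩,
    sU⟩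
  · exact .of_forall fun z => by simp [hPsq]
  · exact .of_forall fun z => by simp [hPsq]
  · filter_upwards [sderivP 1, st.eventually (hPne 1)] with z h1 h2
    refine h1.congr_deriv ?_
    field_simp
  · filter_upwards [sderivP κ, st.eventually (hPne κ)] with z h1 h2
    refine h1.congr_deriv ?_
    field_simp
  · filter_upwards [hφs, ne4] with z h1 h2
    rw [h1]; exact div_mul_cancel₀ _ h2
  · filter_upwards [hφs, hC2', ne4] with z h1 h2 h3
    rw [h1, h2]; exact div_mul_cancel₀ _ h3
  · filter_upwards [hφs, hD2', ne4] with z h1 h2 h3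
    rw [h1, h2]; exact div_mul_cancel₀ _ h3

/-- Entire functions `S, C, D, N` whose quotients `S / N`, `C / N`, `D / N` are the Jacobi elliptic
functions `sn`, `cn`, `dn` with parameter `κ`. -/
structure IsJacobiTheta (κ : ℂ) (S C D N : ℂ → ℂ) : Prop where
  diff_S : Differentiable ℂ S
  diff_C : Differentiable ℂ C
  diff_D : Differentiable ℂ D
  diff_N : Differentiable ℂ N
  S_zero : S 0 = 0
  C_zero : C 0 = 1
  D_zero : D 0 = 1
  N_zero : N 0 = 1
  double_S : ∀ z, S (2 * z) = 2 * S z * C z * D z * N z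
  double_C : ∀ z, C (2 * z) = C z ^ 2 * N z ^ 2 - S z ^ 2 * D z ^ 2
  double_D : ∀ z, D (2 * z) = D z ^ 2 * N z ^ 2 - κ * S z ^ 2 * C z ^ 2
  double_N : ∀ z, N (2 * z) = N z ^ 4 - κ * S z ^ 4
  sq_C : ∀ z, C z ^ 2 = N z ^ 2 - S z ^ 2
  sq_D : ∀ z, D z ^ 2 = N z ^ 2 - κ * S z ^ 2
  wronskian_S : ∀ z, deriv S z * N z - S z * deriv N z = C z * D z
  wronskian_C : ∀ z, deriv C z * N z - C z * deriv N z = -(S z * D z)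
  wronskian_D : ∀ z, deriv D z * N z - D z * deriv N z = -(κ * S z * C z)

lemma exists_analyticAt_double_eq {l : ℂ → ℂ} (hl : AnalyticAt ℂ l 0) {A : ℝ}
    (hA : ∀ᶠ z in 𝓝 0, ‖l z‖ ≤ A * ‖z‖ ^ 4) :
    ∃ g : ℂ → ℂ, AnalyticAt ℂ g 0 ∧ g 0 = 0 ∧ ∀ᶠ z in 𝓝 0, g (2 * z) = 4 * g z + l z := by
  obtain ⟨ρ, hρ, hb⟩ := Metric.eventually_nhds_iff_ball.1 (hA.and hl.eventually_analyticAt)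
  set F : ℕ → ℂ → ℂ := fun m z => 4 ^ m * l (z / 2 ^ (m + 1)) with hF
  have hmem (m : ℕ) {z : ℂ} (hz : z ∈ Metric.ball (0 : ℂ) ρ) :
      z / 2 ^ (m + 1) ∈ Metric.ball (0 : ℂ) ρ := by
    simp only [Metric.mem_ball, dist_zero_right, norm_div, norm_pow, Complex.norm_ofNat] at hz ⊢
    exact (div_le_self (norm_nonneg _) (one_le_pow₀ one_le_two)).trans_lt hz
  have hA0 : 0 ≤ A := by
    have h := (hb ((ρ / 2 : ℝ) : ℂ) (by simp [abs_of_pos hρ, hρ])).1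
    have h2 := (norm_nonneg _).trans h
    have h3 : 0 < ‖((ρ / 2 : ℝ) : ℂ)‖ ^ 4 := by
      have : ((ρ / 2 : ℝ) : ℂ) ≠ 0 := by exact_mod_cast (by positivity : ρ / 2 ≠ 0)
      positivity
    exact nonneg_of_mul_nonneg_left h2 h3
  have hbd (m : ℕ) (z : ℂ) (hz : z ∈ Metric.ball (0 : ℂ) ρ) :
      ‖F m z‖ ≤ A * ρ ^ 4 * (1 / 4) ^ m := by
    have h1 := (hb _ (hmem m hz)).1
    have h2 : ‖z‖ < ρ := by simpa using hz
    simp only [hF, norm_mul, norm_pow, Complex.norm_ofNat]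
    calc (4 : ℝ) ^ m * ‖l (z / 2 ^ (m + 1))‖ ≤ 4 ^ m * (A * ‖z / 2 ^ (m + 1)‖ ^ 4) := by gcongr
      _ = A * ‖z‖ ^ 4 * (1 / 4) ^ m * (1 / 16) := by
        simp only [norm_div, norm_pow, Complex.norm_ofNat, div_pow, one_pow, ← pow_mul]
        rw [show (m + 1) * 4 = 4 * m + 4 by ring, pow_add, pow_mul]
        norm_num
        field_simp
        rw [← pow_mul, mul_comm m 2, pow_mul]
        norm_num
        ring
      _ ≤ A * ρ ^ 4 * (1 / 4) ^ m * 1 := by gcongr; norm_num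
      _ = _ := by ring
  have hsum : Summable fun m : ℕ => A * ρ ^ 4 * (1 / 4 : ℝ) ^ m :=
    (summable_geometric_of_lt_one (by norm_num) (by norm_num)).mul_left _
  have hdiff := Complex.differentiableOn_tsum_of_summable_norm hsum (F := F) (U := Metric.ball 0 ρ)
    (fun m z hz => by
      have h2 : DifferentiableAt ℂ l (z / 2 ^ (m + 1)) := (hb _ (hmem m hz)).2.differentiableAt
      have h3 : DifferentiableAt ℂ (fun z : ℂ => z / 2 ^ (m + 1)) z := by fun_prop
      exact ((h2.comp z h3).const_mul (4 ^ m)).differentiableWithinAt)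
    Metric.isOpen_ball hbd
  have hev : ∀ᶠ z in 𝓝 0, (∑' m, F m (2 * z)) = 4 * (∑' m, F m z) + l z := by
    filter_upwards [Metric.ball_mem_nhds 0 (half_pos hρ)] with z hz
    have h2z : 2 * z ∈ Metric.ball (0 : ℂ) ρ := by
      simp only [Metric.mem_ball, dist_zero_right, norm_mul, Complex.norm_ofNat] at hz ⊢
      linarith
    have hs := Summable.of_norm_bounded hsum fun m => hbd m _ h2z
    rw [hs.tsum_eq_zero_add, ← tsum_mul_left, add_comm]
    congr 1
    · congr 1
      ext m
      simp only [hF]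
      rw [pow_succ' (4 : ℂ), show 2 * z / 2 ^ (m + 1 + 1) = z / 2 ^ (m + 1) by
        rw [pow_succ' (2 : ℂ) (m + 1)]; field_simp]
      ring
    · simp [hF]
  have hl0 : l 0 = 0 := by simpa using hA.self_of_nhds
  refine ⟨fun z => ∑' m, F m z, hdiff.analyticAt (Metric.ball_mem_nhds 0 hρ), ?_, hev⟩
  simp [hF, hl0]

lemma exists_differentiable_semiconj {E : Type*} [NormedAddCommGroup E] [NormedSpace ℂ E]
    {Φ : E → E} (hΦ : Differentiable ℂ Φ) {f : ℂ → E} {ρ : ℝ} (hρ : 0 < ρ)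
    (hf : DifferentiableOn ℂ f (Metric.ball 0 ρ))
    (hfΦ : ∀ z, 2 * z ∈ Metric.ball (0 : ℂ) ρ → f (2 * z) = Φ (f z)) :
    ∃ F : ℂ → E, Differentiable ℂ F ∧ (∀ z, F (2 * z) = Φ (F z)) ∧
      Set.EqOn F f (Metric.ball 0 ρ) := by
  have key (z : ℂ) (n k : ℕ) (h : z / 2 ^ n ∈ Metric.ball (0 : ℂ) ρ) :
      Φ^[n + k] (f (z / 2 ^ (n + k))) = Φ^[n] (f (z / 2 ^ n)) := by
    have hmem (k : ℕ) : z / 2 ^ (n + k) ∈ Metric.ball (0 : ℂ) ρ := by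
      rw [pow_add, ← div_div]
      simp only [Metric.mem_ball, dist_zero_right] at h ⊢
      rw [norm_div, norm_pow, Complex.norm_ofNat]
      exact (div_le_self (norm_nonneg _) (one_le_pow₀ one_le_two)).trans_lt h
    induction k with
    | zero => rfl
    | succ k ih =>
      rw [← ih, ← add_assoc, Function.iterate_succ_apply]
      have e : 2 * (z / 2 ^ (n + k + 1)) = z / 2 ^ (n + k) := by
        rw [pow_succ' (2 : ℂ) (n + k)]; field_simp
      rw [← hfΦ _ (by rw [e]; exact hmem k), e]
  have key2 (z : ℂ) (n m : ℕ) (hn : z / 2 ^ n ∈ Metric.ball (0 : ℂ) ρ)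
      (hm : z / 2 ^ m ∈ Metric.ball (0 : ℂ) ρ) :
      Φ^[n] (f (z / 2 ^ n)) = Φ^[m] (f (z / 2 ^ m)) := by
    rcases le_total n m with h | h
    · obtain ⟨k, rfl⟩ := Nat.exists_eq_add_of_le h
      exact (key z n k hn).symm
    · obtain ⟨k, rfl⟩ := Nat.exists_eq_add_of_le h
      exact key z m k hm
  have hex (z : ℂ) : ∃ n : ℕ, z / 2 ^ n ∈ Metric.ball (0 : ℂ) ρ := by
    obtain ⟨n, hn⟩ := pow_unbounded_of_one_lt (‖z‖ / ρ) (one_lt_two (α := ℝ))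
    refine ⟨n, ?_⟩
    simp only [Metric.mem_ball, dist_zero_right, norm_div, norm_pow, Complex.norm_ofNat]
    rw [div_lt_iff₀ hρ] at hn
    rw [div_lt_iff₀ (by positivity)]
    linarith
  choose n hn using hex
  have hFeq (z : ℂ) (m : ℕ) (hm : z / 2 ^ m ∈ Metric.ball (0 : ℂ) ρ) :
      Φ^[n z] (f (z / 2 ^ n z)) = Φ^[m] (f (z / 2 ^ m)) := key2 z _ _ (hn z) hm
  refine ⟨fun z => Φ^[n z] (f (z / 2 ^ n z)), fun z => ?_, fun z => ?_, fun z hz => ?_⟩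
  · have hc : Continuous fun y : ℂ => y / 2 ^ n z := by fun_prop
    have hev : ∀ᶠ y in 𝓝 z, y / 2 ^ n z ∈ Metric.ball (0 : ℂ) ρ :=
      hc.continuousAt.eventually (Metric.isOpen_ball.mem_nhds (hn z))
    have hd : DifferentiableAt ℂ (fun y => Φ^[n z] (f (y / 2 ^ n z))) z := by
      have h1 : DifferentiableAt ℂ f (z / 2 ^ n z) :=
        hf.differentiableAt (Metric.isOpen_ball.mem_nhds (hn z))
      have h2 : DifferentiableAt ℂ (fun y : ℂ => y / 2 ^ n z) z := by fun_prop
      exact (hΦ.iterate (n z) _).comp z (h1.comp z h2)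
    exact hd.congr_of_eventuallyEq (hev.mono fun y hy => hFeq y _ hy)
  · have e : 2 * z / 2 ^ (n z + 1) = z / 2 ^ n z := by
      rw [pow_succ' (2 : ℂ)]; field_simp
    change Φ^[n (2 * z)] (f (2 * z / 2 ^ n (2 * z))) = Φ (Φ^[n z] (f (z / 2 ^ n z)))
    rw [hFeq (2 * z) (n z + 1) (by rw [e]; exact hn z), e, Function.iterate_succ_apply']
  · simpa using hFeq z 0 (by simpa using hz)

lemma exists_norm_le_exp_sq {E : Type*} [NormedAddCommGroup E] {F : ℂ → E} (hF : Continuous F)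
    (hd : ∀ z, ‖F (2 * z)‖ ≤ 2 * ‖F z‖ ^ 4) :
    ∃ B : ℝ, 0 ≤ B ∧ ∀ R : ℝ, 1 ≤ R → ∀ z, ‖z‖ ≤ R → ‖F z‖ ≤ Real.exp (B * R ^ 2) := by
  obtain ⟨M, hM⟩ := (isCompact_closedBall (0 : ℂ) 1).exists_bound_of_continuousOn hF.continuousOn
  set L := 2 * max M 1 with hL
  have hL2 : 2 ≤ L := by linarith [le_max_right M 1]
  have key (n : ℕ) : ∀ z : ℂ, ‖z‖ ≤ 2 ^ n → ‖F z‖ ≤ L ^ 4 ^ n / 2 := by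
    induction n with
    | zero =>
      intro z hz
      have := hM z (by simpa using hz)
      simp only [hL, pow_zero, pow_one]
      linarith [le_max_left M 1]
    | succ n ih =>
      intro z hz
      have h1 := ih (z / 2) (by
        rw [norm_div, Complex.norm_ofNat, div_le_iff₀ two_pos, ← pow_succ]; exact hz)
      have h2 := hd (z / 2)
      rw [mul_div_cancel₀ z two_ne_zero] at h2
      calc ‖F z‖ ≤ 2 * (L ^ 4 ^ n / 2) ^ 4 := h2.trans (by gcongr)
        _ = (L ^ 4 ^ (n + 1)) / 8 := by rw [div_pow, ← pow_mul, pow_succ]; ring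
        _ ≤ _ := by
          have : 0 ≤ L ^ 4 ^ (n + 1) := by positivity
          linarith
  have hlog : 0 ≤ Real.log L := Real.log_nonneg (by linarith)
  refine ⟨Real.log L * 4, by positivity, fun R hR z hz => ?_⟩
  obtain ⟨n, hn1, hn2⟩ := exists_nat_pow_near hR (one_lt_two (α := ℝ))
  have h1 := key (n + 1) z (hz.trans hn2.le)
  have hL0 : 0 < L := by linarith
  calc ‖F z‖ ≤ L ^ 4 ^ (n + 1) := h1.trans (by
        have : 0 ≤ L ^ 4 ^ (n + 1) := by positivity
        linarith)
    _ = Real.exp (Real.log L * 4 * (2 ^ n) ^ 2) := by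
      rw [← Real.exp_log (pow_pos hL0 _), Real.log_pow, ← pow_mul, mul_comm n 2, pow_mul]
      congr 1
      push_cast
      ring
    _ ≤ _ := by gcongr

lemma Differentiable.eq_of_eventually_eq {f g : ℂ → ℂ} (hf : Differentiable ℂ f)
    (hg : Differentiable ℂ g) {z₀ : ℂ} (h : ∀ᶠ z in 𝓝 z₀, f z = g z) : f = g :=
  AnalyticOnNhd.eq_of_eventuallyEq (𝕜 := ℂ) (fun z _ => hf.analyticAt z)
    (fun z _ => hg.analyticAt z) h

/-- The homogeneous duplication map for the theta functions `S, C, D, N`. -/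
def jacobiDouble (κ : ℂ) (v : Fin 4 → ℂ) : Fin 4 → ℂ :=
  ![2 * v 0 * v 1 * v 2 * v 3, v 1 ^ 2 * v 3 ^ 2 - v 0 ^ 2 * v 2 ^ 2,
    v 2 ^ 2 * v 3 ^ 2 - κ * v 0 ^ 2 * v 1 ^ 2, v 3 ^ 4 - κ * v 0 ^ 4]

lemma differentiable_jacobiDouble (κ : ℂ) : Differentiable ℂ (jacobiDouble κ) := by
  refine differentiable_pi.2 fun i => ?_
  fin_cases i <;> simp [jacobiDouble] <;> fun_prop

theorem IsLocalJacobi.exists_isJacobiTheta {κ : ℂ} {s c d : ℂ → ℂ} (h : IsLocalJacobi κ s c d) :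
    ∃ S C D N : ℂ → ℂ, IsJacobiTheta κ S C D N ∧ ∀ᶠ z in 𝓝 0, S z = s z * N z := by
  have hs0 := h.s_zero
  have hsa := h.analytic_s
  have st : Tendsto s (𝓝 0) (𝓝 0) := by simpa [hs0] using hsa.continuousAt.tendsto
  have hla : AnalyticAt ℂ (fun z => Complex.log (1 - κ * s z ^ 4)) 0 :=
    AnalyticAt.clog (by fun_prop) (by simp [hs0])
  have hO : s =O[𝓝 0] fun z => z := by
    simpa [hs0] using hsa.differentiableAt.isBigO_sub
  obtain ⟨M, hM0, hM⟩ := hO.exists_nonneg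
  have ht : Tendsto (fun z => -(κ * s z ^ 4)) (𝓝 0) (𝓝 0) := by
    have : ContinuousAt (fun z => -(κ * s z ^ 4)) 0 := by
      have := hsa.continuousAt
      fun_prop
    simpa [hs0] using this.tendsto
  have hsmall : ∀ᶠ z in 𝓝 0, ‖-(κ * s z ^ 4)‖ ≤ 1 / 2 :=
    ht.norm.eventually (ge_mem_nhds (by norm_num))
  have hbd : ∀ᶠ z in 𝓝 0,
      ‖Complex.log (1 - κ * s z ^ 4)‖ ≤ (3 / 2 * (‖κ‖ * M ^ 4)) * ‖z‖ ^ 4 := by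
    filter_upwards [hsmall, hM.bound] with z h1 h2
    rw [sub_eq_add_neg]
    refine (Complex.norm_log_one_add_half_le_self h1).trans ?_
    rw [norm_neg, norm_mul, norm_pow]
    calc 3 / 2 * (‖κ‖ * ‖s z‖ ^ 4) ≤ 3 / 2 * (‖κ‖ * (M * ‖z‖) ^ 4) := by gcongr
      _ = _ := by ring
  obtain ⟨g, hga, hg0, hg⟩ := exists_analyticAt_double_eq hla hbd
  have hexp : ∀ᶠ z in 𝓝 0,
      Complex.exp (g (2 * z)) = Complex.exp (g z) ^ 4 * (1 - κ * s z ^ 4) := by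
    filter_upwards [hg, hsmall] with z h1 h2
    rw [h1, Complex.exp_add, Complex.exp_log, ← Complex.exp_nat_mul]
    · norm_num
    · intro h3
      rw [sub_eq_zero] at h3
      rw [← h3] at h2
      norm_num at h2
  set f : ℂ → Fin 4 → ℂ := fun z => ![s z * Complex.exp (g z), c z * Complex.exp (g z),
    d z * Complex.exp (g z), Complex.exp (g z)] with hf
  have hdouble : ∀ᶠ z in 𝓝 0, f (2 * z) = jacobiDouble κ (f z) := by
    filter_upwards [hexp, h.double_s, h.double_c, h.double_d] with z h1 h2 h3 h4
    ext i
    fin_cases i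
    · simp only [hf, jacobiDouble]
      simp
      rw [h1]; linear_combination Complex.exp (g z) ^ 4 * h2
    · simp only [hf, jacobiDouble]
      simp
      rw [h1]; linear_combination Complex.exp (g z) ^ 4 * h3
    · simp only [hf, jacobiDouble]
      simp
      rw [h1]; linear_combination Complex.exp (g z) ^ 4 * h4
    · simp only [hf, jacobiDouble]
      simp
      rw [h1]; ring
  obtain ⟨ρ, hρ, hb⟩ := Metric.eventually_nhds_iff_ball.1
    (hdouble.and (hsa.eventually_analyticAt.and (h.analytic_c.eventually_analyticAt.and
      (h.analytic_d.eventually_analyticAt.and hga.eventually_analyticAt))))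
  have hfd : DifferentiableOn ℂ f (Metric.ball 0 ρ) := by
    intro z hz
    obtain ⟨-, h1, h2, h3, h4⟩ := hb z hz
    have h1 := h1.differentiableAt
    have h2 := h2.differentiableAt
    have h3 := h3.differentiableAt
    have h4 := h4.differentiableAt
    refine (differentiableAt_pi.2 fun i => ?_).differentiableWithinAt
    fin_cases i <;> simp [hf] <;> fun_prop
  obtain ⟨F, hFd, hF2, hFf⟩ := exists_differentiable_semiconj (differentiable_jacobiDouble κ) hρ hfd
    (fun z hz => (hb z (by
      simp only [Metric.mem_ball, dist_zero_right, norm_mul, Complex.norm_ofNat] at hz ⊢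
      linarith [norm_nonneg z])).1)
  have hFi (i : Fin 4) : Differentiable ℂ fun z => F z i := differentiable_pi.1 hFd i
  have hev : ∀ᶠ z in 𝓝 0, F z = f z := by
    filter_upwards [Metric.ball_mem_nhds 0 hρ] with z hz using hFf hz
  have hF0 := hev.self_of_nhds
  have evN : ∀ᶠ z in 𝓝 0, F z 3 = Complex.exp (g z) := hev.mono fun z hz => by simp [hz, hf]
  have evS : ∀ᶠ z in 𝓝 0, F z 0 = s z * F z 3 := hev.mono fun z hz => by simp [hz, hf]
  have evC : ∀ᶠ z in 𝓝 0, F z 1 = c z * F z 3 := hev.mono fun z hz => by simp [hz, hf]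
  have evD : ∀ᶠ z in 𝓝 0, F z 2 = d z * F z 3 := hev.mono fun z hz => by simp [hz, hf]
  have wron {a a' : ℂ → ℂ} (i : Fin 4) (ha : ∀ᶠ z in 𝓝 0, HasDerivAt a (a' z) z)
      (hi : ∀ᶠ z in 𝓝 0, F z i = a z * F z 3) :
      ∀ᶠ z in 𝓝 0, deriv (fun z => F z i) z * F z 3 - F z i * deriv (fun z => F z 3) z
        = a' z * F z 3 ^ 2 := by
    filter_upwards [ha, hi.eventually_nhds] with z h1 h2
    have h3 := (h1.fun_mul (hFi 3 z).hasDerivAt).congr_of_eventuallyEq h2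
    rw [h3.deriv, h2.self_of_nhds]
    ring
  refine ⟨fun z => F z 0, fun z => F z 1, fun z => F z 2, fun z => F z 3,
    ⟨hFi 0, hFi 1, hFi 2, hFi 3, ?_, ?_, ?_, ?_, ?_, ?_, ?_, ?_, ?_, ?_, ?_, ?_, ?_⟩, evS⟩
  · simp [hF0, hf, hs0]
  · simp [hF0, hf, h.c_zero, hg0]
  · simp [hF0, hf, h.d_zero, hg0]
  · simp [hF0, hf, hg0]
  · intro z; simp [hF2, jacobiDouble]
  · intro z; simp [hF2, jacobiDouble]
  · intro z; simp [hF2, jacobiDouble]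
  · intro z; simp [hF2, jacobiDouble]
  · refine fun z => congrFun (Differentiable.eq_of_eventually_eq (z₀ := 0) ((hFi 1).pow 2)
      (((hFi 3).pow 2).sub ((hFi 0).pow 2)) ?_) z
    filter_upwards [evS, evC, h.sq_c] with z h1 h2 h3
    simp only [Pi.pow_apply, Pi.sub_apply]
    rw [h1, h2, mul_pow, h3]; ring
  · refine fun z => congrFun (Differentiable.eq_of_eventually_eq (z₀ := 0) ((hFi 2).pow 2)
      (((hFi 3).pow 2).sub (((hFi 0).pow 2).const_mul κ)) ?_) z
    filter_upwards [evS, evD, h.sq_d] with z h1 h2 h3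
    simp only [Pi.pow_apply, Pi.sub_apply]
    rw [h1, h2, mul_pow, h3]; ring
  · refine fun z => congrFun (Differentiable.eq_of_eventually_eq (z₀ := 0)
      (((hFi 0).deriv.mul (hFi 3)).sub ((hFi 0).mul (hFi 3).deriv)) ((hFi 1).mul (hFi 2)) ?_) z
    filter_upwards [evC, evD, wron 0 h.deriv_s evS] with z h1 h2 h3
    simp only [Pi.mul_apply, Pi.sub_apply]
    rw [h3, h1, h2]; ring
  · refine fun z => congrFun (Differentiable.eq_of_eventually_eq (z₀ := 0)
      (((hFi 1).deriv.mul (hFi 3)).sub ((hFi 1).mul (hFi 3).deriv)) ((hFi 0).mul (hFi 2)).neg ?_) z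
    filter_upwards [evS, evD, wron 1 h.deriv_c evC] with z h1 h2 h3
    simp only [Pi.mul_apply, Pi.sub_apply, Pi.neg_apply]
    rw [h3, h1, h2]; ring
  · refine fun z => congrFun (Differentiable.eq_of_eventually_eq (z₀ := 0)
      (((hFi 2).deriv.mul (hFi 3)).sub ((hFi 2).mul (hFi 3).deriv))
      (((hFi 0).const_mul κ).mul (hFi 1)).neg ?_) z
    filter_upwards [evS, evC, wron 2 h.deriv_d evD] with z h1 h2 h3
    simp only [Pi.mul_apply, Pi.sub_apply, Pi.neg_apply]
    rw [h3, h1, h2]; ring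

namespace IsJacobiTheta

variable {κ : ℂ} {S C D N : ℂ → ℂ}

lemma exists_norm_le_exp (h : IsJacobiTheta κ S C D N) (hκ : ‖κ‖ ≤ 1) :
    ∃ B : ℝ, 0 ≤ B ∧ ∀ R : ℝ, 1 ≤ R → ∀ z, ‖z‖ ≤ R →
      ‖S z‖ ≤ Real.exp (B * R ^ 2) ∧ ‖N z‖ ≤ Real.exp (B * R ^ 2) := by
  set F : ℂ → Fin 4 → ℂ := fun z => ![S z, C z, D z, N z] with hF
  have hc : Continuous F := by
    have h1 := h.diff_S.continuous
    have h2 := h.diff_C.continuous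
    have h3 := h.diff_D.continuous
    have h4 := h.diff_N.continuous
    refine continuous_pi fun i => ?_
    fin_cases i <;> simpa [hF]
  have hd (z : ℂ) : ‖F (2 * z)‖ ≤ 2 * ‖F z‖ ^ 4 := by
    have h0 : ‖S z‖ ≤ ‖F z‖ := norm_le_pi_norm (F z) 0
    have h1 : ‖C z‖ ≤ ‖F z‖ := norm_le_pi_norm (F z) 1
    have h2 : ‖D z‖ ≤ ‖F z‖ := norm_le_pi_norm (F z) 2
    have h3 : ‖N z‖ ≤ ‖F z‖ := norm_le_pi_norm (F z) 3
    generalize ‖F z‖ = b at *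
    have hb : 0 ≤ b := (norm_nonneg _).trans h0
    have quad {x y : ℂ} (hx : ‖x‖ ≤ b ^ 4) (hy : ‖y‖ ≤ b ^ 4) : ‖x - y‖ ≤ 2 * b ^ 4 :=
      (norm_sub_le _ _).trans (by linarith)
    have prod {x y : ℂ} (hx : ‖x‖ ≤ b) (hy : ‖y‖ ≤ b) : ‖x ^ 2 * y ^ 2‖ ≤ b ^ 4 := by
      rw [norm_mul, norm_pow, norm_pow, show b ^ 4 = b ^ 2 * b ^ 2 by ring]
      gcongr
    have hκ' {x : ℂ} (hx : ‖x‖ ≤ b ^ 4) : ‖κ * x‖ ≤ b ^ 4 := by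
      rw [norm_mul]
      exact (mul_le_of_le_one_left (norm_nonneg _) hκ).trans hx
    refine (pi_norm_le_iff_of_nonneg (by positivity)).2 fun i => ?_
    fin_cases i
    · change ‖S (2 * z)‖ ≤ _
      rw [h.double_S]
      simp only [norm_mul, Complex.norm_ofNat]
      calc 2 * ‖S z‖ * ‖C z‖ * ‖D z‖ * ‖N z‖ ≤ 2 * b * b * b * b := by gcongr
        _ = _ := by ring
    · change ‖C (2 * z)‖ ≤ _
      rw [h.double_C]
      exact quad (prod h1 h3) (prod h0 h2)
    · change ‖D (2 * z)‖ ≤ _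
      rw [h.double_D, mul_assoc κ]
      exact quad (prod h2 h3) (hκ' (prod h0 h1))
    · change ‖N (2 * z)‖ ≤ _
      rw [h.double_N]
      refine quad ?_ (hκ' ?_) <;> rw [norm_pow] <;> gcongr
  obtain ⟨B, hB0, hB⟩ := exists_norm_le_exp_sq hc hd
  exact ⟨B, hB0, fun R hR z hz => ⟨(norm_le_pi_norm (F z) 0).trans (hB R hR z hz),
    (norm_le_pi_norm (F z) 3).trans (hB R hR z hz)⟩⟩

lemma N_ne_zero_of_S_eq_zero (h : IsJacobiTheta κ S C D N) (hκ0 : κ ≠ 0) (hκ1 : κ ≠ 1) {z : ℂ}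
    (hS : S z = 0) : N z ≠ 0 := by
  intro hN
  have step (z : ℂ) (h0 : S (2 * z) = 0 ∧ N (2 * z) = 0) : S z = 0 ∧ N z = 0 := by
    obtain ⟨h1, h2⟩ := h0
    rw [h.double_S] at h1
    rw [h.double_N] at h2
    have hc := h.sq_C z
    have hd := h.sq_D z
    have key : S z = 0 := by
      rcases mul_eq_zero.1 h1 with h1 | h1
      · rcases mul_eq_zero.1 h1 with h1 | h1
        · rcases mul_eq_zero.1 h1 with h1 | h1
          · simpa using h1
          · have : (1 - κ) * S z ^ 4 = 0 := by
              rw [h1] at hc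
              linear_combination h2 + (N z ^ 2 + S z ^ 2) * hc
            exact eq_zero_of_pow_eq_zero
              ((mul_eq_zero.1 this).resolve_left (sub_ne_zero.2 hκ1.symm))
        · have : κ * (κ - 1) * S z ^ 4 = 0 := by
            rw [h1] at hd
            linear_combination h2 + (N z ^ 2 + κ * S z ^ 2) * hd
          exact eq_zero_of_pow_eq_zero
            ((mul_eq_zero.1 this).resolve_left (mul_ne_zero hκ0 (sub_ne_zero.2 hκ1)))
      · have : κ * S z ^ 4 = 0 := by
          rw [h1] at h2
          linear_combination -h2
        exact eq_zero_of_pow_eq_zero ((mul_eq_zero.1 this).resolve_left hκ0)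
    refine ⟨key, ?_⟩
    rw [key] at h2
    simpa using h2
  have hn (n : ℕ) : S (z / 2 ^ n) = 0 ∧ N (z / 2 ^ n) = 0 := by
    induction n with
    | zero => simpa using ⟨hS, hN⟩
    | succ n ih =>
      apply step
      have e : 2 * (z / 2 ^ (n + 1)) = z / 2 ^ n := by
        rw [pow_succ' (2 : ℂ)]; field_simp
      rwa [e]
  have ht : Tendsto (fun n : ℕ => z / 2 ^ n) atTop (𝓝 0) := by
    have := (tendsto_pow_atTop_nhds_zero_of_norm_lt_one (x := (1 / 2 : ℂ))
      (by norm_num)).const_mul z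
    simpa [div_eq_mul_inv] using this
  have h1 := (h.diff_N.continuous.tendsto 0).comp ht
  have h2 : Tendsto (N ∘ fun n : ℕ => z / 2 ^ n) atTop (𝓝 0) :=
    tendsto_const_nhds.congr fun n => (hn n).2.symm
  exact one_ne_zero (h.N_zero.symm.trans (tendsto_nhds_unique h1 h2))

/-- If `S = N` at the quarter period `K`, then `4K` is a common period point of `sn, cn, dn`. -/
lemma four_mul (h : IsJacobiTheta κ S C D N) {K : ℂ} (hK : S K = N K) :
    S (4 * K) = 0 ∧ C (4 * K) = N (4 * K) ∧ D (4 * K) = N (4 * K) := by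
  have hC : C K = 0 := by
    have := h.sq_C K
    rw [hK, sub_self] at this
    exact eq_zero_of_pow_eq_zero this
  have hD := h.sq_D K
  have e : 4 * K = 2 * (2 * K) := by ring
  have hS2 : S (2 * K) = 0 := by rw [h.double_S, hC]; ring
  have hC2 := h.double_C K
  have hD2 := h.double_D K
  have hN2 := h.double_N K
  have hC2' : C (2 * K) = - N (2 * K) := by
    rw [hC2, hN2, hD, hC, hK]; ring
  have hD2' : D (2 * K) = N (2 * K) := by
    rw [hD2, hN2, hD, hC, hK]; ring
  rw [e, h.double_S (2 * K), h.double_C (2 * K), h.double_D (2 * K), h.double_N (2 * K), hS2,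
    hC2', hD2']
  refine ⟨?_, ?_, ?_⟩ <;> ring

lemma two_pow_mul (h : IsJacobiTheta κ S C D N) {w : ℂ} (hS : S w = 0) (hC : C w = N w)
    (hD : D w = N w) (l : ℕ) :
    S (2 ^ l * w) = 0 ∧ C (2 ^ l * w) = N (2 ^ l * w) ∧ D (2 ^ l * w) = N (2 ^ l * w) := by
  induction l with
  | zero => simpa using ⟨hS, hC, hD⟩
  | succ l ih =>
    obtain ⟨h1, h2, h3⟩ := ih
    rw [pow_succ', mul_assoc, h.double_S, h.double_C, h.double_D, h.double_N, h1, h2, h3]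
    refine ⟨?_, ?_, ?_⟩ <;> ring

end IsJacobiTheta

lemma one_sub_mul_sq_mem_slitPlane {κ x : ℂ} (hκ : ‖κ‖ ≤ 1) (hx : ‖x‖ < 1) :
    1 - κ * x ^ 2 ∈ Complex.slitPlane := by
  refine Complex.mem_slitPlane_iff.2 (Or.inl ?_)
  have h1 : ‖κ * x ^ 2‖ < 1 := by
    rw [norm_mul, norm_pow]
    have : ‖x‖ ^ 2 < 1 := pow_lt_one₀ (norm_nonneg _) hx two_ne_zero
    nlinarith [norm_nonneg κ, sq_nonneg ‖x‖]
  have h2 := Complex.re_le_norm (κ * x ^ 2)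
  simp only [Complex.sub_re, Complex.one_re]
  linarith

lemma ofReal_cpow_two_inv {x : ℝ} (hx : 0 ≤ x) : (x : ℂ) ^ (2⁻¹ : ℂ) = (Real.sqrt x : ℝ) := by
  rw [Real.sqrt_eq_rpow, Complex.ofReal_cpow hx]
  norm_num

/-- The real elliptic integral of the first kind extends holomorphically to the unit disc. -/
lemma exists_ellipticIntegral_extension {κ : ℝ} (hκ : ‖(κ : ℂ)‖ ≤ 1) {u : ℝ → ℝ} (hu0 : u 0 = 0)
    (hu : ∀ x ∈ Set.Ioo (-1 : ℝ) 1,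
      HasDerivAt u (1 / (Real.sqrt (1 - x ^ 2) * Real.sqrt (1 - κ * x ^ 2))) x) :
    ∃ U : ℂ → ℂ, (∀ x ∈ Metric.ball (0 : ℂ) 1, HasDerivAt U
      (1 / ((1 - 1 * x ^ 2) ^ (2⁻¹ : ℂ) * (1 - (κ : ℂ) * x ^ 2) ^ (2⁻¹ : ℂ))) x) ∧
      ∀ x ∈ Set.Ioo (-1 : ℝ) 1, U x = u x := by
  have hd : DifferentiableOn ℂ (fun x : ℂ =>
      1 / ((1 - 1 * x ^ 2) ^ (2⁻¹ : ℂ) * (1 - (κ : ℂ) * x ^ 2) ^ (2⁻¹ : ℂ)))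
      (Metric.ball 0 1) := by
    intro x hx
    have hx' : ‖x‖ < 1 := by simpa using hx
    have h1 := one_sub_mul_sq_mem_slitPlane (κ := 1) (by simp) hx'
    have h2 := one_sub_mul_sq_mem_slitPlane hκ hx'
    refine (DifferentiableAt.div (differentiableAt_const _)
      ((analyticAt_sqrt_one_sub 1 x h1).differentiableAt.mul
      (analyticAt_sqrt_one_sub κ x h2).differentiableAt) ?_).differentiableWithinAt
    refine mul_ne_zero ?_ ?_
    · exact fun h => Complex.slitPlane_ne_zero h1 ((Complex.cpow_eq_zero_iff _ _).1 h).1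
    · exact fun h => Complex.slitPlane_ne_zero h2 ((Complex.cpow_eq_zero_iff _ _).1 h).1
  obtain ⟨U, hU0, hU⟩ := hd.isExactOn_ball.with_val_at 0 0
  refine ⟨U, hU, fun x hx => ?_⟩
  have hderiv : ∀ y ∈ Set.Ioo (-1 : ℝ) 1, HasDerivAt (fun y : ℝ => U y - u y) 0 y := by
    intro y hy
    have hyb : ((y : ℝ) : ℂ) ∈ Metric.ball (0 : ℂ) 1 := by
      simpa [abs_lt] using hy
    have h1 := (hU _ hyb).comp_ofReal
    have h2 := (hu y hy).ofReal_comp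
    refine (h1.sub h2).congr_deriv ?_
    have hy2 : y ^ 2 ≤ 1 := by nlinarith [hy.1, hy.2]
    have hκ' : |κ| ≤ 1 := by simpa using hκ
    have e1 : (1 - 1 * (y : ℂ) ^ 2) = ((1 - y ^ 2 : ℝ) : ℂ) := by push_cast; ring
    have e2 : (1 - (κ : ℂ) * (y : ℂ) ^ 2) = ((1 - κ * y ^ 2 : ℝ) : ℂ) := by push_cast; ring
    rw [e1, e2, ofReal_cpow_two_inv (by linarith),
      ofReal_cpow_two_inv (by nlinarith [(abs_le.1 hκ').2, sq_nonneg y])]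
    push_cast
    ring
  have hconst := (convex_Ioo (-1 : ℝ) 1).is_const_of_fderivWithin_eq_zero (𝕜 := ℝ)
    (f := fun y : ℝ => U y - u y)
    (fun y hy => (hderiv y hy).differentiableAt.differentiableWithinAt)
    (fun y hy => by
      rw [fderivWithin_of_isOpen isOpen_Ioo hy]
      have := (hderiv y hy).hasFDerivAt.fderiv
      rw [this]; ext; simp) hx (show (0 : ℝ) ∈ Set.Ioo (-1 : ℝ) 1 by norm_num)
  simp only [Complex.ofReal_zero, hU0, hu0, sub_zero] at hconst
  exact sub_eq_zero.1 hconst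

/-- The complete elliptic integral is the quarter period of the Jacobi functions. -/
theorem exists_isJacobiTheta_four_mul {κ K : ℝ} (hκ : |κ| ≤ 1) {u : ℝ → ℝ}
    (hu0 : u 0 = 0)
    (hu : ∀ x ∈ Set.Ioo (-1 : ℝ) 1,
      HasDerivAt u (1 / (Real.sqrt (1 - x ^ 2) * Real.sqrt (1 - κ * x ^ 2))) x)
    (hK : Tendsto u (𝓝[<] 1) (𝓝 K)) :
    ∃ S C D N : ℂ → ℂ, IsJacobiTheta κ S C D N ∧ S (4 * K) = 0 ∧
      C (4 * K) = N (4 * K) ∧ D (4 * K) = N (4 * K) := by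
  obtain ⟨U, hU, hUu⟩ := exists_ellipticIntegral_extension (by simpa using hκ) hu0 hu
  have hb : Metric.ball (0 : ℂ) 1 ∈ 𝓝 (0 : ℂ) := Metric.ball_mem_nhds _ one_pos
  have hdU : DifferentiableOn ℂ U (Metric.ball 0 1) :=
    fun x hx => (hU x hx).differentiableAt.differentiableWithinAt
  have hU0 : U 0 = 0 := by simpa [hu0] using hUu 0 (by norm_num)
  obtain ⟨s, c, d, hloc, hs⟩ := exists_isLocalJacobi (hdU.analyticAt hb) hU0
    (eventually_of_mem hb hU)
  obtain ⟨S, C, D, N, h, hSN⟩ := hloc.exists_isJacobiTheta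
  refine ⟨S, C, D, N, h, h.four_mul ?_⟩
  have hUt : Tendsto U (𝓝 0) (𝓝 0) := by
    simpa [hU0] using (hU 0 (by simp)).continuousAt.tendsto
  have hev : ∀ᶠ x in 𝓝 (0 : ℂ), S (U x) = x * N (U x) := by
    filter_upwards [hs, hUt.eventually hSN] with x h1 h2
    rw [h2, h1]
  have hEq : Set.EqOn (fun x => S (U x)) (fun x => x * N (U x)) (Metric.ball 0 1) := by
    refine AnalyticOnNhd.eqOn_of_preconnected_of_eventuallyEq (𝕜 := ℂ) (z₀ := 0) ?_ ?_
      (convex_ball _ _).isPreconnected (by simp) hev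
    · exact (h.diff_S.comp_differentiableOn hdU).analyticOnNhd Metric.isOpen_ball
    · exact (differentiableOn_id.mul (h.diff_N.comp_differentiableOn hdU)).analyticOnNhd
        Metric.isOpen_ball
  have hlim : Tendsto (fun x : ℝ => (u x : ℂ)) (𝓝[<] 1) (𝓝 K) :=
    (Complex.continuous_ofReal.tendsto K).comp hK
  have hid : Tendsto (fun x : ℝ => (x : ℂ)) (𝓝[<] 1) (𝓝 1) :=
    (Complex.continuous_ofReal.tendsto' 1 1 (by simp)).mono_left nhdsWithin_le_nhds
  have t1 := (h.diff_S.continuous.tendsto K).comp hlim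
  have t2 := hid.mul ((h.diff_N.continuous.tendsto K).comp hlim)
  rw [one_mul] at t2
  refine tendsto_nhds_unique t1 (t2.congr' ?_)
  filter_upwards [Ioo_mem_nhdsLT (show (-1 : ℝ) < 1 by norm_num)] with x hx
  have := hEq (x := (x : ℂ)) (by simpa [abs_lt] using hx)
  simpa [hUu x hx] using this.symm

section Jet

variable {R : Type*} [CommRing R]

/-- The `t`-th derivative of `z ^ i * sn ^ a * cn ^ b * dn ^ c` (parameter `κ`) at a period point
`w`, where `sn, cn, dn` take the values `0, 1, 1`. -/
def jacobiJet (κ w : R) : ℕ → ℕ → ℕ → ℕ → ℕ → R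
  | 0, i, a, _, _ => w ^ i * 0 ^ a
  | t + 1, i, a, b, c =>
    i * jacobiJet κ w t (i - 1) a b c + a * jacobiJet κ w t i (a - 1) (b + 1) (c + 1)
      - b * jacobiJet κ w t i (a + 1) (b - 1) (c + 1)
      - c * κ * jacobiJet κ w t i (a + 1) (b + 1) (c - 1)

lemma map_jacobiJet {R' : Type*} [CommRing R'] (φ : R →+* R') (κ w : R) (t i a b c : ℕ) :
    φ (jacobiJet κ w t i a b c) = jacobiJet (φ κ) (φ w) t i a b c := by
  induction t generalizing i a b c with
  | zero => simp [jacobiJet]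
  | succ t ih => simp [jacobiJet, ih]

lemma isIntegral_pow_mul_jacobiJet {κ w : R} {q : ℤ} (hκ : IsIntegral ℤ (q * κ))
    (hw : IsIntegral ℤ (q * w)) (t i a b c k : ℕ) (hk : i + t ≤ k) :
    IsIntegral ℤ ((q : R) ^ k * jacobiJet κ w t i a b c) := by
  have hq (n : ℕ) : IsIntegral ℤ ((q : R) ^ n) := by
    simpa using (isIntegral_algebraMap (R := ℤ) (A := R) (x := q)).pow n
  have hn (n : ℕ) : IsIntegral ℤ (n : R) := by
    simpa using isIntegral_algebraMap (R := ℤ) (A := R) (x := n)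
  induction t generalizing i a b c k with
  | zero =>
    obtain ⟨l, rfl⟩ := Nat.exists_eq_add_of_le hk
    have h0 : IsIntegral ℤ ((0 : R) ^ a) := isIntegral_zero.pow a
    have e : (q : R) ^ (i + 0 + l) * jacobiJet κ w 0 i a b c
        = (q : R) ^ l * (q * w) ^ i * 0 ^ a := by
      simp only [jacobiJet]; ring
    rw [e]
    exact ((hq l).mul (hw.pow i)).mul h0
  | succ t ih =>
    obtain ⟨k, rfl⟩ : ∃ k', k = k' + 1 := ⟨k - 1, by omega⟩
    have e : (q : R) ^ (k + 1) * jacobiJet κ w (t + 1) i a b c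
        = i * (q ^ (k + 1) * jacobiJet κ w t (i - 1) a b c)
          + a * (q ^ (k + 1) * jacobiJet κ w t i (a - 1) (b + 1) (c + 1))
          - b * (q ^ (k + 1) * jacobiJet κ w t i (a + 1) (b - 1) (c + 1))
          - c * (q * κ) * (q ^ k * jacobiJet κ w t i (a + 1) (b + 1) (c - 1)) := by
      simp only [jacobiJet]; ring
    rw [e]
    refine (((hn i).mul (ih _ _ _ _ _ (by omega))).add ((hn a).mul (ih _ _ _ _ _ (by omega)))
      |>.sub ((hn b).mul (ih _ _ _ _ _ (by omega)))).sub
      (((hn c).mul hκ).mul (ih _ _ _ _ _ (by omega)))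

lemma house_jacobiJet_le {K : Type*} [Field K] [NumberField K] {κ w : K} {B : ℝ} (hB : 1 ≤ B)
    (hκ : NumberField.house κ ≤ B) (hw : NumberField.house w ≤ B) (t i a b c : ℕ) :
    NumberField.house (jacobiJet κ w t i a b c)
      ≤ B ^ (i + t) * (i + a + b + c + t : ℝ) ^ t := by
  have hB0 : 0 ≤ B := zero_le_one.trans hB
  have hneg (x : K) : NumberField.house (-x) = NumberField.house x := by
    simp [NumberField.house]
  have hone (k : ℕ) : NumberField.house ((k : K)) = k := by
    simpa using NumberField.house_intCast (K := K) (k : ℤ)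
  induction t generalizing i a b c with
  | zero =>
    simp only [jacobiJet, pow_zero, mul_one, add_zero]
    refine (NumberField.house_mul_le _ _).trans ?_
    have h1 : NumberField.house ((0 : K) ^ a) ≤ 1 := by
      rcases Nat.eq_zero_or_pos a with rfl | ha
      · simpa using (hone 1).le
      · rw [zero_pow ha.ne']
        simpa using (hone 0).le.trans (by simp)
    calc NumberField.house (w ^ i) * NumberField.house ((0 : K) ^ a)
        ≤ B ^ i * 1 := by
          gcongr
          · exact NumberField.house_nonneg _
          · exact (NumberField.house_pow_le _ _).trans
              (pow_le_pow_left₀ (NumberField.house_nonneg _) hw i)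
      _ = B ^ i := mul_one _
  | succ t ih =>
    set Q : ℝ := i + a + b + c + (t + 1) with hQ
    have key (x : K) (k i' a' b' c' : ℕ) (e : ℕ) (hx : NumberField.house x ≤ B ^ e)
        (h : k = 0 ∨ (i' + e ≤ i + 1 ∧ i' + a' + b' + c' ≤ i + a + b + c + 1)) :
        NumberField.house (k * x * jacobiJet κ w t i' a' b' c')
          ≤ k * (B ^ (i + t + 1) * Q ^ t) := by
      rw [mul_assoc, NumberField.house_nat_mul]
      rcases h with rfl | ⟨h1, h2⟩
      · simp
      refine mul_le_mul_of_nonneg_left ?_ (Nat.cast_nonneg k)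
      refine (NumberField.house_mul_le _ _).trans ?_
      have h2' : (i' + a' + b' + c' : ℝ) ≤ i + a + b + c + 1 := by exact_mod_cast h2
      calc NumberField.house x * NumberField.house (jacobiJet κ w t i' a' b' c')
          ≤ B ^ e * (B ^ (i' + t) * (i' + a' + b' + c' + t : ℝ) ^ t) := by
            gcongr
            · exact NumberField.house_nonneg _
            · exact ih _ _ _ _
        _ = B ^ (e + (i' + t)) * (i' + a' + b' + c' + t : ℝ) ^ t := by ring
        _ ≤ B ^ (i + t + 1) * Q ^ t := by
            gcongr ?_ * ?_ ^ t
            · exact pow_le_pow_right₀ hB (by omega)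
            · linarith
    have h1 : NumberField.house (1 : K) ≤ B ^ 0 := by simpa using (hone 1).le
    have e1 := key 1 i (i - 1) a b c 0 h1 (by omega)
    have e2 := key 1 a i (a - 1) (b + 1) (c + 1) 0 h1 (by omega)
    have e3 := key 1 b i (a + 1) (b - 1) (c + 1) 0 h1 (by omega)
    have e4 := key κ c i (a + 1) (b + 1) (c - 1) 1 (by simpa using hκ) (by omega)
    simp only [mul_one] at e1 e2 e3
    simp only [jacobiJet, sub_eq_add_neg]
    refine (NumberField.house_add_le _ _).trans ?_
    grw [NumberField.house_add_le, NumberField.house_add_le, hneg, hneg, e1, e2, e3, e4]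
    have hsum : (i + a + b + c : ℝ) ≤ Q := by rw [hQ]; linarith [(Nat.cast_nonneg t : (0 : ℝ) ≤ t)]
    calc _ = (i + a + b + c : ℝ) * (B ^ (i + t + 1) * Q ^ t) := by ring
      _ ≤ Q * (B ^ (i + t + 1) * Q ^ t) := by gcongr
      _ = _ := by rw [hQ]; push_cast; ring

end Jet

lemma iteratedDeriv_jacobi_monomial {κ w : ℂ} {s c d : ℂ → ℂ} (hs : AnalyticAt ℂ s w)
    (hc : AnalyticAt ℂ c w) (hd : AnalyticAt ℂ d w) (hs0 : s w = 0) (hc0 : c w = 1)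
    (hd0 : d w = 1) (hs' : ∀ᶠ z in 𝓝 w, deriv s z = c z * d z)
    (hc' : ∀ᶠ z in 𝓝 w, deriv c z = -(s z * d z))
    (hd' : ∀ᶠ z in 𝓝 w, deriv d z = -(κ * s z * c z)) (t i j k l : ℕ) :
    iteratedDeriv t (fun z => z ^ i * s z ^ j * c z ^ k * d z ^ l) w
      = jacobiJet κ w t i j k l := by
  induction t generalizing i j k l with
  | zero => simp [jacobiJet, hs0, hc0, hd0]
  | succ t ih =>
    rw [iteratedDeriv_succ']
    have hder : deriv (fun z => z ^ i * s z ^ j * c z ^ k * d z ^ l) =ᶠ[𝓝 w] fun z =>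
        (i : ℂ) * (z ^ (i - 1) * s z ^ j * c z ^ k * d z ^ l)
        + (j : ℂ) * (z ^ i * s z ^ (j - 1) * c z ^ (k + 1) * d z ^ (l + 1))
        + (-k : ℂ) * (z ^ i * s z ^ (j + 1) * c z ^ (k - 1) * d z ^ (l + 1))
        + (-(l * κ) : ℂ) * (z ^ i * s z ^ (j + 1) * c z ^ (k + 1) * d z ^ (l - 1)) := by
      filter_upwards [hs.eventually_analyticAt, hc.eventually_analyticAt,
        hd.eventually_analyticAt, hs', hc', hd'] with z as ac ad h1 h2 h3
      have ds := as.differentiableAt.hasDerivAt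
      have dc := ac.differentiableAt.hasDerivAt
      have dd := ad.differentiableAt.hasDerivAt
      rw [h1] at ds
      rw [h2] at dc
      rw [h3] at dd
      have := ((((hasDerivAt_id z).fun_pow i).fun_mul (ds.fun_pow j)).fun_mul
        (dc.fun_pow k)).fun_mul (dd.fun_pow l)
      simp only [id] at this
      rw [this.deriv]
      ring
    rw [hder.iteratedDeriv_eq, iteratedDeriv_fun_add, iteratedDeriv_fun_add, iteratedDeriv_fun_add,
      iteratedDeriv_const_mul_field, iteratedDeriv_const_mul_field, iteratedDeriv_const_mul_field,
      iteratedDeriv_const_mul_field, ih, ih, ih, ih, jacobiJet]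
    · ring
    all_goals
      have h1 := hs.contDiffAt (n := t)
      have h2 := hc.contDiffAt (n := t)
      have h3 := hd.contDiffAt (n := t)
      fun_prop

lemma iteratedDeriv_sub_pow_mul {f : ℂ → ℂ} {w : ℂ} (hf : AnalyticAt ℂ f w) (k : ℕ) :
    iteratedDeriv k (fun z => (z - w) ^ k * f z) w = k.factorial * f w := by
  induction k generalizing f with
  | zero => simp
  | succ k ih =>
    rw [iteratedDeriv_succ']
    have hder : deriv (fun z => (z - w) ^ (k + 1) * f z) =ᶠ[𝓝 w]
        fun z => (z - w) ^ k * ((k + 1) * f z + (z - w) * deriv f z) := by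
      filter_upwards [hf.eventually_analyticAt] with z hz
      have := (((hasDerivAt_id z).sub_const w).fun_pow (k + 1)).fun_mul
        hz.differentiableAt.hasDerivAt
      simp only [id] at this
      rw [this.deriv]
      push_cast [Nat.add_sub_cancel]
      ring
    have hf' := hf.deriv
    rw [hder.iteratedDeriv_eq, ih (by fun_prop), Nat.factorial_succ]
    push_cast
    ring

lemma exists_eq_sub_pow_mul {G : ℂ → ℂ} (hG : Differentiable ℂ G) {w : ℂ} {k : ℕ}
    (h : (k : ℕ∞) ≤ analyticOrderAt G w) :
    ∃ H : ℂ → ℂ, Differentiable ℂ H ∧ ∀ z, G z = (z - w) ^ k * H z := by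
  induction k generalizing G with
  | zero => exact ⟨G, hG, by simp⟩
  | succ k ih =>
    have hdiff : Differentiable ℂ (dslope G w) := by
      rw [← differentiableOn_univ, Complex.differentiableOn_dslope univ_mem]
      exact hG.differentiableOn
    have hGw : G w = 0 := by
      apply apply_eq_zero_of_analyticOrderAt_ne_zero
      intro h0
      rw [h0] at h
      simp at h
    have e : G = (fun z => z - w) * dslope G w := by
      ext z
      have := sub_smul_dslope G w z
      rw [hGw, sub_zero, smul_eq_mul] at this
      exact this.symm
    have hord : analyticOrderAt (fun z => z - w) w = 1 := by
      have : AnalyticAt ℂ (fun z => z - w) w := by fun_prop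
      rw [show (1 : ℕ∞) = ((1 : ℕ) : ℕ∞) by rfl, this.analyticOrderAt_eq_natCast]
      exact ⟨fun _ => 1, analyticAt_const, one_ne_zero, by simp⟩
    rw [e, analyticOrderAt_mul (by fun_prop) (hdiff.analyticAt w), hord, add_comm] at h
    push_cast at h
    obtain ⟨H, hH, hH'⟩ := ih hdiff ((ENat.add_le_add_iff_left (by simp)).1 h)
    refine ⟨H, hH, fun z => ?_⟩
    rw [e, Pi.mul_apply, hH']
    ring

lemma exists_eq_prod_sub_pow_mul {ι : Type*} {G : ℂ → ℂ} (hG : Differentiable ℂ G)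
    (w : ι → ℂ) (hw : Function.Injective w) (s : Finset ι) {k : ℕ}
    (h : ∀ l ∈ s, (k : ℕ∞) ≤ analyticOrderAt G (w l)) :
    ∃ H : ℂ → ℂ, Differentiable ℂ H ∧ ∀ z, G z = (∏ l ∈ s, (z - w l) ^ k) * H z := by
  classical
  induction s using Finset.induction_on with
  | empty => exact ⟨G, hG, by simp⟩
  | insert a s ha ih =>
    obtain ⟨H, hH, e⟩ := ih fun l hl => h l (Finset.mem_insert_of_mem hl)
    have hP : AnalyticAt ℂ (fun z => ∏ l ∈ s, (z - w l) ^ k) (w a) := by fun_prop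
    have hP0 : analyticOrderAt (fun z => ∏ l ∈ s, (z - w l) ^ k) (w a) = 0 := by
      rw [hP.analyticOrderAt_eq_zero, Finset.prod_ne_zero_iff]
      exact fun l hl => pow_ne_zero _ (sub_ne_zero.2 fun h => ha (hw h ▸ hl))
    have ha' := h a (Finset.mem_insert_self _ _)
    rw [show G = (fun z => ∏ l ∈ s, (z - w l) ^ k) * H from funext e,
      analyticOrderAt_mul hP (hH.analyticAt _), hP0, zero_add] at ha'
    obtain ⟨H', hH', e'⟩ := exists_eq_sub_pow_mul hH ha'
    refine ⟨H', hH', fun z => ?_⟩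
    rw [e, e', Finset.prod_insert ha]
    ring

/-- **Schwarz's lemma** for entire functions with many zeros of order `k`, bounding the first
possibly nonzero derivative at one of the zeros. -/
lemma norm_iteratedDeriv_le_of_zeros {n : ℕ} {G : ℂ → ℂ} (hG : Differentiable ℂ G)
    (w : Fin n → ℂ) (hw : Function.Injective w) {k : ℕ}
    (h : ∀ l, (k : ℕ∞) ≤ analyticOrderAt G (w l)) {R M P : ℝ} (hR : 0 < R)
    (hwR : ∀ l, ‖w l‖ ≤ R / 2) (hGM : ∀ z, ‖z‖ ≤ R → ‖G z‖ ≤ M) (l : Fin n)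
    (hP : ∏ l' ∈ Finset.univ.erase l, ‖w l - w l'‖ ≤ P) :
    ‖iteratedDeriv k G (w l)‖ ≤ k.factorial * P ^ k * (M / (R / 2) ^ (n * k)) := by
  obtain ⟨H, hH, e⟩ := exists_eq_prod_sub_pow_mul hG w hw Finset.univ fun l _ => h l
  have hHb : ‖H (w l)‖ ≤ M / (R / 2) ^ (n * k) := by
    refine Complex.norm_le_of_forall_mem_frontier_norm_le (U := Metric.ball 0 R)
      Metric.isBounded_ball hH.diffContOnCl (fun z hz => ?_) (subset_closure ?_)
    · rw [frontier_ball _ hR.ne', mem_sphere_zero_iff_norm] at hz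
      rw [le_div_iff₀ (by positivity)]
      calc ‖H z‖ * (R / 2) ^ (n * k) = (∏ _l : Fin n, (R / 2) ^ k) * ‖H z‖ := by
            rw [Finset.prod_const, Finset.card_univ, Fintype.card_fin, ← pow_mul, mul_comm k]
            ring
        _ ≤ (∏ l, ‖z - w l‖ ^ k) * ‖H z‖ := by
            gcongr with l
            have := norm_sub_norm_le z (w l)
            linarith [hwR l]
        _ = ‖G z‖ := by rw [e, norm_mul, norm_prod]; simp
        _ ≤ M := hGM z hz.le
    · simpa using (hwR l).trans_lt (by linarith)
  have hsplit : G = fun z => (z - w l) ^ k *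
      ((∏ l' ∈ Finset.univ.erase l, (z - w l') ^ k) * H z) := by
    ext z
    rw [e, ← Finset.mul_prod_erase _ _ (Finset.mem_univ l), mul_assoc]
  have han : AnalyticAt ℂ
      (fun z => (∏ l' ∈ Finset.univ.erase l, (z - w l') ^ k) * H z) (w l) :=
    .fun_mul (by fun_prop) (hH.analyticAt _)
  rw [hsplit, iteratedDeriv_sub_pow_mul han, norm_mul, norm_mul, norm_prod,
    Finset.prod_congr rfl fun l' _ => norm_pow _ _, Finset.prod_pow, Complex.norm_natCast,
    ← mul_assoc]
  have hP0 : 0 ≤ P := (Finset.prod_nonneg fun _ _ => norm_nonneg _).trans hP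
  gcongr

/-- The entire function `N ^ r * P (z, S / N)` where `P` is the polynomial with coefficients `x`. -/
def thetaPolynomial (S N : ℂ → ℂ) {r : ℕ} (x : Fin r × Fin r → ℂ) (z : ℂ) : ℂ :=
  ∑ p, x p * (z ^ (p.1 : ℕ) * S z ^ (p.2 : ℕ) * N z ^ (r - p.2))

/-- The `t`-th derivative of `P (z, sn z)` at a period point `w`, where `P` is the polynomial with
coefficients `x`. -/
def jetSum {R : Type*} [CommRing R] (κ w : R) {r : ℕ} (x : Fin r × Fin r → R) (t : ℕ) : R :=
  ∑ p, x p * jacobiJet κ w t p.1 p.2 0 0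

namespace IsJacobiTheta

variable {κ : ℂ} {S C D N : ℂ → ℂ}

lemma differentiable_thetaPolynomial (h : IsJacobiTheta κ S C D N) {r : ℕ}
    (x : Fin r × Fin r → ℂ) : Differentiable ℂ (thetaPolynomial S N x) := by
  have hS := h.diff_S
  have hN := h.diff_N
  unfold thetaPolynomial
  fun_prop

lemma iteratedDeriv_eq_jetSum (h : IsJacobiTheta κ S C D N) {w : ℂ} (hS : S w = 0)
    (hC : C w = N w) (hD : D w = N w) (hN : N w ≠ 0) {r : ℕ} (x : Fin r × Fin r → ℂ) (t : ℕ) :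
    iteratedDeriv t (fun z => ∑ p, x p * (z ^ (p.1 : ℕ) * (S z / N z) ^ (p.2 : ℕ))) w
      = jetSum κ w x t := by
  have hNe : ∀ᶠ z in 𝓝 w, N z ≠ 0 := h.diff_N.continuous.continuousAt.eventually_ne hN
  have aS : AnalyticAt ℂ (fun z => S z / N z) w :=
    (h.diff_S.analyticAt w).fun_div (h.diff_N.analyticAt w) hN
  have aC : AnalyticAt ℂ (fun z => C z / N z) w :=
    (h.diff_C.analyticAt w).fun_div (h.diff_N.analyticAt w) hN
  have aD : AnalyticAt ℂ (fun z => D z / N z) w :=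
    (h.diff_D.analyticAt w).fun_div (h.diff_N.analyticAt w) hN
  rw [iteratedDeriv_fun_sum]
  swap
  · intro p _
    have := aS.contDiffAt (n := t)
    fun_prop
  refine Finset.sum_congr rfl fun p _ => ?_
  rw [iteratedDeriv_const_mul_field]
  have key := iteratedDeriv_jacobi_monomial aS aC aD (κ := κ) (by simp [hS]) (by simp [hC, hN])
    (by simp [hD, hN]) ?_ ?_ ?_ t p.1 p.2 0 0
  · simpa using congrArg (x p * ·) key
  · filter_upwards [hNe] with z hz
    rw [((h.diff_S z).hasDerivAt.fun_div (h.diff_N z).hasDerivAt hz).deriv, h.wronskian_S]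
    field_simp
  · filter_upwards [hNe] with z hz
    rw [((h.diff_C z).hasDerivAt.fun_div (h.diff_N z).hasDerivAt hz).deriv, h.wronskian_C]
    field_simp
  · filter_upwards [hNe] with z hz
    rw [((h.diff_D z).hasDerivAt.fun_div (h.diff_N z).hasDerivAt hz).deriv, h.wronskian_D]
    field_simp

lemma thetaPolynomial_of_jetSum_eq_zero (h : IsJacobiTheta κ S C D N) {w : ℂ} (hS : S w = 0)
    (hC : C w = N w) (hD : D w = N w) (hN : N w ≠ 0) {r : ℕ} (x : Fin r × Fin r → ℂ) {k : ℕ}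
    (hk : ∀ t < k, jetSum κ w x t = 0) :
    (k : ℕ∞) ≤ analyticOrderAt (thetaPolynomial S N x) w ∧
      iteratedDeriv k (thetaPolynomial S N x) w = N w ^ r * jetSum κ w x k := by
  set F : ℂ → ℂ := fun z => ∑ p, x p * (z ^ (p.1 : ℕ) * (S z / N z) ^ (p.2 : ℕ)) with hF
  have hder := h.iteratedDeriv_eq_jetSum hS hC hD hN x
  have aF : AnalyticAt ℂ F w := by
    have aS : AnalyticAt ℂ (fun z => S z / N z) w :=
      (h.diff_S.analyticAt w).fun_div (h.diff_N.analyticAt w) hN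
    fun_prop
  obtain ⟨g, hg, hFg⟩ := (natCast_le_analyticOrderAt aF).1
    ((natCast_le_analyticOrderAt_iff_iteratedDeriv_eq_zero aF).2
      fun i hi => (hder i).trans (hk i hi))
  have aN := h.diff_N.analyticAt w
  have agN : AnalyticAt ℂ (fun z => N z ^ r * g z) w := by fun_prop
  have hGg : thetaPolynomial S N x =ᶠ[𝓝 w] fun z => (z - w) ^ k * (N z ^ r * g z) := by
    filter_upwards [hFg, h.diff_N.continuous.continuousAt.eventually_ne hN] with z h1 h2
    rw [smul_eq_mul] at h1
    rw [mul_left_comm, ← h1, hF, Finset.mul_sum, thetaPolynomial]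
    refine Finset.sum_congr rfl fun p _ => ?_
    have : N z ^ r = N z ^ (p.2 : ℕ) * N z ^ (r - p.2) := by
      rw [← pow_add, Nat.add_sub_cancel' p.2.2.le]
    rw [this, div_pow]
    field_simp
  refine ⟨?_, ?_⟩
  · exact (natCast_le_analyticOrderAt ((h.differentiable_thetaPolynomial x).analyticAt w)).2
      ⟨_, agN, hGg⟩
  · have h1 : iteratedDeriv k F w = k.factorial * g w := by
      rw [← iteratedDeriv_sub_pow_mul hg]
      exact EventuallyEq.iteratedDeriv_eq k hFg
    rw [hGg.iteratedDeriv_eq, iteratedDeriv_sub_pow_mul agN, ← hder k, h1]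
    ring

lemma eq_zero_of_sum_eq_zero (h : IsJacobiTheta κ S C D N) (hκ0 : κ ≠ 0) (hκ1 : κ ≠ 1)
    {w : ℂ} (hw : w ≠ 0) (hS : S w = 0) (hC : C w = N w) (hD : D w = N w) (r : ℕ)
    (P : ℕ → Polynomial ℂ)
    (hP : ∀ z, ∑ j ∈ Finset.range r, (P j).eval z * (S z ^ j * N z ^ (r - j)) = 0) :
    ∀ j < r, P j = 0 := by
  have hSa := h.diff_S.differentiableOn.analyticOnNhd isOpen_univ
  have hNa := h.diff_N.differentiableOn.analyticOnNhd isOpen_univ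
  induction r generalizing P with
  | zero => simp
  | succ r ih =>
    simp only [Finset.sum_range_succ', pow_zero, one_mul, Nat.sub_zero] at hP
    have h0 : P 0 = 0 := by
      refine Polynomial.eq_zero_of_infinite_isRoot _
        (Set.infinite_of_injective_forall_mem (f := fun l : ℕ => 2 ^ l * w) ?_ fun l => ?_)
      · intro l l' e
        have e' : (2 : ℂ) ^ l = 2 ^ l' := mul_right_cancel₀ hw e
        exact Nat.pow_right_injective le_rfl (by exact_mod_cast e' : 2 ^ l = 2 ^ l')
      · have hl := h.two_pow_mul hS hC hD l
        have := hP (2 ^ l * w)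
        simp only [hl.1] at this
        simpa [h.N_ne_zero_of_S_eq_zero hκ0 hκ1 hl.1] using this
    have hmul : ∀ z, S z * ∑ j ∈ Finset.range r,
        (P (j + 1)).eval z * (S z ^ j * N z ^ (r - j)) = 0 := by
      intro z
      have := hP z
      rw [h0, Polynomial.eval_zero, zero_mul, add_zero] at this
      rw [← this, Finset.mul_sum]
      refine Finset.sum_congr rfl fun j _ => ?_
      rw [Nat.add_sub_add_right]
      ring
    have hpoly (j : ℕ) : AnalyticOnNhd ℂ (fun z => (P j).eval z) Set.univ :=
      (P j).differentiable.differentiableOn.analyticOnNhd isOpen_univ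
    have hsum : AnalyticOnNhd ℂ (fun z => ∑ j ∈ Finset.range r,
        (P (j + 1)).eval z * (S z ^ j * N z ^ (r - j))) Set.univ :=
      Finset.analyticOnNhd_fun_sum _ fun j _ =>
        (hpoly _).mul ((hSa.pow j).mul (hNa.pow _))
    rcases hSa.eq_zero_or_eq_zero_of_mul_eq_zero hsum
      (fun z _ => hmul z) isPreconnected_univ with hz | hz
    · exfalso
      have hd : deriv S 0 = 0 := by
        rw [show S = fun _ => 0 from funext fun z => hz z trivial]; simp
      have := h.wronskian_S 0
      rw [hd, h.S_zero, h.C_zero, h.D_zero] at this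
      simp at this
    · intro j hj
      rcases j with _ | j
      · exact h0
      · exact ih (fun j => P (j + 1)) (fun z => hz z trivial) j (by omega)

lemma exists_jetSum_ne_zero (h : IsJacobiTheta κ S C D N) (hκ0 : κ ≠ 0) (hκ1 : κ ≠ 1)
    {w : ℂ} (hw : w ≠ 0) (hS : S w = 0) (hC : C w = N w) (hD : D w = N w) {r : ℕ}
    {x : Fin r × Fin r → ℂ} (hx : x ≠ 0) : ∃ t, jetSum κ w x t ≠ 0 := by
  by_contra! hcon
  have hN := h.N_ne_zero_of_S_eq_zero hκ0 hκ1 hS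
  have hG := h.differentiable_thetaPolynomial x
  have htop : analyticOrderAt (thetaPolynomial S N x) w = ⊤ :=
    ENat.eq_top_iff_forall_ge.2 fun k =>
      (h.thetaPolynomial_of_jetSum_eq_zero hS hC hD hN x (k := k) fun t _ => hcon t).1
  have hzero (z : ℂ) : thetaPolynomial S N x z = 0 :=
    congrFun (hG.eq_of_eventually_eq (differentiable_const 0)
      (analyticOrderAt_eq_top.1 htop)) z
  apply hx
  set P : ℕ → Polynomial ℂ := fun j => if hj : j < r then
    ∑ i : Fin r, Polynomial.C (x (i, ⟨j, hj⟩)) * Polynomial.X ^ (i : ℕ) else 0 with hPdef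
  have hP0 := h.eq_zero_of_sum_eq_zero hκ0 hκ1 hw hS hC hD r P fun z => by
    rw [Finset.sum_range, ← hzero z, thetaPolynomial, Fintype.sum_prod_type_right]
    refine Finset.sum_congr rfl fun j _ => ?_
    simp only [hPdef, j.2, dif_pos, Polynomial.eval_finsetSum, Finset.sum_mul]
    refine Finset.sum_congr rfl fun i _ => ?_
    simp only [Polynomial.eval_mul, Polynomial.eval_C, Polynomial.eval_pow, Polynomial.eval_X]
    ring
  ext ⟨i, j⟩
  have := congrArg (Polynomial.coeff · i) (hP0 j j.2)
  simpa [hPdef, Polynomial.finsetSum_coeff, Polynomial.coeff_X_pow, Fin.val_inj] using this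

end IsJacobiTheta

section Arithmetic

variable {K : Type*} [Field K] [NumberField K]

open NumberField in
lemma one_le_norm_mul_house_pow {α : K} (hα : IsIntegral ℤ α) (h0 : α ≠ 0) (σ : K →+* ℂ) :
    1 ≤ ‖σ α‖ * house α ^ (Module.finrank ℚ K - 1) := by
  refine le_trans ?_ (norm_norm_le_norm_mul_house_pow α σ)
  obtain ⟨y, hy⟩ := IsIntegrallyClosed.isIntegral_iff.1 (Algebra.isIntegral_norm ℚ hα)
  have hy0 : y ≠ 0 := by
    rintro rfl
    rw [map_zero] at hy
    exact h0 (Algebra.norm_eq_zero_iff.1 hy.symm)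
  rw [← hy]
  have : (1 : ℝ) ≤ |(y : ℝ)| := by exact_mod_cast Int.one_le_abs hy0
  simpa [Int.norm_eq_abs] using this

variable (K) in
open NumberField in
/-- Siegel's lemma for systems with twice as many unknowns as equations. -/
lemma exists_siegel_constant : ∃ c : ℝ, 0 ≤ c ∧ ∀ (α β : Type) [Fintype α] [Fintype β]
    (a : Matrix α β (𝓞 K)), a ≠ 0 → 0 < Fintype.card α →
    Fintype.card β = 2 * Fintype.card α → ∀ A : ℝ, (∀ k l, house (a k l : K) ≤ A) →
    ∃ ξ : β → 𝓞 K, ξ ≠ 0 ∧ a.mulVec ξ = 0 ∧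
      ∀ l, house (ξ l : K) ≤ c * Fintype.card α * A := by
  classical
  obtain ⟨c₁, hc₁⟩ : ∃ c₁ : ℝ, ∀ (α β : Type) [Fintype α] [Fintype β]
      (a : Matrix α β (𝓞 K)), a ≠ 0 → 0 < Fintype.card α →
      Fintype.card α < Fintype.card β → ∀ A : ℝ, (∀ k l, house (a k l : K) ≤ A) →
      ∃ ξ : β → 𝓞 K, ξ ≠ 0 ∧ a.mulVec ξ = 0 ∧
        ∀ l, house (ξ l : K) ≤ c₁ * (c₁ * (Fintype.card β : ℕ) * A) ^
          (((Fintype.card α : ℕ) : ℝ) / ((Fintype.card β : ℕ) - (Fintype.card α : ℕ))) :=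
    ⟨_, fun α β _ _ a ha h0 hlt A hA =>
      house.exists_ne_zero_int_vec_house_le K a ha h0 hlt rfl hA rfl⟩
  refine ⟨2 * c₁ ^ 2, by positivity, fun α β _ _ a ha h0 hcard A hA => ?_⟩
  obtain ⟨ξ, h1, h2, h3⟩ := hc₁ α β a ha h0 (by omega) A hA
  refine ⟨ξ, h1, h2, fun l => (h3 l).trans (le_of_eq ?_)⟩
  have hp : ((Fintype.card α : ℕ) : ℝ) ≠ 0 := by exact_mod_cast h0.ne'
  rw [hcard]
  push_cast
  rw [show (2 * (Fintype.card α : ℝ) - Fintype.card α) = Fintype.card α by ring, div_self hp,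
    Real.rpow_one]
  ring

lemma exists_int_mul_isIntegral (κ w : K) :
    ∃ q : ℤ, q ≠ 0 ∧ IsIntegral ℤ (q * κ) ∧ IsIntegral ℤ (q * w) := by
  classical
  obtain ⟨q, hq, h⟩ := exists_integral_multiples ℤ ℚ ({κ, w} : Finset K)
  refine ⟨q, hq, ?_, ?_⟩
  · simpa using h κ (by simp)
  · simpa using h w (by simp)

open NumberField in
lemma house_pow_mul_jacobiJet_le {κ w : K} {q : ℤ} {B : ℝ} (hB : 1 ≤ B) (hκ : house κ ≤ B)
    (hw : house w ≤ B) {t i j k : ℕ} (ht : t ≤ k) (hi : i ≤ k) (hj : j ≤ k) (hk : 1 ≤ k) :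
    house ((q : K) ^ (2 * k) * jacobiJet κ w t i j 0 0) ≤ ((|(q : ℝ)| * B) ^ 2 * (3 * k)) ^ k := by
  have hk' : (1 : ℝ) ≤ k := by exact_mod_cast hk
  have ht' : (t : ℝ) ≤ k := by exact_mod_cast ht
  have hi' : (i : ℝ) ≤ k := by exact_mod_cast hi
  have hj' : (j : ℝ) ≤ k := by exact_mod_cast hj
  have hq : house ((q : K) ^ (2 * k)) ≤ |(q : ℝ)| ^ (2 * k) := by
    refine (house_pow_le _ _).trans (le_of_eq ?_)
    rw [house_intCast, Int.cast_abs]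
  calc house ((q : K) ^ (2 * k) * jacobiJet κ w t i j 0 0)
      ≤ |(q : ℝ)| ^ (2 * k) * (B ^ (i + t) * (i + j + (0 : ℕ) + (0 : ℕ) + t : ℝ) ^ t) := by
        refine (house_mul_le _ _).trans ?_
        gcongr
        · exact house_nonneg _
        · exact house_jacobiJet_le hB hκ hw t i j 0 0
    _ ≤ |(q : ℝ)| ^ (2 * k) * (B ^ (2 * k) * (3 * k : ℝ) ^ k) := by
        gcongr ?_ * (?_ * ?_)
        · exact pow_le_pow_right₀ hB (by omega)
        · calc (i + j + (0 : ℕ) + (0 : ℕ) + t : ℝ) ^ t ≤ (3 * k : ℝ) ^ t := by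
                gcongr
                push_cast
                linarith
            _ ≤ (3 * k : ℝ) ^ k := pow_le_pow_right₀ (by linarith) ht
    _ = _ := by rw [pow_mul _ 2 k, pow_mul B 2 k, ← mul_pow, ← mul_pow]; ring

open NumberField in
/-- Coefficients of an auxiliary polynomial, small in all conjugates, whose jets vanish to high
order at the points `2 ^ l * w`, together with the Liouville lower bound for further jets. -/
theorem exists_auxiliary_polynomial (κ w : K) (σ : K →+* ℂ) {n : ℕ} (hn : 1 ≤ n) :
    ∃ E : ℝ, 1 ≤ E ∧ ∀ m T : ℕ, 1 ≤ m → T = 2 * n * m ^ 2 →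
      ∃ x : Fin (2 * n * m) × Fin (2 * n * m) → K, x ≠ 0 ∧
      (∀ p, ‖σ (x p)‖ ≤ (E * T) ^ T) ∧
      (∀ l < n, ∀ t < T, jetSum κ (2 ^ l * w) x t = 0) ∧
      ∀ k, T ≤ k → ∀ l < n, jetSum κ (2 ^ l * w) x k ≠ 0 →
        1 ≤ ‖σ (jetSum κ (2 ^ l * w) x k)‖ * ((E * k ^ 2) ^ k) ^ Module.finrank ℚ K := by
  obtain ⟨q, hq0, hqκ, hqw⟩ := exists_int_mul_isIntegral κ w
  obtain ⟨c, hc0, hc⟩ := exists_siegel_constant K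
  obtain ⟨B, hB1, hBκ, hBw⟩ : ∃ B : ℝ, 1 ≤ B ∧ house κ ≤ B ∧ ∀ l < n, house (2 ^ l * w) ≤ B := by
    refine ⟨1 + house κ + ∑ l ∈ Finset.range n, house (2 ^ l * w), ?_, ?_, fun l hl => ?_⟩
    · linarith [house_nonneg κ, Finset.sum_nonneg fun l (_ : l ∈ Finset.range n) =>
        house_nonneg (2 ^ l * w)]
    · linarith [Finset.sum_nonneg fun l (_ : l ∈ Finset.range n) => house_nonneg (2 ^ l * w)]
    · linarith [house_nonneg κ, Finset.single_le_sum (f := fun l : ℕ => house (2 ^ l * w))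
        (fun l _ => house_nonneg _) (Finset.mem_range.2 hl)]
  have hq1 : (1 : ℝ) ≤ |(q : ℝ)| := by exact_mod_cast Int.one_le_abs hq0
  have hqK : (q : K) ≠ 0 := by exact_mod_cast hq0
  have hn' : (1 : ℝ) ≤ n := by exact_mod_cast hn
  set D : ℝ := |(q : ℝ)| * B with hD
  have hqD : |(q : ℝ)| ≤ D := le_mul_of_one_le_right (by positivity) hB1
  have hD1 : 1 ≤ D := hq1.trans hqD
  have hD2 : 1 ≤ D ^ 2 := one_le_pow₀ hD1
  set c' : ℝ := (c + 1) * 2 * n * (D ^ 2 * 3) with hc'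
  have hc'1 : 1 ≤ c' := by
    have h1 : 1 ≤ (c + 1) * 2 := by linarith
    exact one_le_mul_of_one_le_of_one_le (one_le_mul_of_one_le_of_one_le h1 hn') (by linarith)
  have hqw' (l : ℕ) : IsIntegral ℤ ((q : K) * (2 ^ l * w)) := by
    have h2 : IsIntegral ℤ ((2 : K) ^ l) := by
      simpa using (isIntegral_algebraMap (R := ℤ) (A := K) (x := 2)).pow l
    have := h2.mul hqw
    rwa [mul_left_comm] at this
  have hc'E : c' ≤ c' * (12 * D ^ 2) := le_mul_of_one_le_right (by linarith) (by linarith)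
  refine ⟨c' * (12 * D ^ 2), hc'1.trans hc'E, fun m T hm hT => ?_⟩
  have hm2 : m ≤ m ^ 2 := by nlinarith
  have hrT : 2 * n * m ≤ T := by rw [hT]; gcongr
  have hT1 : 1 ≤ T := le_trans (by nlinarith) hrT
  have hT1' : (1 : ℝ) ≤ T := by exact_mod_cast hT1
  have hint (k l t i j : ℕ) (ht : t ≤ k) (hi : i ≤ k) :
      IsIntegral ℤ ((q : K) ^ (2 * k) * jacobiJet κ (2 ^ l * w) t i j 0 0) :=
    isIntegral_pow_mul_jacobiJet hqκ (hqw' l) t i j 0 0 _ (by omega)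
  set a : Matrix (Fin T × Fin n) (Fin (2 * n * m) × Fin (2 * n * m)) (𝓞 K) := fun e p =>
    ⟨(q : K) ^ (2 * T) * jacobiJet κ (2 ^ (e.2 : ℕ) * w) e.1 p.1 p.2 0 0,
      hint T e.2 e.1 p.1 p.2 e.1.2.le (p.1.2.le.trans hrT)⟩ with ha
  have ha0 : a ≠ 0 := by
    intro h
    have hr : 0 < 2 * n * m := by positivity
    have := congrArg (fun y : 𝓞 K => (y : K))
      (congrFun (congrFun h (⟨0, hT1⟩, ⟨0, hn⟩)) (⟨0, hr⟩, ⟨0, hr⟩))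
    simp [ha, jacobiJet, hq0] at this
  obtain ⟨ξ, hξ0, hξa, hξ⟩ := hc _ _ a ha0 (by simp; omega)
    (by simp only [Fintype.card_prod, Fintype.card_fin, hT]; ring) ((D ^ 2 * (3 * T)) ^ T)
    (fun e p => house_pow_mul_jacobiJet_le hB1 hBκ (hBw _ e.2.2) e.1.2.le (p.1.2.le.trans hrT)
      (p.2.2.le.trans hrT) hT1)
  have hξ' (p) : house (ξ p : K) ≤ (c' * T) ^ T := by
    refine (hξ p).trans ?_
    simp only [Fintype.card_prod, Fintype.card_fin]
    push_cast
    calc c * (T * n) * (D ^ 2 * (3 * T)) ^ T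
        ≤ (c + 1) ^ T * (2 ^ T * n ^ T) * (D ^ 2 * (3 * T)) ^ T := by
          gcongr
          · exact (by linarith : c ≤ c + 1).trans (le_self_pow₀ (by linarith) (by omega))
          · exact_mod_cast T.lt_two_pow_self.le
          · exact le_self_pow₀ hn' (by omega)
      _ = (c' * T) ^ T := by rw [← mul_pow, ← mul_pow, ← mul_pow, hc']; ring
  refine ⟨fun p => ξ p, ?_, fun p => ?_, fun l hl t ht => ?_, fun k hk l hl hne => ?_⟩
  · intro h
    apply hξ0
    ext p
    simpa using congrFun h p
  · refine (norm_embedding_le_house _ σ).trans ((hξ' p).trans ?_)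
    gcongr
  · have := congrArg (fun y : 𝓞 K => (y : K)) (congrFun hξa (⟨t, ht⟩, ⟨l, hl⟩))
    simp only [Matrix.mulVec, dotProduct, ha, Pi.zero_apply, map_sum, map_zero] at this
    suffices h0 : (q : K) ^ (2 * T) * jetSum κ (2 ^ l * w) (fun p => (ξ p : K)) t = 0 from
      (mul_eq_zero.1 h0).resolve_left (pow_ne_zero _ hqK)
    rw [← this, jetSum, Finset.mul_sum]
    refine Finset.sum_congr rfl fun p _ => ?_
    change (q : K) ^ (2 * T) * ((ξ p : K) * jacobiJet κ (2 ^ l * w) t p.1 p.2 0 0)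
      = (q : K) ^ (2 * T) * jacobiJet κ (2 ^ l * w) t p.1 p.2 0 0 * (ξ p : K)
    ring
  · set γ := jetSum κ (2 ^ l * w) (fun p => (ξ p : K)) k with hγ
    have hk1 : 1 ≤ k := hT1.trans hk
    have hk1' : (1 : ℝ) ≤ k := by exact_mod_cast hk1
    have hTk : (T : ℝ) ≤ k := by exact_mod_cast hk
    have hsum : (q : K) ^ (2 * k) * γ = ∑ p : Fin (2 * n * m) × Fin (2 * n * m),
        (ξ p : K) * ((q : K) ^ (2 * k) * jacobiJet κ (2 ^ l * w) k p.1 p.2 0 0) := by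
      rw [hγ, jetSum, Finset.mul_sum]
      exact Finset.sum_congr rfl fun p _ => by ring
    have hαint : IsIntegral ℤ ((q : K) ^ (2 * k) * γ) := by
      rw [hsum]
      exact IsIntegral.sum _ fun p _ => (ξ p).2.mul
        (hint k l k p.1 p.2 le_rfl (p.1.2.le.trans (hrT.trans hk)))
    have hαhouse : house ((q : K) ^ (2 * k) * γ) ≤ (c' * (12 * D ^ 2) * k ^ 2) ^ k := by
      rw [hsum]
      refine (house_sum_le_sum_house _ _).trans ?_
      have hterm (p : Fin (2 * n * m) × Fin (2 * n * m)) :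
          house ((ξ p : K) * ((q : K) ^ (2 * k) * jacobiJet κ (2 ^ l * w) k p.1 p.2 0 0))
            ≤ (c' * k) ^ k * (D ^ 2 * (3 * k)) ^ k := by
        refine (house_mul_le _ _).trans ?_
        gcongr
        · exact house_nonneg _
        · refine (hξ' p).trans ?_
          calc (c' * T) ^ T ≤ (c' * k) ^ T := by gcongr
            _ ≤ (c' * k) ^ k := pow_le_pow_right₀ (one_le_mul_of_one_le_of_one_le hc'1 hk1') hk
        · exact house_pow_mul_jacobiJet_le hB1 hBκ (hBw l hl) le_rfl
            (p.1.2.le.trans (hrT.trans hk)) (p.2.2.le.trans (hrT.trans hk)) hk1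
      have hr2 : ((2 * n * m : ℕ) : ℝ) ≤ 2 ^ k := by
        exact_mod_cast (hrT.trans hk).trans k.lt_two_pow_self.le
      calc _ ≤ ∑ _p : Fin (2 * n * m) × Fin (2 * n * m),
            (c' * k) ^ k * (D ^ 2 * (3 * k)) ^ k := Finset.sum_le_sum fun p _ => hterm p
        _ = ((2 * n * m : ℕ) : ℝ) * ((2 * n * m : ℕ) : ℝ)
            * ((c' * k) ^ k * (D ^ 2 * (3 * k)) ^ k) := by
              simp [Finset.card_univ]
        _ ≤ 2 ^ k * 2 ^ k * ((c' * k) ^ k * (D ^ 2 * (3 * k)) ^ k) := by gcongr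
        _ = _ := by rw [← mul_pow, ← mul_pow, ← mul_pow]; ring
    have hσ : ‖σ ((q : K) ^ (2 * k) * γ)‖ ≤ (c' * (12 * D ^ 2) * k ^ 2) ^ k * ‖σ γ‖ := by
      rw [map_mul, norm_mul, map_pow, map_intCast, norm_pow, Complex.norm_intCast]
      gcongr
      rw [pow_mul]
      gcongr
      have h1 : |(q : ℝ)| ^ 2 ≤ D ^ 2 := by gcongr
      have h2 : (1 : ℝ) ≤ k ^ 2 := one_le_pow₀ hk1'
      calc |(q : ℝ)| ^ 2 ≤ D ^ 2 := h1
        _ ≤ 12 * D ^ 2 := by linarith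
        _ ≤ c' * (12 * D ^ 2) := le_mul_of_one_le_left (by positivity) hc'1
        _ ≤ _ := le_mul_of_one_le_right (by positivity) h2
    have hδ : Module.finrank ℚ K = Module.finrank ℚ K - 1 + 1 :=
      (Nat.sub_add_cancel Module.finrank_pos).symm
    calc (1 : ℝ) ≤ _ := one_le_norm_mul_house_pow hαint
          (mul_ne_zero (pow_ne_zero _ hqK) hne) σ
      _ ≤ ((c' * (12 * D ^ 2) * k ^ 2) ^ k * ‖σ γ‖)
          * ((c' * (12 * D ^ 2) * k ^ 2) ^ k) ^ (Module.finrank ℚ K - 1) := by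
            gcongr
            · exact pow_nonneg (house_nonneg _) _
            · exact house_nonneg _
      _ = _ := by rw [mul_comm _ ‖σ γ‖, mul_assoc, ← pow_succ', ← hδ]

end Arithmetic

lemma map_jetSum {R R' : Type*} [CommRing R] [CommRing R'] (φ : R →+* R') (κ w : R) {r : ℕ}
    (x : Fin r × Fin r → R) (t : ℕ) :
    φ (jetSum κ w x t) = jetSum (φ κ) (φ w) (fun p => φ (x p)) t := by
  simp [jetSum, map_jacobiJet]

lemma one_le_of_one_le_prod_pow {ν P E b g F M R : ℝ} {n δ m r T k : ℕ} (hν : 1 ≤ ν)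
    (hP : 1 ≤ P) (hE : 1 ≤ E) (hb : 0 ≤ b) (hn : n = 8 * δ + 10) (hm : 1 ≤ m)
    (hr : r = 2 * n * m) (hT : T = 2 * n * m ^ 2) (hk : T ≤ k) (hR : 1 ≤ R) (hRk : R ^ 4 = k)
    (hF : F = ν * P * 4 * E * Real.exp (2 * n * b) * 2 ^ n * E ^ δ)
    (hM : M = r ^ 2 * ((E * T) ^ T * (R ^ r * Real.exp (b * R ^ 2) ^ r)))
    (hg : g ≤ ν ^ r * (k.factorial * P ^ k * (M / (R / 2) ^ (n * k))))
    (hL : 1 ≤ g * ((E * k ^ 2) ^ k) ^ δ) : R ≤ F := by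
  have hrT : r ≤ T := by
    rw [hr, hT]
    gcongr
    nlinarith
  have hrk : r ≤ k := hrT.trans hk
  have hn1 : 1 ≤ n := by omega
  have hT1 : 1 ≤ T := by rw [hT]; exact Nat.mul_pos (by omega) (by positivity)
  have hT1' : (1 : ℝ) ≤ T := by exact_mod_cast hT1
  have hk1 : 1 ≤ k := hT1.trans hk
  have hk1' : (1 : ℝ) ≤ k := by exact_mod_cast hk1
  have hR0 : 0 < R := by linarith
  have hr2 : (r : ℝ) ≤ 2 ^ k := by exact_mod_cast hrk.trans k.lt_two_pow_self.le
  have hmR : (m : ℝ) ≤ R ^ 2 := by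
    have h1 : m ^ 2 ≤ k := by nlinarith
    have h2 : (m : ℝ) ^ 2 ≤ (R ^ 2) ^ 2 := by
      rw [← pow_mul, hRk]
      exact_mod_cast h1
    exact (pow_le_pow_iff_left₀ (by positivity) (by positivity) two_ne_zero).1 h2
  have hexp : Real.exp (b * R ^ 2) ^ r ≤ Real.exp (2 * n * b) ^ k := by
    rw [← Real.exp_nat_mul, ← Real.exp_nat_mul, Real.exp_le_exp, hr]
    push_cast
    calc (2 * n * m : ℝ) * (b * R ^ 2) ≤ (2 * n * R ^ 2) * (b * R ^ 2) := by gcongr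
      _ = k * (2 * n * b) := by rw [← hRk]; ring
  have hM0 : 0 ≤ M := by rw [hM]; positivity
  have hM' : M ≤ (4 * (E * k) * R * Real.exp (2 * n * b)) ^ k := by
    have hTk : (T : ℝ) ≤ k := by exact_mod_cast hk
    calc M ≤ (2 ^ k) ^ 2 * ((E * k) ^ k * (R ^ k * Real.exp (2 * n * b) ^ k)) := by
          rw [hM]
          gcongr
          · calc (E * T) ^ T ≤ (E * k) ^ T := by gcongr
              _ ≤ (E * k) ^ k :=
                pow_le_pow_right₀ (one_le_mul_of_one_le_of_one_le hE hk1') hk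
      _ = _ := by rw [← pow_mul, mul_comm k, pow_mul]; simp only [← mul_pow]; ring_nf
  have hfac : (k.factorial : ℝ) ≤ k ^ k := by exact_mod_cast k.factorial_le_pow
  have hfin : 1 ≤ (F / R) ^ k := by
    calc (1 : ℝ) ≤ g * ((E * k ^ 2) ^ k) ^ δ := hL
      _ ≤ (ν ^ k * (k ^ k * P ^ k * ((4 * (E * k) * R * Real.exp (2 * n * b)) ^ k
          / (R / 2) ^ (n * k)))) * ((E * k ^ 2) ^ k) ^ δ := by
            gcongr
            refine hg.trans ?_
            gcongr
      _ = (ν * (k * P * ((4 * (E * k) * R * Real.exp (2 * n * b)) / (R / 2) ^ n))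
          * (E * k ^ 2) ^ δ) ^ k := by
            simp only [mul_pow, div_pow, ← pow_mul]
            ring
      _ = (F / R) ^ k := by
            congr 1
            have hRn : (R / 2) ^ n * 2 ^ n = R ^ n := by rw [← mul_pow]; ring
            have h2 : (R / 2) ^ n ≠ 0 := by positivity
            rw [hF, ← hRk]
            field_simp
            rw [hRn, hn]
            ring
  have h1 : 1 ≤ F / R := by
    by_contra! hlt
    exact absurd hfin (not_le.2 (pow_lt_one₀ (by rw [hF]; positivity) hlt (by omega)))
  rwa [one_le_div hR0] at h1

namespace IsJacobiTheta

variable {κ : ℂ} {S C D N : ℂ → ℂ}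

lemma exists_norm_thetaPolynomial_le (h : IsJacobiTheta κ S C D N) (hκ : ‖κ‖ ≤ 1) :
    ∃ B : ℝ, 0 ≤ B ∧ ∀ (r : ℕ) (x : Fin r × Fin r → ℂ) (A R : ℝ), 1 ≤ R → (∀ p, ‖x p‖ ≤ A) →
      ∀ z, ‖z‖ ≤ R →
        ‖thetaPolynomial S N x z‖ ≤ r ^ 2 * (A * (R ^ r * Real.exp (B * R ^ 2) ^ r)) := by
  obtain ⟨B, hB, hSN⟩ := h.exists_norm_le_exp hκ
  refine ⟨B, hB, fun r x A R hR hx z hz => ?_⟩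
  obtain ⟨hS, hN⟩ := hSN R hR z hz
  have hterm (p : Fin r × Fin r) :
      ‖x p * (z ^ (p.1 : ℕ) * S z ^ (p.2 : ℕ) * N z ^ (r - p.2))‖
        ≤ A * (R ^ r * Real.exp (B * R ^ 2) ^ r) := by
    have hA : 0 ≤ A := (norm_nonneg _).trans (hx p)
    simp only [norm_mul, norm_pow]
    calc _ ≤ A * (R ^ (p.1 : ℕ) * Real.exp (B * R ^ 2) ^ (p.2 : ℕ)
          * Real.exp (B * R ^ 2) ^ (r - p.2)) := by
          gcongr
          exact hx p
      _ = A * (R ^ (p.1 : ℕ) * Real.exp (B * R ^ 2) ^ r) := by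
          rw [mul_assoc, ← pow_add, Nat.add_sub_cancel' p.2.2.le]
      _ ≤ _ := by
          gcongr
          exact p.1.2.le
  calc _ ≤ ∑ _p : Fin r × Fin r, A * (R ^ r * Real.exp (B * R ^ 2) ^ r) :=
        norm_sum_le_of_le _ fun p _ => hterm p
    _ = _ := by
        rw [Finset.sum_const, Finset.card_univ, Fintype.card_prod, Fintype.card_fin, nsmul_eq_mul,
          Nat.cast_mul, ← sq]

/-- Schneider's theorem: a common period of the Jacobi elliptic functions with algebraic parameter
is transcendental. -/
theorem transcendental_period (h : IsJacobiTheta κ S C D N) (hκ : ‖κ‖ ≤ 1) (hκ0 : κ ≠ 0)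
    (hκ1 : κ ≠ 1) {ω : ℂ} (hω0 : ω ≠ 0) (hS : S ω = 0) (hC : C ω = N ω) (hD : D ω = N ω)
    (hκa : IsAlgebraic ℚ κ) : Transcendental ℚ ω := by
  intro hωa
  let K := IntermediateField.adjoin ℚ ({κ, ω} : Set ℂ)
  have : FiniteDimensional ℚ K :=
    IntermediateField.finiteDimensional_adjoin fun y hy => by
      rcases hy with rfl | rfl
      · exact hκa.isIntegral
      · exact hωa.isIntegral
  have : NumberField K := ⟨⟩
  let κ' : K := ⟨κ, IntermediateField.subset_adjoin ℚ _ (by simp)⟩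
  let ω' : K := ⟨ω, IntermediateField.subset_adjoin ℚ _ (by simp)⟩
  let σ : K →+* ℂ := algebraMap K ℂ
  have hσκ : σ κ' = κ := rfl
  have hσω (l : ℕ) : σ (2 ^ l * ω') = 2 ^ l * ω := by
    rw [map_mul, map_pow, map_ofNat]; rfl
  set δ := Module.finrank ℚ K with hδ
  obtain ⟨n, hn⟩ : ∃ n, n = 8 * δ + 10 := ⟨_, rfl⟩
  have hn1 : 1 ≤ n := by omega
  obtain ⟨E, hE, haux⟩ := exists_auxiliary_polynomial κ' ω' σ hn1
  obtain ⟨B, hB, hgrowth⟩ := h.exists_norm_thetaPolynomial_le hκ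
  have hper (l : ℕ) := h.two_pow_mul hS hC hD l
  have hN0 (l : ℕ) : N (2 ^ l * ω) ≠ 0 := h.N_ne_zero_of_S_eq_zero hκ0 hκ1 (hper l).1
  let v : Fin n → ℂ := fun l => 2 ^ (l : ℕ) * ω
  have hv : Function.Injective v := by
    intro l l' hll
    have h2 : (2 : ℂ) ^ (l : ℕ) = 2 ^ (l' : ℕ) := mul_right_cancel₀ hω0 hll
    have h3 : (2 : ℕ) ^ (l : ℕ) = 2 ^ (l' : ℕ) := by exact_mod_cast h2
    exact Fin.ext (Nat.pow_right_injective le_rfl h3)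
  have hbound (f : Fin n → ℝ) (hf : ∀ l, 0 ≤ f l) : ∃ P : ℝ, 1 ≤ P ∧ ∀ l, f l ≤ P :=
    ⟨1 + ∑ l, f l, by linarith [Finset.sum_nonneg fun l (_ : l ∈ Finset.univ) => hf l],
      fun l => by linarith [Finset.single_le_sum (fun l _ => hf l) (Finset.mem_univ l)]⟩
  obtain ⟨P, hP, hPv⟩ := hbound (fun l => ∏ l' ∈ Finset.univ.erase l, ‖v l - v l'‖)
    fun l => by positivity
  obtain ⟨ν, hν, hνv⟩ := hbound (fun l => ‖N (v l)‖⁻¹) fun l => by positivity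
  obtain ⟨Q, hQ, hQv⟩ := hbound (fun l => ‖v l‖) fun l => by positivity
  set F := ν * P * 4 * E * Real.exp (2 * n * B) * 2 ^ n * E ^ δ with hF
  have hF0 : 0 ≤ F := by positivity
  obtain ⟨m, hm⟩ := exists_nat_gt ((F + 2 * Q + 1) ^ 4)
  have hm1 : 1 ≤ m := by
    have : (0 : ℝ) < m := lt_of_le_of_lt (by positivity) hm
    exact_mod_cast this
  obtain ⟨T, hT⟩ : ∃ T, T = 2 * n * m ^ 2 := ⟨_, rfl⟩
  obtain ⟨r, hr⟩ : ∃ r, r = 2 * n * m := ⟨_, rfl⟩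
  have hauxm := haux m T hm1 hT
  rw [← hr] at hauxm
  obtain ⟨x, hx0, hxle, hxT, hxL⟩ := hauxm
  set y : Fin r × Fin r → ℂ := fun p => σ (x p) with hy
  have hjet (l t : ℕ) : σ (jetSum κ' (2 ^ l * ω') x t) = jetSum κ (2 ^ l * ω) y t := by
    rw [map_jetSum, hσω, hσκ]
  have hy0 : y ≠ 0 := by
    intro hy'
    exact hx0 (funext fun p => (map_eq_zero σ).1 (congrFun hy' p))
  have hex : ∃ k, ∃ l : Fin n, jetSum κ (v l) y k ≠ 0 := by
    obtain ⟨k, hk⟩ := h.exists_jetSum_ne_zero hκ0 hκ1 hω0 hS hC hD hy0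
    exact ⟨k, ⟨0, hn1⟩, by simpa [v] using hk⟩
  classical
  obtain ⟨k, ⟨l, hkl⟩, hkmin⟩ : ∃ k, (∃ l : Fin n, jetSum κ (v l) y k ≠ 0) ∧
      ∀ t < k, ∀ l : Fin n, jetSum κ (v l) y t = 0 :=
    ⟨Nat.find hex, Nat.find_spec hex, fun t ht => by simpa using Nat.find_min hex ht⟩
  have hTk : T ≤ k := by
    by_contra! hlt
    apply hkl
    rw [← hjet, hxT l l.2 k hlt, map_zero]
  have hL := hxL k hTk l l.2 (fun h0 => hkl (by rw [← hjet, h0, map_zero]))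
  rw [hjet] at hL
  have horder (l : Fin n) := h.thetaPolynomial_of_jetSum_eq_zero (hper l).1 (hper l).2.1
    (hper l).2.2 (hN0 l) y (k := k) fun t ht => hkmin t ht l
  have hkm : (m : ℝ) ≤ k := by
    have : m ≤ k := le_trans (by rw [hT]; nlinarith [Nat.mul_le_mul hn1 hm1]) hTk
    exact_mod_cast this
  obtain ⟨R, hR0, hRk⟩ : ∃ R : ℝ, 0 ≤ R ∧ R ^ 4 = k :=
    ⟨√√k, by positivity, by
      rw [show 4 = 2 * 2 from rfl, pow_mul, Real.sq_sqrt (by positivity),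
        Real.sq_sqrt (by positivity)]⟩
  have hRF : F + 2 * Q + 1 < R := by
    refine lt_of_pow_lt_pow_left₀ 4 hR0 ?_
    rw [hRk]
    exact hm.trans_le hkm
  have hR1 : 1 ≤ R := by linarith
  have hder := norm_iteratedDeriv_le_of_zeros (h.differentiable_thetaPolynomial y) v hv
    (fun l => (horder l).1) (R := R) (by linarith) (fun l => by linarith [hQv l])
    (hgrowth r y _ R hR1 hxle) l (hPv l)
  rw [(horder l).2, norm_mul, norm_pow] at hder
  have hg : ‖jetSum κ (v l) y k‖ = ‖N (v l)‖⁻¹ ^ r * (‖N (v l)‖ ^ r * ‖jetSum κ (v l) y k‖) := by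
    have : ‖N (v l)‖ ≠ 0 := norm_ne_zero_iff.2 (hN0 l)
    rw [← mul_assoc, ← mul_pow, inv_mul_cancel₀ this, one_pow, one_mul]
  have hfinal := one_le_of_one_le_prod_pow hν hP hE hB hn hm1 hr hT hTk hR1 hRk hF rfl
    (hg.le.trans (mul_le_mul (pow_le_pow_left₀ (by positivity) (hνv l) r) hder
      (by positivity) (by positivity))) hL
  linarith

end IsJacobiTheta

section RealIntegral

lemma intervalIntegrable_jacobi {κ : ℝ} (hκ : κ < 1) :
    IntervalIntegrable (fun x => 1 / (√(1 - x ^ 2) * √(1 - κ * x ^ 2)))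
      MeasureTheory.volume 0 1 := by
  have h1 : IntervalIntegrable (fun x : ℝ => 1 / √(1 - x ^ 2)) MeasureTheory.volume 0 1 := by
    refine intervalIntegral.intervalIntegrable_deriv_of_nonneg (g := Real.arcsin)
      Real.continuous_arcsin.continuousOn (fun x hx => ?_) fun x _ => by positivity
    rw [min_eq_left zero_le_one, max_eq_right zero_le_one] at hx
    exact Real.hasDerivAt_arcsin (by linarith [hx.1]) hx.2.ne
  have h2 : ContinuousOn (fun x : ℝ => 1 / √(1 - κ * x ^ 2)) (Set.uIcc 0 1) := by
    refine continuousOn_const.div (by fun_prop) fun x hx => ?_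
    rw [Set.uIcc_of_le zero_le_one] at hx
    refine (Real.sqrt_pos.2 ?_).ne'
    have hx2 : x ^ 2 ≤ 1 := pow_le_one₀ hx.1 hx.2
    rcases le_total κ 0 with h0 | h0 <;> nlinarith [sq_nonneg x]
  simpa only [div_mul_div_comm, one_mul] using h1.mul_continuousOn h2

lemma hasDerivAt_integral_jacobi {κ : ℝ} (hκ : |κ| < 1) {x : ℝ} (hx : x ∈ Set.Ioo (-1 : ℝ) 1) :
    HasDerivAt (fun y => ∫ t in (0 : ℝ)..y, 1 / (√(1 - t ^ 2) * √(1 - κ * t ^ 2)))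
      (1 / (√(1 - x ^ 2) * √(1 - κ * x ^ 2))) x := by
  have hcont : ContinuousOn (fun x => 1 / (√(1 - x ^ 2) * √(1 - κ * x ^ 2)))
      (Set.Ioo (-1 : ℝ) 1) := by
    refine continuousOn_const.div (by fun_prop) fun y hy => ?_
    have hy2 : y ^ 2 < 1 := by nlinarith [hy.1, hy.2]
    have hκ' := abs_lt.1 hκ
    exact (mul_pos (Real.sqrt_pos.2 (by linarith)) (Real.sqrt_pos.2 (by nlinarith))).ne'
  have hsub : Set.uIcc 0 x ⊆ Set.Ioo (-1 : ℝ) 1 :=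
    Set.ordConnected_Ioo.uIcc_subset (by simp) hx
  have hnhds : Set.Ioo (-1 : ℝ) 1 ∈ 𝓝 x := Ioo_mem_nhds hx.1 hx.2
  exact intervalIntegral.integral_hasDerivAt_right (hcont.mono hsub).intervalIntegrable
    (hcont.stronglyMeasurableAtFilter isOpen_Ioo x hx) (hcont.continuousAt hnhds)

lemma cassini_integral_eq {b : ℝ} (hb0 : 0 < b) (hb1 : b < 1) :
    √(b / 2) * ∫ v in b..1, 1 / √(v * (1 - v) * (v ^ 2 - b ^ 2))
      = ∫ x in (0 : ℝ)..1, 1 / (√(1 - x ^ 2) * √(1 - (1 - b) / 2 * x ^ 2)) := by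
  set κ := (1 - b) / 2 with hκ
  set u : ℝ → ℝ := fun y => ∫ t in (0 : ℝ)..y, 1 / (√(1 - t ^ 2) * √(1 - κ * t ^ 2)) with hu
  set q : ℝ → ℝ := fun v => (v - b) / ((1 - b) * v) with hq
  have hb1' : 0 < 1 - b := by linarith
  have hq_mem {v : ℝ} (hv : v ∈ Set.Icc b 1) : q v ∈ Set.Icc (0 : ℝ) 1 := by
    have hv0 : 0 < v := hb0.trans_le hv.1
    refine ⟨div_nonneg (by linarith [hv.1]) (by positivity), ?_⟩
    rw [hq, div_le_one (by positivity)]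
    nlinarith [hv.2]
  have hu_cont : ContinuousOn u (Set.Icc 0 1) := by
    have := intervalIntegral.continuousOn_primitive_interval'
      (intervalIntegrable_jacobi (κ := κ) (by linarith)) Set.left_mem_uIcc
    rwa [Set.uIcc_of_le zero_le_one] at this
  have hcont : ContinuousOn (fun v => u √(q v)) (Set.Icc b 1) := by
    refine hu_cont.comp (Real.continuous_sqrt.comp_continuousOn ?_) fun v hv =>
      ⟨Real.sqrt_nonneg _, Real.sqrt_le_one.2 (hq_mem hv).2⟩
    refine ContinuousOn.div (by fun_prop) (by fun_prop) fun v hv => ?_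
    exact (mul_pos hb1' (hb0.trans_le hv.1)).ne'
  have hderiv (v : ℝ) (hv : v ∈ Set.Ioo b 1) : HasDerivAt (fun v => u √(q v))
      (√(b / 2) * (1 / √(v * (1 - v) * (v ^ 2 - b ^ 2)))) v := by
    have hv0 : 0 < v := hb0.trans hv.1
    have hvb : 0 < v - b := by linarith [hv.1]
    have hv1 : 0 < 1 - v := by linarith [hv.2]
    have hvb2 : 0 < v ^ 2 - b ^ 2 := by nlinarith
    have hq0 : 0 < q v := by positivity
    have hq1 : 1 - q v = b * (1 - v) / ((1 - b) * v) := by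
      simp only [hq]; field_simp; ring
    have hq1' : 0 < 1 - q v := by rw [hq1]; positivity
    have hqκ : 1 - κ * q v = (v + b) / (2 * v) := by
      simp only [hq, hκ]; field_simp; ring
    have hqκ' : 0 < 1 - κ * q v := by rw [hqκ]; positivity
    have hqd : HasDerivAt q (b / ((1 - b) * v ^ 2)) v := by
      refine (((hasDerivAt_id v).sub_const b).fun_div ((hasDerivAt_id v).const_mul (1 - b))
        (by simp; constructor <;> positivity)).congr_deriv ?_
      simp only [id]; field_simp; ring
    have hlt : √(q v) < 1 := by rw [Real.sqrt_lt' one_pos]; linarith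
    have hud := hasDerivAt_integral_jacobi (κ := κ) (x := √(q v))
      (by rw [abs_lt]; constructor <;> linarith)
      ⟨by linarith [Real.sqrt_nonneg (q v)], hlt⟩
    refine (hud.comp v (hqd.sqrt hq0.ne')).congr_deriv ?_
    rw [Real.sq_sqrt hq0.le, ← pow_left_inj₀ (by positivity) (by positivity) two_ne_zero]
    simp only [mul_pow, div_pow, Real.sq_sqrt hq0.le, Real.sq_sqrt hq1'.le, Real.sq_sqrt hqκ'.le,
      Real.sq_sqrt (by positivity : 0 ≤ b / 2),
      Real.sq_sqrt (by positivity : 0 ≤ v * (1 - v) * (v ^ 2 - b ^ 2))]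
    rw [hq1, hqκ, show v ^ 2 - b ^ 2 = (v - b) * (v + b) by ring]
    simp only [hq]
    field_simp
  have hint : IntervalIntegrable (fun v => √(b / 2) * (1 / √(v * (1 - v) * (v ^ 2 - b ^ 2))))
      MeasureTheory.volume b 1 := by
    refine intervalIntegral.intervalIntegrable_deriv_of_nonneg (g := fun v => u √(q v))
      ?_ ?_ fun v _ => by positivity
    · rwa [Set.uIcc_of_le hb1.le]
    · rwa [min_eq_left hb1.le, max_eq_right hb1.le]
  rw [← intervalIntegral.integral_const_mul,
    intervalIntegral.integral_eq_sub_of_hasDerivAt_of_le hb1.le hcont hderiv hint]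
  simp [hq, hu, hb1'.ne']

end RealIntegral

theorem transcendental_integral_jacobi {κ : ℝ} (hκ0 : 0 < κ) (hκ1 : κ < 1)
    (hκ : IsAlgebraic ℚ κ) :
    Transcendental ℚ (4 * ∫ x in (0 : ℝ)..1, 1 / (√(1 - x ^ 2) * √(1 - κ * x ^ 2))) := by
  set K := ∫ x in (0 : ℝ)..1, 1 / (√(1 - x ^ 2) * √(1 - κ * x ^ 2)) with hK
  have hint := intervalIntegrable_jacobi hκ1
  have hκabs : |κ| < 1 := by rwa [abs_of_pos hκ0]
  have hK0 : 0 < K := by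
    refine intervalIntegral.intervalIntegral_pos_of_pos_on hint (fun x hx => ?_) one_pos
    have hx2 : x ^ 2 < 1 := by nlinarith [hx.1, hx.2]
    have h1 := Real.sqrt_pos.2 (show 0 < 1 - x ^ 2 by linarith)
    have h2 := Real.sqrt_pos.2 (show 0 < 1 - κ * x ^ 2 by nlinarith)
    positivity
  have htend : Tendsto (fun y => ∫ t in (0 : ℝ)..y, 1 / (√(1 - t ^ 2) * √(1 - κ * t ^ 2)))
      (𝓝[<] 1) (𝓝 K) := by
    have h1 := intervalIntegral.continuousOn_primitive_interval' hint Set.left_mem_uIcc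
    rw [Set.uIcc_of_le zero_le_one] at h1
    have h2 := h1 1 (by simp)
    rw [← nhdsWithin_Ioo_eq_nhdsLT (zero_lt_one' ℝ)]
    exact h2.mono Set.Ioo_subset_Icc_self
  obtain ⟨S, C, D, N, h, hS, hC, hD⟩ := exists_isJacobiTheta_four_mul hκabs.le
    intervalIntegral.integral_same (fun x hx => hasDerivAt_integral_jacobi hκabs hx) htend
  have htr := h.transcendental_period (by simpa using hκabs.le) (by exact_mod_cast hκ0.ne')
    (by exact_mod_cast hκ1.ne) (by exact_mod_cast (by positivity : 4 * K ≠ 0)) hS hC hD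
    (hκ.algebraMap (A := ℂ))
  intro halg
  apply htr
  simpa using halg.algebraMap (A := ℂ)

/-- For algebraic `0 < a < 1`, the total length of the Cassini oval `{z : |z²-a²| = 1}`,
namely `2√2·(1-a⁴)^{1/4}·∫_{√(1-a⁴)}^{1} dv/√(v(1-v)(v²-(1-a⁴)))`, is transcendental. -/
theorem stmt_12 (a : ℝ) (haAlg : IsAlgebraic ℚ a) (ha0 : 0 < a) (ha1 : a < 1) :
    Transcendental ℚ
      (2 * Real.sqrt 2 * (1 - a ^ 4) ^ ((1 : ℝ) / 4) *
        ∫ v in Real.sqrt (1 - a ^ 4)..1,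
          1 / Real.sqrt (v * (1 - v) * (v ^ 2 - (1 - a ^ 4)))) := by
  have ha4 : a ^ 4 < 1 := pow_lt_one₀ ha0.le ha1 (by norm_num)
  have ha4' : 0 < a ^ 4 := by positivity
  obtain ⟨b, hb⟩ : ∃ b, b = √(1 - a ^ 4) := ⟨_, rfl⟩
  have hb2 : b ^ 2 = 1 - a ^ 4 := by rw [hb, Real.sq_sqrt (by linarith)]
  have hb0 : 0 < b := by rw [hb]; exact Real.sqrt_pos.2 (by linarith)
  have hb1 : b < 1 := by rw [hb, Real.sqrt_lt' one_pos]; linarith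
  have hroot : (1 - a ^ 4) ^ ((1 : ℝ) / 4) = √b := by
    rw [hb, Real.sqrt_eq_rpow, Real.sqrt_eq_rpow, ← Real.rpow_mul (by linarith)]
    norm_num
  have hbAlg : IsAlgebraic ℚ b :=
    IsAlgebraic.of_pow two_pos (by rw [hb2]; exact isAlgebraic_one.sub (haAlg.pow 4))
  have hκAlg : IsAlgebraic ℚ ((1 - b) / 2) := by
    have h2 : IsAlgebraic ℚ (2 : ℝ) := by simpa using isAlgebraic_algebraMap (A := ℝ) (2 : ℚ)
    rw [div_eq_mul_inv]
    exact (isAlgebraic_one.sub hbAlg).mul h2.inv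
  have hsqrt : 2 * √2 * √b = 4 * √(b / 2) := by
    rw [Real.sqrt_div hb0.le]
    field_simp
    rw [Real.sq_sqrt two_pos.le]
    norm_num
  rw [hroot, ← hb, ← hb2, hsqrt, mul_assoc, cassini_integral_eq hb0 hb1]
  exact transcendental_integral_jacobi (by linarith) (by linarith) hκAlg
end

section
/- For every integer k ≥ 1 and every real number a with 0 < a < 1, one has ∫_{(1−a^k)^{1/k}}^{(1+a^k)^{1/k}} 4k·r^k dr / √((r^{2k} − (a^k−1)²)·((1+a^k)² − r^{2k})) = (4/(1+a^k)^{(k−1)/k}) · ∫₀^{π/2} (1 − (4a^k/(1+a^k)²)·sin²φ)^{−(k−1)/(2k)} dφ. Both sides equal the total length of the regular polynomial lemniscate C_{a,k} = {z ∈ ℂ : |z^k − a^k| = 1}. -/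
/-- The Matz-type substitution `r ^ (2k) = (1 + u)² - 4 u sin² φ`, solved for `r`. -/
noncomputable def matzRadius (u : ℝ) (k : ℕ) (φ : ℝ) : ℝ :=
  ((1 + u) ^ 2 - 4 * u * Real.sin φ ^ 2) ^ ((1 : ℝ) / (2 * k))

lemma matzRadicand_pos {u : ℝ} (hu0 : 0 < u) (hu1 : u < 1) (φ : ℝ) :
    0 < (1 + u) ^ 2 - 4 * u * Real.sin φ ^ 2 := by
  nlinarith [Real.sin_sq_le_one φ, sq_pos_of_pos (sub_pos.2 hu1),
    mul_le_mul_of_nonneg_left (Real.sin_sq_le_one φ) hu0.le]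

lemma matzRadius_pow {u : ℝ} (hu0 : 0 < u) (hu1 : u < 1) {k : ℕ} (hk : 1 ≤ k) (φ : ℝ) :
    matzRadius u k φ ^ (2 * k) = (1 + u) ^ 2 - 4 * u * Real.sin φ ^ 2 := by
  have hk0 : (k : ℝ) ≠ 0 := by positivity
  rw [matzRadius, ← Real.rpow_natCast, ← Real.rpow_mul (matzRadicand_pos hu0 hu1 φ).le]
  push_cast
  rw [one_div_mul_cancel (by positivity), Real.rpow_one]

lemma hasDerivAt_matzRadius {u : ℝ} (hu0 : 0 < u) (hu1 : u < 1) (k : ℕ) (φ : ℝ) :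
    HasDerivAt (matzRadius u k)
      (-(8 * u * Real.sin φ * Real.cos φ) * ((1 : ℝ) / (2 * k)) *
        ((1 + u) ^ 2 - 4 * u * Real.sin φ ^ 2) ^ ((1 : ℝ) / (2 * k) - 1)) φ := by
  have h : HasDerivAt (fun φ => (1 + u) ^ 2 - 4 * u * Real.sin φ ^ 2)
      (-(8 * u * Real.sin φ * Real.cos φ)) φ := by
    refine ((((Real.hasDerivAt_sin φ).pow 2).const_mul (4 * u)).const_sub
      ((1 + u) ^ 2)).congr_deriv ?_
    norm_num
    ring
  exact h.rpow_const (Or.inl (matzRadicand_pos hu0 hu1 φ).ne')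

lemma strictAntiOn_matzRadius {u : ℝ} (hu0 : 0 < u) (hu1 : u < 1) {k : ℕ} (hk : 1 ≤ k) :
    StrictAntiOn (matzRadius u k) (Set.Icc 0 (Real.pi / 2)) := by
  intro x hx y hy hxy
  have hk0 : (0 : ℝ) < k := by positivity
  refine Real.rpow_lt_rpow (matzRadicand_pos hu0 hu1 y).le ?_ (by positivity)
  have hs : Real.sin x < Real.sin y :=
    Real.sin_lt_sin_of_lt_of_le_pi_div_two (by linarith [hx.1, Real.pi_pos]) hy.2 hxy
  have hs0 : 0 ≤ Real.sin x :=
    Real.sin_nonneg_of_nonneg_of_le_pi hx.1 (by linarith [hx.2, Real.pi_pos])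
  have := mul_lt_mul_of_pos_left (pow_lt_pow_left₀ hs hs0 two_ne_zero) (by positivity : 0 < 4 * u)
  linarith

lemma matzRadius_zero {u : ℝ} (hu0 : 0 < u) (k : ℕ) :
    matzRadius u k 0 = (1 + u) ^ ((1 : ℝ) / k) := by
  have h : (0 : ℝ) ≤ 1 + u := by positivity
  rw [matzRadius, Real.sin_zero, ← one_div_mul_one_div, Real.rpow_mul (by simp; positivity)]
  congr 1
  rw [← Real.sqrt_eq_rpow]
  simp [Real.sqrt_sq h]

lemma matzRadius_pi_div_two {u : ℝ} (hu1 : u < 1) (k : ℕ) :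
    matzRadius u k (Real.pi / 2) = (1 - u) ^ ((1 : ℝ) / k) := by
  have h : (0 : ℝ) ≤ 1 - u := by linarith
  have e : (1 + u) ^ 2 - 4 * u * (1 : ℝ) ^ 2 = (1 - u) ^ 2 := by ring
  rw [matzRadius, Real.sin_pi_div_two, e, ← one_div_mul_one_div, Real.rpow_mul (sq_nonneg _)]
  congr 1
  rw [← Real.sqrt_eq_rpow, Real.sqrt_sq h]

lemma image_matzRadius {u : ℝ} (hu0 : 0 < u) (hu1 : u < 1) {k : ℕ} (hk : 1 ≤ k) :
    matzRadius u k '' Set.Ioo 0 (Real.pi / 2) =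
      Set.Ioo ((1 - u) ^ ((1 : ℝ) / k)) ((1 + u) ^ ((1 : ℝ) / k)) := by
  have hpi : 0 ≤ Real.pi / 2 := by positivity
  have hanti := strictAntiOn_matzRadius hu0 hu1 hk
  rw [← matzRadius_zero hu0, ← matzRadius_pi_div_two hu1]
  refine Set.Subset.antisymm ?_ (intermediate_value_Ioo' hpi
    fun φ _ => (hasDerivAt_matzRadius hu0 hu1 k φ).continuousAt.continuousWithinAt)
  rintro _ ⟨φ, hφ, rfl⟩
  exact ⟨hanti (Set.Ioo_subset_Icc_self hφ) (Set.right_mem_Icc.2 hpi) hφ.2,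
    hanti (Set.left_mem_Icc.2 hpi) (Set.Ioo_subset_Icc_self hφ) hφ.1⟩

/-- Pointwise form of the substitution: the pulled-back radial length element. -/
lemma matz_integrand_eq {u : ℝ} (hu0 : 0 < u) (hu1 : u < 1) {k : ℕ} (hk : 1 ≤ k) {φ : ℝ}
    (hφ : φ ∈ Set.Ioo 0 (Real.pi / 2)) :
    |-(8 * u * Real.sin φ * Real.cos φ) * ((1 : ℝ) / (2 * k)) *
        ((1 + u) ^ 2 - 4 * u * Real.sin φ ^ 2) ^ ((1 : ℝ) / (2 * k) - 1)| *
      (4 * (k : ℝ) * matzRadius u k φ ^ k /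
        Real.sqrt ((matzRadius u k φ ^ (2 * k) - (u - 1) ^ 2) *
          ((1 + u) ^ 2 - matzRadius u k φ ^ (2 * k)))) =
      4 / (1 + u) ^ (((k : ℝ) - 1) / k) *
        (1 - (4 * u / (1 + u) ^ 2) * Real.sin φ ^ 2) ^ (-(((k : ℝ) - 1) / (2 * k))) := by
  have hk0 : (0 : ℝ) < k := by positivity
  have hs : 0 < Real.sin φ := Real.sin_pos_of_pos_of_lt_pi hφ.1 (by linarith [hφ.2, Real.pi_pos])
  have hc : 0 < Real.cos φ := Real.cos_pos_of_mem_Ioo ⟨by linarith [hφ.1, Real.pi_pos], hφ.2⟩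
  have hR := matzRadicand_pos hu0 hu1 φ
  have hpow : matzRadius u k φ ^ k =
      ((1 + u) ^ 2 - 4 * u * Real.sin φ ^ 2) ^ ((1 : ℝ) / 2) := by
    rw [matzRadius, ← Real.rpow_natCast, ← Real.rpow_mul hR.le]
    congr 1
    field_simp
  have hsqrt : Real.sqrt ((matzRadius u k φ ^ (2 * k) - (u - 1) ^ 2) *
      ((1 + u) ^ 2 - matzRadius u k φ ^ (2 * k))) = 4 * u * Real.sin φ * Real.cos φ := by
    rw [matzRadius_pow hu0 hu1 hk, ← Real.sqrt_sq (by positivity :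
      0 ≤ 4 * u * Real.sin φ * Real.cos φ)]
    congr 1
    rw [mul_pow, Real.cos_sq']
    ring
  have hu : (0 : ℝ) < 1 + u := by positivity
  have hfac : 1 - (4 * u / (1 + u) ^ 2) * Real.sin φ ^ 2 =
      ((1 + u) ^ 2 - 4 * u * Real.sin φ ^ 2) / (1 + u) ^ 2 := by
    field_simp
  have hden : ((1 + u) ^ 2) ^ (-(((k : ℝ) - 1) / (2 * k))) =
      ((1 + u) ^ (((k : ℝ) - 1) / k))⁻¹ := by
    rw [← Real.rpow_natCast, ← Real.rpow_mul hu.le, ← Real.rpow_neg hu.le]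
    congr 1
    push_cast
    field_simp
  have hexp : ((1 + u) ^ 2 - 4 * u * Real.sin φ ^ 2) ^ (-(((k : ℝ) - 1) / (2 * k))) =
      ((1 + u) ^ 2 - 4 * u * Real.sin φ ^ 2) ^ ((1 : ℝ) / (2 * k) - 1) *
        ((1 + u) ^ 2 - 4 * u * Real.sin φ ^ 2) ^ ((1 : ℝ) / 2) := by
    rw [← Real.rpow_add hR]
    congr 1
    field_simp
    ring
  rw [hsqrt, hpow, hfac, Real.div_rpow hR.le (by positivity), hden, hexp, neg_mul, neg_mul,
    abs_neg, abs_of_nonneg (by positivity)]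
  have hA : (0 : ℝ) < (1 + u) ^ (((k : ℝ) - 1) / k) := Real.rpow_pos_of_pos hu _
  generalize ((1 + u) ^ 2 - 4 * u * Real.sin φ ^ 2) ^ ((1 : ℝ) / (2 * k) - 1) = X
  generalize ((1 + u) ^ 2 - 4 * u * Real.sin φ ^ 2) ^ ((1 : ℝ) / 2) = Y
  generalize (1 + u) ^ (((k : ℝ) - 1) / k) = A at hA
  field_simp
  ring

/-- For `k ≥ 1` and `0 < a < 1`, the radial integral for the total length of the regular
lemniscate `C_{a,k} = {z : |z^k - a^k| = 1}` equals its Matz-type trigonometric form. -/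
theorem stmt_13 (k : ℕ) (hk : 1 ≤ k) (a : ℝ) (ha0 : 0 < a) (ha1 : a < 1) :
    (∫ r in ((1 - a ^ k) ^ ((1 : ℝ) / (k : ℝ)))..((1 + a ^ k) ^ ((1 : ℝ) / (k : ℝ))),
        4 * (k : ℝ) * r ^ k /
          Real.sqrt ((r ^ (2 * k) - (a ^ k - 1) ^ 2) * ((1 + a ^ k) ^ 2 - r ^ (2 * k)))) =
      (4 / (1 + a ^ k) ^ (((k : ℝ) - 1) / (k : ℝ))) *
        ∫ φ in (0:ℝ)..(Real.pi / 2),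
          (1 - (4 * a ^ k / (1 + a ^ k) ^ 2) * Real.sin φ ^ 2) ^
            (-(((k : ℝ) - 1) / (2 * (k : ℝ)))) := by
  have hu0 : 0 < a ^ k := pow_pos ha0 k
  have hu1 : a ^ k < 1 := pow_lt_one₀ ha0.le ha1 (by omega)
  generalize a ^ k = u at hu0 hu1 ⊢
  have hle : (1 - u) ^ ((1 : ℝ) / (k : ℝ)) ≤ (1 + u) ^ ((1 : ℝ) / (k : ℝ)) :=
    Real.rpow_le_rpow (by linarith) (by linarith) (by positivity)
  have hpi : 0 ≤ Real.pi / 2 := by positivity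
  rw [← intervalIntegral.integral_const_mul, intervalIntegral.integral_of_le hle,
    intervalIntegral.integral_of_le hpi, MeasureTheory.integral_Ioc_eq_integral_Ioo,
    MeasureTheory.integral_Ioc_eq_integral_Ioo, ← image_matzRadius hu0 hu1 hk,
    MeasureTheory.integral_image_eq_integral_abs_deriv_smul measurableSet_Ioo
      (fun φ _ => (hasDerivAt_matzRadius hu0 hu1 k φ).hasDerivWithinAt)
      ((strictAntiOn_matzRadius hu0 hu1 hk).injOn.mono Set.Ioo_subset_Icc_self)]
  exact MeasureTheory.setIntegral_congr_fun measurableSet_Ioo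
    fun φ hφ => matz_integrand_eq hu0 hu1 hk hφ
end

section
/- For every integer k ≥ 1 and every real number a with 0 < a < 1, setting b = 4a^k/(1+a^k)², one has (2/(1+a^k)^{(k−1)/k}) · ∫₀¹ dt / ((1 − b t)^{(k−1)/(2k)} · √(t(1−t))) = 2π · Σ_{n=0}^∞ ( ((k−1)/(2k))_n / n! )² · a^{2kn}, where (x)_n = x(x+1)⋯(x+n−1) is the ascending Pochhammer symbol (with (x)_0 = 1). In other words, the total length of the regular lemniscate C_{a,k} equals 2π·₂F₁((k−1)/(2k), (k−1)/(2k), 1; a^{2k}). -/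
open Real Set MeasureTheory

theorem integral_cos_int_mul {m : ℤ} (hm : m ≠ 0) : ∫ θ in (0 : ℝ)..π, cos (m * θ) = 0 := by
  have hm' : (m : ℝ) ≠ 0 := by exact_mod_cast hm
  rw [intervalIntegral.integral_comp_mul_left (fun u => cos u) hm']
  simp

theorem hasSum_mul_of_summable_norm {f g : ℕ → ℂ} {s t : ℂ} (hf : HasSum f s) (hg : HasSum g t)
    (hfn : Summable fun n => ‖f n‖) (hgn : Summable fun n => ‖g n‖) :
    HasSum (fun x : ℕ × ℕ => f x.1 * g x.2) (s * t) :=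
  hf.mul hg (summable_mul_of_summable_norm hfn hgn)

/-- Parseval's identity on the half circle, for real coefficients with an absolutely convergent
sum. -/
theorem hasSum_sq_of_hasSum_exp {a : ℕ → ℝ} (ha : Summable a) {F : ℝ → ℂ}
    (hF : ∀ θ : ℝ, HasSum (fun n => (a n : ℂ) * Complex.exp (n * θ * Complex.I)) (F θ)) :
    HasSum (fun n => π * a n ^ 2) (∫ θ in (0 : ℝ)..π, ‖F θ‖ ^ 2) := by
  have hprod : Summable fun x : ℕ × ℕ => ‖a x.1‖ * ‖a x.2‖ :=
    ha.norm.mul_of_nonneg ha.norm (fun _ => norm_nonneg _) (fun _ => norm_nonneg _)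
  have hterm (θ : ℝ) (n : ℕ) : ‖(a n : ℂ) * Complex.exp (n * θ * Complex.I)‖ = ‖a n‖ := by
    rw [norm_mul, Complex.norm_real, show (n * θ * Complex.I : ℂ) = ((n * θ : ℝ) : ℂ) * Complex.I by
      push_cast; ring, Complex.norm_exp_ofReal_mul_I, mul_one]
  have hpair (θ : ℝ) : HasSum
      (fun x : ℕ × ℕ => a x.1 * a x.2 * cos (((x.1 : ℤ) - (x.2 : ℤ) : ℤ) * θ)) (‖F θ‖ ^ 2) := by
    have hconj := (hF θ).map (starRingEnd ℂ) Complex.continuous_conj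
    have hnorm : Summable fun n => ‖(a n : ℂ) * Complex.exp (n * θ * Complex.I)‖ := by
      simpa only [hterm] using ha.norm
    have hnorm' : Summable fun n =>
        ‖((starRingEnd ℂ) ∘ fun n => (a n : ℂ) * Complex.exp (n * θ * Complex.I)) n‖ := by
      simpa only [Function.comp_apply, RCLike.norm_conj] using hnorm
    have hsum := hasSum_mul_of_summable_norm (hF θ) hconj hnorm hnorm'
    rw [Complex.mul_conj] at hsum
    have hre := Complex.hasSum_re hsum
    rw [Complex.ofReal_re, Complex.normSq_eq_norm_sq] at hre
    refine hre.congr_fun ?_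
    rintro ⟨n, m⟩
    have : (a n : ℂ) * Complex.exp (n * θ * Complex.I) *
        (starRingEnd ℂ) ((a m : ℂ) * Complex.exp (m * θ * Complex.I)) =
        ((a n * a m : ℝ) : ℂ) * Complex.exp (((((n : ℤ) - (m : ℤ) : ℤ) * θ : ℝ) : ℂ) * Complex.I) := by
      rw [map_mul, ← Complex.exp_conj, mul_mul_mul_comm, ← Complex.exp_add]
      simp only [map_mul, Complex.conj_ofReal, Complex.conj_I, map_natCast]
      push_cast
      congr 2
      ring
    simp only [Function.comp_apply]
    rw [this, Complex.re_ofReal_mul, Complex.exp_ofReal_mul_I_re]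
  have hint : HasSum (fun x : ℕ × ℕ => ∫ θ in (0 : ℝ)..π,
      a x.1 * a x.2 * cos (((x.1 : ℤ) - (x.2 : ℤ) : ℤ) * θ)) (∫ θ in (0 : ℝ)..π, ‖F θ‖ ^ 2) := by
    refine intervalIntegral.hasSum_integral_of_dominated_convergence
      (fun x _ => ‖a x.1‖ * ‖a x.2‖) (fun x => ?_) (fun x => ?_) ?_ ?_ ?_
    · exact Continuous.aestronglyMeasurable (by fun_prop)
    · refine .of_forall fun θ _ => ?_
      rw [norm_mul, norm_mul]
      exact mul_le_of_le_one_right (by positivity) (abs_cos_le_one _)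
    · exact .of_forall fun _ _ => hprod
    · exact intervalIntegrable_const
    · exact .of_forall fun θ _ => hpair θ
  have hdiag : Function.Injective fun n : ℕ => (n, n) := fun n m h => (Prod.ext_iff.1 h).1
  rw [← hdiag.hasSum_iff] at hint
  · refine hint.congr_fun fun n => ?_
    simp
    ring
  · rintro ⟨n, m⟩ hnm
    have hne : (n : ℤ) - (m : ℤ) ≠ 0 := fun h => hnm ⟨n, by simp; omega⟩
    rw [intervalIntegral.integral_const_mul, integral_cos_int_mul hne, mul_zero]

theorem Ring.choose_add_sub_one_eq_ascPochhammer_eval_div {K : Type*} [Field K] [CharZero K]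
    (p : K) (n : ℕ) :
    Ring.choose (p + n - 1) n = (ascPochhammer K n).eval p / (n.factorial : K) := by
  rw [← Ring.multichoose_eq, eq_div_iff (by exact_mod_cast n.factorial_ne_zero), mul_comm,
    ← nsmul_eq_mul, Ring.factorial_nsmul_multichoose_eq_ascPochhammer,
    Polynomial.ascPochhammer_smeval_eq_eval]

theorem hasSum_one_sub_cpow_neg (p : ℝ) {z : ℂ} (hz : ‖z‖ < 1) :
    HasSum (fun n : ℕ => (((ascPochhammer ℝ n).eval p / (n.factorial : ℝ) : ℝ) : ℂ) * z ^ n)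
      ((1 - z) ^ ((-p : ℝ) : ℂ)) := by
  have h := (Complex.one_div_one_sub_cpow_hasFPowerSeriesOnBall_zero p).hasSum
    (y := z) (by simpa [enorm_eq_nnnorm, ← NNReal.coe_lt_coe] using hz)
  rw [zero_add, one_div, ← Complex.cpow_neg, ← Complex.ofReal_neg] at h
  refine h.congr_fun fun n => ?_
  rw [← Ring.choose_add_sub_one_eq_ascPochhammer_eval_div, Complex.ofReal_choose]
  simp [mul_comm]

theorem norm_one_sub_mul_exp_sq (x θ : ℝ) :
    ‖1 - (x : ℂ) * Complex.exp (θ * Complex.I)‖ ^ 2 = 1 + x ^ 2 - 2 * x * cos θ := by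
  rw [← Complex.normSq_eq_norm_sq, Complex.normSq_apply]
  simp [Complex.exp_ofReal_mul_I_re, Complex.exp_ofReal_mul_I_im]
  linear_combination x ^ 2 * sin_sq_add_cos_sq θ

theorem integral_one_add_sq_sub_cos_rpow (p : ℝ) {x : ℝ} (hx0 : 0 ≤ x) (hx1 : x < 1) :
    ∫ θ in (0 : ℝ)..π, (1 + x ^ 2 - 2 * x * cos θ) ^ (-p) =
      π * ∑' n : ℕ, ((ascPochhammer ℝ n).eval p / (n.factorial : ℝ)) ^ 2 * x ^ (2 * n) := by
  have hsum : Summable fun n : ℕ => (ascPochhammer ℝ n).eval p / (n.factorial : ℝ) * x ^ n := by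
    have h := (hasSum_one_sub_cpow_neg p (z := x) (by simpa [abs_of_nonneg hx0])).summable
    exact_mod_cast h
  have h := hasSum_sq_of_hasSum_exp hsum
    (F := fun θ => (1 - (x : ℂ) * Complex.exp (θ * Complex.I)) ^ ((-p : ℝ) : ℂ)) fun θ => by
      refine (hasSum_one_sub_cpow_neg p ?_).congr_fun fun n => ?_
      · simpa [Complex.norm_exp_ofReal_mul_I, abs_of_nonneg hx0]
      · rw [mul_pow, ← Complex.exp_nat_mul, mul_assoc (n : ℂ)]
        push_cast
        ring
  rw [← tsum_mul_left]
  refine Eq.trans ?_ (h.tsum_eq.symm.trans (tsum_congr fun n => by rw [mul_pow, ← pow_mul']))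
  refine intervalIntegral.integral_congr fun θ _ => ?_
  rw [Complex.norm_cpow_real, ← norm_one_sub_mul_exp_sq, ← rpow_natCast, ← rpow_natCast,
    ← rpow_mul (norm_nonneg _), ← rpow_mul (norm_nonneg _), mul_comm (-p)]

/-- The substitution `t = (1 + cos θ) / 2`. -/
theorem integral_div_sqrt_mul_one_sub (g : ℝ → ℝ) :
    ∫ t in (0 : ℝ)..1, 1 / (g t * √(t * (1 - t))) =
      ∫ θ in (0 : ℝ)..π, 1 / g ((1 + cos θ) / 2) := by
  have hinj : InjOn (fun θ => (1 + cos θ) / 2) (Ioo 0 π) := fun x hx y hy h =>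
    injOn_cos (Ioo_subset_Icc_self hx) (Ioo_subset_Icc_self hy) (by simp only at h; linarith)
  have himage : (fun θ => (1 + cos θ) / 2) '' Ioo 0 π = Ioo 0 1 := by
    ext t
    constructor
    · rintro ⟨θ, hθ, rfl⟩
      have h1 := strictAntiOn_cos ⟨le_rfl, pi_pos.le⟩ (Ioo_subset_Icc_self hθ) hθ.1
      have h2 := strictAntiOn_cos (Ioo_subset_Icc_self hθ) ⟨pi_pos.le, le_rfl⟩ hθ.2
      rw [cos_zero] at h1
      rw [cos_pi] at h2
      constructor <;> simp only <;> linarith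
    · rintro ⟨h0, h1⟩
      refine ⟨arccos (2 * t - 1), ⟨arccos_pos.2 (by linarith), ?_⟩, ?_⟩
      · refine lt_of_le_of_ne (arccos_le_pi _) fun h => ?_
        rw [arccos_eq_pi] at h
        linarith
      · simp only
        rw [cos_arccos (by linarith) (by linarith)]
        ring
  rw [intervalIntegral.integral_of_le zero_le_one, intervalIntegral.integral_of_le pi_pos.le,
    integral_Ioc_eq_integral_Ioo, integral_Ioc_eq_integral_Ioo, ← himage,
    integral_image_eq_integral_abs_deriv_smul (f' := fun θ => -sin θ / 2) measurableSet_Ioo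
      (fun θ _ => (((hasDerivAt_cos θ).const_add 1).div_const 2).hasDerivWithinAt) hinj]
  refine setIntegral_congr_fun measurableSet_Ioo fun θ hθ => ?_
  have hsin := sin_pos_of_mem_Ioo hθ
  have hsqrt : √((1 + cos θ) / 2 * (1 - (1 + cos θ) / 2)) = sin θ / 2 := by
    rw [← sqrt_sq (half_pos hsin).le]
    congr 1
    linear_combination (-1 / 4) * sin_sq_add_cos_sq θ
  have habs : |-sin θ / 2| = sin θ / 2 := by
    rw [neg_div, abs_neg, abs_of_pos (half_pos hsin)]
  simp only [smul_eq_mul]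
  rw [hsqrt, habs, one_div, one_div, mul_inv, mul_left_comm, mul_inv_cancel₀ (half_pos hsin).ne',
    mul_one]


/-- For `k ≥ 1`, `0 < a < 1` and `b = 4a^k/(1+a^k)²`, the integral expression for the total
length of the regular lemniscate `C_{a,k}` equals the hypergeometric series
`2π·₂F₁((k-1)/(2k), (k-1)/(2k), 1; a^{2k})`, written out with Pochhammer symbols. -/
theorem stmt_14 (k : ℕ) (hk : 1 ≤ k) (a : ℝ) (ha0 : 0 < a) (ha1 : a < 1) :
    (2 / (1 + a ^ k) ^ (((k : ℝ) - 1) / (k : ℝ))) *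
        (∫ t in (0:ℝ)..1,
          1 / ((1 - (4 * a ^ k / (1 + a ^ k) ^ 2) * t) ^ (((k : ℝ) - 1) / (2 * (k : ℝ))) *
            Real.sqrt (t * (1 - t)))) =
      2 * Real.pi *
        ∑' n : ℕ,
          ((ascPochhammer ℝ n).eval (((k : ℝ) - 1) / (2 * (k : ℝ))) / (n.factorial : ℝ)) ^ 2 *
            a ^ (2 * k * n) := by
  have hk0 : (k : ℝ) ≠ 0 := by positivity
  have hx1 : a ^ k < 1 := pow_lt_one₀ ha0.le ha1 (by omega)
  have hx0 : 0 < a ^ k := pow_pos ha0 k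
  have hexp : ((k : ℝ) - 1) / (k : ℝ) = 2 * (((k : ℝ) - 1) / (2 * (k : ℝ))) := by field_simp
  have hpow (n : ℕ) : a ^ (2 * k * n) = (a ^ k) ^ (2 * n) := by rw [← pow_mul]; congr 1; ring
  simp only [hexp, hpow]
  generalize ((k : ℝ) - 1) / (2 * (k : ℝ)) = p
  generalize a ^ k = x at hx0 hx1
  have hx : 0 < 1 + x := by linarith
  rw [integral_div_sqrt_mul_one_sub fun t => (1 - 4 * x / (1 + x) ^ 2 * t) ^ p, mul_assoc 2 π,
    ← integral_one_add_sq_sub_cos_rpow p hx0.le hx1, ← intervalIntegral.integral_const_mul,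
    ← intervalIntegral.integral_const_mul]
  refine intervalIntegral.integral_congr fun θ _ => ?_
  have hN : 0 ≤ 1 + x ^ 2 - 2 * x * cos θ := norm_one_sub_mul_exp_sq x θ ▸ sq_nonneg _
  have hbase : 1 - 4 * x / (1 + x) ^ 2 * ((1 + cos θ) / 2) =
      (1 + x ^ 2 - 2 * x * cos θ) / (1 + x) ^ 2 := by
    field_simp
    ring
  have hne : ((1 + x) ^ 2) ^ p ≠ 0 := (rpow_pos_of_pos (by positivity) p).ne'
  rw [hbase, div_rpow hN (sq_nonneg _), rpow_mul hx.le, rpow_two, rpow_neg hN, one_div_div]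
  field_simp
end

section
/- For every real number a with 0 ≤ a < 1, one has Σ_{n=0}^∞ ( (1/4)_n / n! )² · a^{4n} = (2/π)·K((1 − √(1−a⁴))/2), where (x)_n is the ascending Pochhammer symbol and K(m) = ∫₀¹ dt/√((1−t²)(1−m t²)). In other words, ₂F₁(1/4, 1/4, 1; a⁴) = (2/π)·K((1−√(1−a⁴))/2). -/
open Set MeasureTheory

lemma hasDerivAt_tsum_mul_pow {d : ℕ → ℝ} {k : ℕ} (hd : ∀ n, |d n| ≤ (n : ℝ) ^ k) {x : ℝ}
    (hx : |x| < 1) :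
    HasDerivAt (fun y => ∑' n, d n * y ^ n) (∑' n, d n * (n * x ^ (n - 1))) x := by
  obtain ⟨ρ, hxρ, hρ1⟩ := exists_between hx
  have hρ0 : 0 < ρ := (abs_nonneg x).trans_lt hxρ
  have hu : Summable fun n : ℕ => (n : ℝ) ^ (k + 1) * ρ ^ (n - 1) := by
    have h := (summable_pow_mul_geometric_of_norm_lt_one (k + 1) (r := ρ)
      (by rwa [Real.norm_eq_abs, abs_of_pos hρ0])).mul_left ρ⁻¹
    refine h.congr fun n => ?_
    rcases n with _ | n
    · simp
    · simp only [Nat.add_sub_cancel, pow_succ ρ]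
      field_simp
  refine hasDerivAt_tsum_of_isPreconnected (g := fun n y => d n * y ^ n)
    (g' := fun n y => d n * (n * y ^ (n - 1))) (t := Metric.ball 0 ρ) (y₀ := 0) hu
    Metric.isOpen_ball (convex_ball 0 ρ).isPreconnected
    (fun n y _ => (hasDerivAt_pow n y).const_mul (d n)) (fun n y hy => ?_)
    (Metric.mem_ball_self hρ0) (summable_of_ne_finset_zero (s := {0}) fun n hn => ?_)
    (by simpa using hxρ)
  · have hy : |y| < ρ := by simpa using hy
    rw [Real.norm_eq_abs, abs_mul, abs_mul, abs_pow, Nat.abs_cast, pow_succ, mul_assoc]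
    gcongr
    exact hd n
  · simp [show n ≠ 0 by simpa using hn]

lemma hasDerivAt_tsum_mul_pow_of_ne_zero {d : ℕ → ℝ} {k : ℕ} (hd : ∀ n, |d n| ≤ (n : ℝ) ^ k)
    {x : ℝ} (hx : |x| < 1) (hx0 : x ≠ 0) :
    HasDerivAt (fun y => ∑' n, d n * y ^ n) ((∑' n : ℕ, (n * d n) * x ^ n) / x) x := by
  convert hasDerivAt_tsum_mul_pow hd hx using 1
  rw [← tsum_div_const]
  refine tsum_congr fun n => ?_
  rcases n with _ | n
  · simp
  · simp only [Nat.add_sub_cancel, pow_succ]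
    field_simp

lemma summable_mul_pow_of_abs_le {d : ℕ → ℝ} {k : ℕ} (hd : ∀ n, |d n| ≤ (n : ℝ) ^ k) {x : ℝ}
    (hx : |x| < 1) : Summable fun n => d n * x ^ n := by
  refine Summable.of_norm_bounded
    (summable_pow_mul_geometric_of_norm_lt_one k (r := |x|) (by simpa using hx)) fun n => ?_
  rw [norm_mul, norm_pow, Real.norm_eq_abs, Real.norm_eq_abs]
  gcongr
  exact hd n

/-- The coefficient `(α)ₙ / n!`. -/
noncomputable def pochCoeff (α : ℝ) (n : ℕ) : ℝ :=
  (ascPochhammer ℝ n).eval α / (n.factorial : ℝ)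

@[simp] lemma pochCoeff_zero (α : ℝ) : pochCoeff α 0 = 1 := by simp [pochCoeff]

lemma succ_mul_pochCoeff_succ (α : ℝ) (n : ℕ) :
    (n + 1) * pochCoeff α (n + 1) = (n + α) * pochCoeff α n := by
  have : (n.factorial : ℝ) ≠ 0 := by positivity
  have : (n + 1 : ℝ) ≠ 0 := by positivity
  simp only [pochCoeff, ascPochhammer_succ_eval, Nat.factorial_succ]
  push_cast
  field_simp
  ring

lemma pochCoeff_succ (α : ℝ) (n : ℕ) :
    pochCoeff α (n + 1) = (n + α) / (n + 1) * pochCoeff α n := by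
  have : (n + 1 : ℝ) ≠ 0 := by positivity
  rw [div_mul_eq_mul_div, ← succ_mul_pochCoeff_succ]
  field_simp

lemma pochCoeff_mem_Icc {α : ℝ} (h0 : 0 ≤ α) (h1 : α ≤ 1) (n : ℕ) :
    pochCoeff α n ∈ Icc (0 : ℝ) 1 := by
  induction n with
  | zero => simp
  | succ n ih =>
    rw [pochCoeff_succ]
    refine ⟨mul_nonneg (by positivity) ih.1, mul_le_one₀ ?_ ih.1 ih.2⟩
    rw [div_le_one (by positivity)]
    linarith

/-- The series `∑ nᵏ ((α)ₙ / n!)² xⁿ`, obtained from `₂F₁(α, α; 1; x)` by applying `x d/dx`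
`k` times. -/
noncomputable def hyperEuler (α : ℝ) (k : ℕ) (x : ℝ) : ℝ :=
  ∑' n : ℕ, (n ^ k * pochCoeff α n ^ 2) * x ^ n

lemma abs_natCast_pow_mul_pochCoeff_sq_le {α : ℝ} (h0 : 0 ≤ α) (h1 : α ≤ 1) (k n : ℕ) :
    |(n : ℝ) ^ k * pochCoeff α n ^ 2| ≤ (n : ℝ) ^ k := by
  have h := pochCoeff_mem_Icc h0 h1 n
  rw [abs_of_nonneg (by positivity)]
  exact mul_le_of_le_one_right (by positivity) (pow_le_one₀ h.1 h.2)

lemma hyperEuler_zero_right (α : ℝ) (k : ℕ) : hyperEuler α k 0 = 0 ^ k := by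
  rw [hyperEuler, tsum_eq_single 0 fun n hn => by simp [hn]]
  simp

lemma hasDerivAt_hyperEuler {α : ℝ} (h0 : 0 ≤ α) (h1 : α ≤ 1) (k : ℕ) {x : ℝ} (hx : |x| < 1)
    (hx0 : x ≠ 0) : HasDerivAt (hyperEuler α k) (hyperEuler α (k + 1) x / x) x := by
  refine (hasDerivAt_tsum_mul_pow_of_ne_zero (abs_natCast_pow_mul_pochCoeff_sq_le h0 h1 k) hx
    hx0).congr_deriv (congrArg (· / x) (tsum_congr fun n => ?_))
  ring

lemma continuousAt_hyperEuler {α : ℝ} (h0 : 0 ≤ α) (h1 : α ≤ 1) (k : ℕ) {x : ℝ} (hx : |x| < 1) :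
    ContinuousAt (hyperEuler α k) x :=
  (hasDerivAt_tsum_mul_pow (abs_natCast_pow_mul_pochCoeff_sq_le h0 h1 k) hx).continuousAt

/-- The hypergeometric differential equation for `₂F₁(α, α; 1; x)`. -/
lemma hyperEuler_two_eq {α : ℝ} (h0 : 0 ≤ α) (h1 : α ≤ 1) {x : ℝ} (hx : |x| < 1) :
    hyperEuler α 2 x =
      x * (hyperEuler α 2 x + 2 * α * hyperEuler α 1 x + α ^ 2 * hyperEuler α 0 x) := by
  have hs (k : ℕ) := summable_mul_pow_of_abs_le (abs_natCast_pow_mul_pochCoeff_sq_le h0 h1 k) hx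
  have hs' (k : ℕ) := (hs k).hasSum
  have h := (((hs' 2).add ((hs' 1).mul_left (2 * α))).add ((hs' 0).mul_left (α ^ 2))).mul_left x
  refine Eq.trans ?_ h.tsum_eq
  rw [hyperEuler, (hs 2).tsum_eq_zero_add]
  simp only [CharP.cast_eq_zero, ne_eq, OfNat.ofNat_ne_zero, not_false_eq_true, zero_pow, zero_mul,
    zero_add]
  refine tsum_congr fun n => ?_
  have hn := succ_mul_pochCoeff_succ α n
  push_cast
  rw [← mul_pow, hn]
  ring

/-- Uniqueness of the solution of `(x (1 - x) h')' = h / 4` that is regular at `0`. -/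
lemma eq_zero_of_legendre_equation {h k : ℝ → ℝ} {m : ℝ} (hm0 : 0 ≤ m) (hm : m ≤ 1 / 2)
    (hh : ContinuousOn h (Icc 0 m)) (hk : ContinuousOn k (Icc 0 m)) (hh0 : h 0 = 0) (hk0 : k 0 = 0)
    (hh' : ∀ x ∈ Ioo 0 m, HasDerivAt h (k x / (x * (1 - x))) x)
    (hk' : ∀ x ∈ Ioo 0 m, HasDerivAt k (h x / 4) x) : h m = 0 := by
  obtain ⟨x₀, hx₀, hmax⟩ := isCompact_Icc.exists_isMaxOn (nonempty_Icc.2 hm0) hh.abs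
  suffices h x₀ = 0 by
    have := hmax (right_mem_Icc.2 hm0)
    simp_all
  rcases hx₀.1.eq_or_lt with rfl | hx0
  · exact hh0
  obtain ⟨ξ, hξ, hξ'⟩ := exists_hasDerivAt_eq_slope h _ hx0
    (hh.mono (Icc_subset_Icc_right hx₀.2)) fun x hx => hh' x ⟨hx.1, hx.2.trans_le hx₀.2⟩
  have hξm : ξ < m := hξ.2.trans_le hx₀.2
  obtain ⟨η, hη, hη'⟩ := exists_hasDerivAt_eq_slope k _ hξ.1
    (hk.mono (Icc_subset_Icc_right hξm.le)) fun x hx => hk' x ⟨hx.1, hx.2.trans hξm⟩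
  have hM : |h η| ≤ |h x₀| := hmax ⟨hη.1.le, (hη.2.trans hξm).le⟩
  have hξ0 := hξ.1
  have h1ξ : 1 / 2 < 1 - ξ := by linarith
  rw [hk0, sub_zero, sub_zero, eq_div_iff hξ0.ne'] at hη'
  rw [hh0, sub_zero, sub_zero, eq_div_iff hx0.ne', ← hη'] at hξ'
  have key : h x₀ = h η * (x₀ / (4 * (1 - ξ))) := by
    rw [← hξ']
    have : (1 - ξ) ≠ 0 := by linarith
    field_simp
  have hfac : x₀ / (4 * (1 - ξ)) ≤ 1 / 2 := by
    rw [div_le_iff₀ (by linarith)]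
    linarith [hx₀.2]
  have hfac0 : 0 ≤ x₀ / (4 * (1 - ξ)) := div_nonneg hx0.le (by linarith)
  have : |h x₀| ≤ |h x₀| * (1 / 2) := by
    conv_lhs => rw [key, abs_mul, abs_of_nonneg hfac0]
    gcongr
  exact abs_nonpos_iff.1 (by linarith)

/-- The quadratic transformation `₂F₁(1/4, 1/4; 1; 4 m (1 - m)) = ₂F₁(1/2, 1/2; 1; m)`. -/
lemma hyperEuler_quadratic_transformation {m : ℝ} (hm0 : 0 ≤ m) (hm : m < 1 / 2) :
    hyperEuler (1 / 4) 0 (4 * m * (1 - m)) = hyperEuler (1 / 2) 0 m := by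
  have hlt {x : ℝ} (hx : x ∈ Icc 0 m) : |x| < 1 := by
    rw [abs_of_nonneg hx.1]; linarith [hx.2]
  have hq {x : ℝ} (hx : x ∈ Icc 0 m) : |4 * x * (1 - x)| < 1 := by
    have := hx.1
    have := hx.2
    rw [abs_of_nonneg (mul_nonneg (by linarith) (by linarith))]
    nlinarith [mul_pos (show 0 < 1 / 2 - x by linarith) (show 0 < 1 / 2 - x by linarith)]
  have hc2 (k : ℕ) : ContinuousOn (hyperEuler (1 / 2) k) (Icc 0 m) := fun x hx =>
    (continuousAt_hyperEuler (by norm_num) (by norm_num) k (hlt hx)).continuousWithinAt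
  have hc4 (k : ℕ) : ContinuousOn (fun x => hyperEuler (1 / 4) k (4 * x * (1 - x))) (Icc 0 m) :=
    fun x hx => (ContinuousAt.comp (f := fun x : ℝ => 4 * x * (1 - x))
      (continuousAt_hyperEuler (by norm_num) (by norm_num) k (hq hx))
      (by fun_prop)).continuousWithinAt
  have hd4 (k : ℕ) {x : ℝ} (hx : x ∈ Ioo 0 m) :
      HasDerivAt (fun x => hyperEuler (1 / 4) k (4 * x * (1 - x)))
        (hyperEuler (1 / 4) (k + 1) (4 * x * (1 - x)) / (4 * x * (1 - x)) * (4 * (1 - 2 * x)))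
        x := by
    have hne : 4 * x * (1 - x) ≠ 0 :=
      mul_ne_zero (mul_ne_zero (by norm_num) hx.1.ne') (by linarith [hx.2])
    refine HasDerivAt.comp (h := fun x : ℝ => 4 * x * (1 - x)) x
      (hasDerivAt_hyperEuler (by norm_num) (by norm_num) k (hq (Ioo_subset_Icc_self hx)) hne) ?_
    refine (((hasDerivAt_id x).const_mul 4).mul ((hasDerivAt_id x).const_sub 1)).congr_deriv ?_
    simp only [id]
    ring
  have hd2 (k : ℕ) {x : ℝ} (hx : x ∈ Ioo 0 m) :=
    hasDerivAt_hyperEuler (α := 1 / 2) (by norm_num) (by norm_num) k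
      (hlt (Ioo_subset_Icc_self hx)) hx.1.ne'
  refine sub_eq_zero.1 (eq_zero_of_legendre_equation
    (h := fun x => hyperEuler (1 / 4) 0 (4 * x * (1 - x)) - hyperEuler (1 / 2) 0 x)
    (k := fun x => (1 - 2 * x) * hyperEuler (1 / 4) 1 (4 * x * (1 - x)) -
      (1 - x) * hyperEuler (1 / 2) 1 x) hm0 hm.le ((hc4 0).sub (hc2 0))
    (((by fun_prop : ContinuousOn (fun x : ℝ => 1 - 2 * x) (Icc 0 m)).mul (hc4 1)).sub
      ((by fun_prop : ContinuousOn (fun x : ℝ => 1 - x) (Icc 0 m)).mul (hc2 1)))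
    (by simp [hyperEuler_zero_right]) (by simp [hyperEuler_zero_right])
    (fun x hx => ?_) (fun x hx => ?_))
  · have hx0 : x ≠ 0 := hx.1.ne'
    have hx1 : 1 - x ≠ 0 := by linarith [hx.2]
    refine ((hd4 0 hx).sub (hd2 0 hx)).congr_deriv ?_
    field_simp
  · have hx0 : x ≠ 0 := hx.1.ne'
    have hx1 : 1 - x ≠ 0 := by linarith [hx.2]
    have hode4 := hyperEuler_two_eq (α := 1 / 4) (by norm_num) (by norm_num)
      (hq (Ioo_subset_Icc_self hx))
    have hode2 := hyperEuler_two_eq (α := 1 / 2) (by norm_num) (by norm_num)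
      (hlt (Ioo_subset_Icc_self hx))
    refine (((((hasDerivAt_id x).const_mul 2).const_sub 1).mul (hd4 1 hx)).sub
      (((hasDerivAt_id x).const_sub 1).mul (hd2 1 hx))).congr_deriv ?_
    simp only [id, Nat.reduceAdd, mul_one]
    generalize hyperEuler (1 / 4) 2 (4 * x * (1 - x)) = C4 at *
    generalize hyperEuler (1 / 4) 1 (4 * x * (1 - x)) = B4 at *
    generalize hyperEuler (1 / 4) 0 (4 * x * (1 - x)) = A4 at *
    generalize hyperEuler (1 / 2) 2 x = C2 at *
    generalize hyperEuler (1 / 2) 1 x = B2 at *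
    generalize hyperEuler (1 / 2) 0 x = A2 at *
    field_simp
    linear_combination 4 * hode4 - 4 * (1 - x) * hode2

lemma hasSum_pochCoeff_half_mul_pow {x : ℝ} (hx : |x| < 1) :
    HasSum (fun n => pochCoeff (1 / 2) n * x ^ n) (1 / √(1 - x)) := by
  have h := (Real.one_div_one_sub_rpow_hasFPowerSeriesOnBall_zero (1 / 2)).hasSum (y := x)
    (by simpa [← ofReal_norm] using hx)
  rw [zero_add, ← Real.sqrt_eq_rpow] at h
  refine (funext fun n => ?_ : (fun n => pochCoeff (1 / 2) n * x ^ n) = _) ▸ h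
  rw [FormalMultilinearSeries.ofScalars_apply_eq, smul_eq_mul]
  congr 1
  have := Ring.factorial_nsmul_multichoose_eq_ascPochhammer (1 / 2 : ℝ) n
  rw [Polynomial.ascPochhammer_smeval_eq_eval, nsmul_eq_mul] at this
  rw [Ring.choose, pochCoeff, ← this, mul_div_cancel_left₀ _ (by positivity)]
  congr 1
  ring

lemma integral_cos_pow_two_mul (n : ℕ) :
    ∫ θ in (0 : ℝ)..Real.pi / 2, Real.cos θ ^ (2 * n) = Real.pi / 2 * pochCoeff (1 / 2) n := by
  rw [EulerSine.integral_cos_pow_eq, integral_sin_pow_even]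
  have : ∏ i ∈ Finset.range n, (2 * (i : ℝ) + 1) / (2 * i + 2) = pochCoeff (1 / 2) n := by
    induction n with
    | zero => simp
    | succ n ih =>
      rw [Finset.prod_range_succ, ih, pochCoeff_succ]
      field_simp
  rw [this]
  ring

lemma image_cos_Ioo : Real.cos '' Ioo 0 (Real.pi / 2) = Ioo 0 1 := by
  ext t
  constructor
  · rintro ⟨θ, hθ, rfl⟩
    refine ⟨Real.cos_pos_of_mem_Ioo ⟨by linarith [hθ.1, Real.pi_pos], hθ.2⟩, ?_⟩
    rw [← Real.cos_zero]
    exact Real.cos_lt_cos_of_nonneg_of_le_pi_div_two le_rfl hθ.2.le hθ.1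
  · intro ht
    exact ⟨Real.arccos t, ⟨Real.arccos_pos.2 ht.2, Real.arccos_lt_pi_div_two.2 ht.1⟩,
      Real.cos_arccos (by linarith [ht.1]) ht.2.le⟩

lemma integral_elliptic_eq_integral_cos (m : ℝ) :
    ∫ t in (0 : ℝ)..1, 1 / √((1 - t ^ 2) * (1 - m * t ^ 2)) =
      ∫ θ in (0 : ℝ)..Real.pi / 2, 1 / √(1 - m * Real.cos θ ^ 2) := by
  rw [intervalIntegral.integral_of_le zero_le_one,
    intervalIntegral.integral_of_le (by positivity), integral_Ioc_eq_integral_Ioo,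
    integral_Ioc_eq_integral_Ioo, ← image_cos_Ioo,
    integral_image_eq_integral_abs_deriv_smul measurableSet_Ioo
      (fun θ _ => (Real.hasDerivAt_cos θ).hasDerivWithinAt)
      (Real.injOn_cos.mono (Ioo_subset_Icc_self.trans (Icc_subset_Icc_right (by linarith [Real.pi_pos]))))]
  refine setIntegral_congr_fun measurableSet_Ioo fun θ hθ => ?_
  have hsin : 0 < Real.sin θ := Real.sin_pos_of_pos_of_lt_pi hθ.1 (by linarith [hθ.2, Real.pi_pos])
  simp only [smul_eq_mul]
  rw [abs_neg, abs_of_pos hsin, ← Real.sin_sq, Real.sqrt_mul (sq_nonneg _),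
    Real.sqrt_sq hsin.le, one_div, mul_inv, mul_inv_cancel_left₀ hsin.ne', one_div]

lemma integral_elliptic_eq_hyperEuler {m : ℝ} (hm : |m| < 1) :
    ∫ t in (0 : ℝ)..1, 1 / √((1 - t ^ 2) * (1 - m * t ^ 2)) =
      Real.pi / 2 * hyperEuler (1 / 2) 0 m := by
  rw [integral_elliptic_eq_integral_cos]
  have hcoeff (n : ℕ) := pochCoeff_mem_Icc (α := 1 / 2) (by norm_num) (by norm_num) n
  have hcos (θ : ℝ) : Real.cos θ ^ 2 ≤ 1 := Real.cos_sq_le_one θ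
  have h := intervalIntegral.hasSum_integral_of_dominated_convergence
    (F := fun (n : ℕ) θ => pochCoeff (1 / 2) n * (m * Real.cos θ ^ 2) ^ n)
    (f := fun θ => 1 / √(1 - m * Real.cos θ ^ 2)) (μ := volume) (a := 0) (b := Real.pi / 2)
    (fun n _ => |m| ^ n) (fun n => by fun_prop)
    (fun n => ae_of_all _ fun θ _ => ?_)
    (ae_of_all _ fun _ _ => summable_geometric_of_lt_one (abs_nonneg m) hm) (by simp)
    (ae_of_all _ fun θ _ => hasSum_pochCoeff_half_mul_pow ?_)
  · rw [← h.tsum_eq, hyperEuler, ← tsum_mul_left]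
    refine tsum_congr fun n => ?_
    simp_rw [mul_pow, ← mul_assoc, ← pow_mul]
    rw [intervalIntegral.integral_const_mul, integral_cos_pow_two_mul]
    ring
  · rw [norm_mul, norm_pow, norm_mul, Real.norm_of_nonneg (hcoeff n).1, Real.norm_eq_abs,
      Real.norm_of_nonneg (sq_nonneg _)]
    refine (mul_le_of_le_one_left (by positivity) (hcoeff n).2).trans ?_
    gcongr
    exact mul_le_of_le_one_right (abs_nonneg m) (hcos θ)
  · rw [abs_mul, abs_of_nonneg (sq_nonneg (Real.cos θ))]
    exact (mul_le_of_le_one_right (abs_nonneg m) (hcos θ)).trans_lt hm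

/-- For `0 ≤ a < 1`: `₂F₁(1/4, 1/4, 1; a⁴) = (2/π)·K((1-√(1-a⁴))/2)`, with the
hypergeometric series written out via Pochhammer symbols and
`K(m) = ∫₀¹ dt/√((1-t²)(1-mt²))`. -/
theorem stmt_16 (a : ℝ) (ha0 : 0 ≤ a) (ha1 : a < 1) :
    (∑' n : ℕ, ((ascPochhammer ℝ n).eval (1 / 4 : ℝ) / (n.factorial : ℝ)) ^ 2 * a ^ (4 * n)) =
      (2 / Real.pi) *
        ∫ t in (0:ℝ)..1,
          1 / Real.sqrt ((1 - t ^ 2) * (1 - ((1 - Real.sqrt (1 - a ^ 4)) / 2) * t ^ 2)) := by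
  set s := √(1 - a ^ 4) with hs
  have ha4 : a ^ 4 < 1 := pow_lt_one₀ ha0 ha1 (by norm_num)
  have hs0 : 0 < s := Real.sqrt_pos.2 (by linarith)
  have hs2 : s ^ 2 = 1 - a ^ 4 := Real.sq_sqrt (by linarith)
  have hs1 : s ≤ 1 := Real.sqrt_le_one.2 (by linarith [pow_nonneg ha0 4])
  have hm : |(1 - s) / 2| < 1 := by
    rw [abs_of_nonneg (by linarith)]
    linarith
  rw [integral_elliptic_eq_hyperEuler hm, ← hyperEuler_quadratic_transformation (by linarith)
    (by linarith), show 4 * ((1 - s) / 2) * (1 - (1 - s) / 2) = a ^ 4 by linear_combination -hs2,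
    ← mul_assoc, div_mul_div_cancel₀ Real.pi_ne_zero, div_self two_ne_zero, one_mul, hyperEuler]
  simp only [pow_zero, one_mul, pochCoeff, pow_mul]
end

section
/- Fix an integer k ≥ 2 and define g(a) = (4/(1+a^k)^{(k−1)/k}) · ∫₀^{π/2} (1 − (4a^k/(1+a^k)²)·sin²φ)^{−(k−1)/(2k)} dφ for 0 ≤ a ≤ 1, so that g(a) is the total length of the regular lemniscate C_{a,k} for 0 < a ≤ 1. Then: (i) g is strictly increasing on [0,1); (ii) g is convex on [0,1); (iii) g(a) ≤ g(1) for all a ∈ [0,1]; and (iv) for every a > 1, a^{−(k−1)}·g(1/a) ≤ g(1), i.e. the length of C_{a,k} (which equals a^{−(k−1)}·g(1/a) for a > 1) attains its maximum over all a > 0 at a = 1. -/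
open Filter Topology

lemma summable_abs_choose_mul_pow (β x : ℝ) (hx0 : 0 ≤ x) (hx1 : x < 1) :
    Summable fun n => |Ring.choose β n * x ^ n| := by
  have hx : x ∈ Metric.eball (0 : ℝ) 1 := by
    rw [← ENNReal.ofReal_one, Metric.eball_ofReal]
    simpa [abs_of_nonneg hx0] using hx1
  have h := (binomialSeries ℝ β).summable_norm_apply
    (Metric.eball_subset_eball Real.one_add_rpow_hasFPowerSeriesOnBall_zero.r_le hx)
  simpa [binomialSeries_apply, -FormalMultilinearSeries.apply_eq_prod_smul_coeff] using h

lemma hasSum_choose_mul_pow (β : ℝ) {z : ℂ} (hz : ‖z‖ < 1) :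
    HasSum (fun n => ((Ring.choose β n : ℝ) : ℂ) * z ^ n) ((1 + z) ^ (β : ℂ)) := by
  have hzmem : z ∈ Metric.eball (0 : ℂ) 1 := by
    rw [← ENNReal.ofReal_one, Metric.eball_ofReal]
    simpa using hz
  have h := (Complex.one_add_cpow_hasFPowerSeriesOnBall_zero (a := (β : ℂ))).hasSum hzmem
  rw [zero_add] at h
  refine h.congr_fun fun n => ?_
  rw [binomialSeries_apply, Complex.ofReal_choose]
  simp

lemma choose_mul_pow_mul_conj (β x θ : ℝ) (n m : ℕ) :
    ((Ring.choose β n : ℝ) : ℂ) * (x * Complex.exp (θ * Complex.I)) ^ n *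
      (starRingEnd ℂ) ((Ring.choose β m : ℝ) * (x * Complex.exp (θ * Complex.I)) ^ m) =
    ((Ring.choose β n * x ^ n * (Ring.choose β m * x ^ m) : ℝ) : ℂ) *
      Complex.exp ((((n : ℝ) - m) * θ : ℝ) * Complex.I) := by
  have hexp : Complex.exp ((((n : ℝ) - m) * θ : ℝ) * Complex.I) =
      Complex.exp (θ * Complex.I) ^ n * Complex.exp (-(θ * Complex.I)) ^ m := by
    rw [← Complex.exp_nat_mul, ← Complex.exp_nat_mul, ← Complex.exp_add]
    congr 1
    push_cast
    ring
  have hc : (starRingEnd ℂ) (Complex.exp (θ * Complex.I)) = Complex.exp (-(θ * Complex.I)) := by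
    rw [← Complex.exp_conj]
    simp
  rw [hexp, map_mul, map_pow, map_mul, Complex.conj_ofReal, Complex.conj_ofReal, hc]
  push_cast
  ring

lemma norm_one_add_cpow_sq (β x θ : ℝ) :
    ‖(1 + x * Complex.exp (θ * Complex.I)) ^ (β : ℂ)‖ ^ 2 =
      (1 + 2 * x * Real.cos θ + x ^ 2) ^ β := by
  rw [Complex.norm_cpow_real, ← Real.rpow_natCast, ← Real.rpow_mul (norm_nonneg _), mul_comm β,
    Real.rpow_mul (norm_nonneg _), Real.rpow_natCast, ← Complex.normSq_eq_norm_sq,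
    Complex.normSq_apply, Complex.add_re, Complex.add_im, Complex.re_ofReal_mul,
    Complex.im_ofReal_mul, Complex.exp_ofReal_mul_I_re, Complex.exp_ofReal_mul_I_im,
    Complex.one_re, Complex.one_im]
  congr 1
  linear_combination x ^ 2 * Real.sin_sq_add_cos_sq θ

lemma hasSum_re_mul_conj {f : ℕ → ℂ} {w : ℂ} (hf : HasSum f w) (hnorm : Summable fun n => ‖f n‖) :
    HasSum (fun p : ℕ × ℕ => (f p.1 * (starRingEnd ℂ) (f p.2)).re) (‖w‖ ^ 2) := by
  have hconj : HasSum (fun n => (starRingEnd ℂ) (f n)) ((starRingEnd ℂ) w) :=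
    Complex.hasSum_conj'.mpr hf
  have hnorm' : Summable fun n => ‖(starRingEnd ℂ) (f n)‖ := by simpa using hnorm
  have hprod := hf.mul (g := fun n => (starRingEnd ℂ) (f n)) hconj
    (summable_mul_of_summable_norm (g := fun n => (starRingEnd ℂ) (f n)) hnorm hnorm')
  have hre := Complex.hasSum_re hprod
  rwa [Complex.mul_conj, Complex.ofReal_re, Complex.normSq_eq_norm_sq] at hre

/-- The double binomial expansion of `|1 + x e^{2iφ}| ^ (2β)`, with
`|1 + x e^{2iφ}|² = (1 - x)² + 4 x cos² φ`. -/
lemma hasSum_rpow_dist_sq (β x φ : ℝ) (hx0 : 0 ≤ x) (hx1 : x < 1) :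
    HasSum (fun p : ℕ × ℕ => Ring.choose β p.1 * x ^ p.1 * (Ring.choose β p.2 * x ^ p.2) *
      Real.cos (((p.1 : ℝ) - p.2) * (2 * φ)))
      (((1 - x) ^ 2 + 4 * x * Real.cos φ ^ 2) ^ β) := by
  have hz : ‖(x : ℂ) * Complex.exp ((2 * φ : ℝ) * Complex.I)‖ = x := by
    rw [norm_mul, Complex.norm_exp_ofReal_mul_I, Complex.norm_real, Real.norm_of_nonneg hx0,
      mul_one]
  have hsum := hasSum_choose_mul_pow β (hz.trans_lt hx1)
  have hnorm : Summable fun n =>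
      ‖((Ring.choose β n : ℝ) : ℂ) * (x * Complex.exp ((2 * φ : ℝ) * Complex.I)) ^ n‖ := by
    refine (summable_abs_choose_mul_pow β x hx0 hx1).congr fun n => ?_
    rw [norm_mul, norm_pow, hz, Complex.norm_real, Real.norm_eq_abs, abs_mul,
      abs_of_nonneg (pow_nonneg hx0 n)]
  have hre := hasSum_re_mul_conj hsum hnorm
  simp only [choose_mul_pow_mul_conj, Complex.re_ofReal_mul, Complex.exp_ofReal_mul_I_re,
    norm_one_add_cpow_sq] at hre
  have hbase : (1 - x) ^ 2 + 4 * x * Real.cos φ ^ 2 =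
      1 + 2 * x * Real.cos (2 * φ) + x ^ 2 := by
    rw [Real.cos_two_mul]
    ring
  rw [hbase]
  exact hre

lemma integral_cos_two_mul_int_mul (n m : ℕ) :
    ∫ φ in (0 : ℝ)..(Real.pi / 2), Real.cos (((n : ℝ) - m) * (2 * φ)) =
      if n = m then Real.pi / 2 else 0 := by
  split_ifs with h
  · simp [h]
  · have hne : ((n : ℝ) - m) * 2 ≠ 0 := by
      simpa [sub_eq_zero] using h
    have hpi : ((n : ℝ) - m) * 2 * (Real.pi / 2) = ((n - m : ℤ) : ℝ) * Real.pi := by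
      push_cast
      ring
    simp_rw [← mul_assoc]
    rw [intervalIntegral.integral_comp_mul_left _ hne, integral_cos, hpi, Real.sin_int_mul_pi]
    simp

/-- A quarter of the length of the regular lemniscate, as a function of `x = a ^ k`, with
`β = -(k - 1) / (2 k)`. -/
noncomputable def quarterLength (β x : ℝ) : ℝ :=
  ∫ φ in (0 : ℝ)..(Real.pi / 2), ((1 - x) ^ 2 + 4 * x * Real.cos φ ^ 2) ^ β

lemma hasSum_quarterLength (β x : ℝ) (hx0 : 0 ≤ x) (hx1 : x < 1) :
    HasSum (fun n => Real.pi / 2 * Ring.choose β n ^ 2 * x ^ (2 * n)) (quarterLength β x) := by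
  have habs := summable_abs_choose_mul_pow β x hx0 hx1
  have h := intervalIntegral.hasSum_integral_of_dominated_convergence
    (μ := MeasureTheory.volume) (a := 0) (b := Real.pi / 2)
    (F := fun (p : ℕ × ℕ) (φ : ℝ) => Ring.choose β p.1 * x ^ p.1 *
      (Ring.choose β p.2 * x ^ p.2) * Real.cos (((p.1 : ℝ) - p.2) * (2 * φ)))
    (f := fun φ => ((1 - x) ^ 2 + 4 * x * Real.cos φ ^ 2) ^ β)
    (fun p _ => |Ring.choose β p.1 * x ^ p.1| * |Ring.choose β p.2 * x ^ p.2|)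
    (fun p => Continuous.aestronglyMeasurable (by fun_prop))
    (fun p => Eventually.of_forall fun φ _ => by
      rw [norm_mul, norm_mul, Real.norm_eq_abs, Real.norm_eq_abs, Real.norm_eq_abs]
      exact mul_le_of_le_one_right (by positivity) (Real.abs_cos_le_one _))
    (Eventually.of_forall fun φ _ => habs.mul_of_nonneg habs (fun _ => abs_nonneg _)
      (fun _ => abs_nonneg _))
    (by simp)
    (Eventually.of_forall fun φ _ => hasSum_rpow_dist_sq β x φ hx0 hx1)
  simp only [intervalIntegral.integral_const_mul, integral_cos_two_mul_int_mul] at h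
  have hinj : Function.Injective fun n : ℕ => (n, n) := fun _ _ h => (Prod.ext_iff.mp h).1
  rw [← hinj.hasSum_iff] at h
  · refine h.congr_fun fun n => ?_
    simp only [Function.comp_apply, if_true]
    ring
  · rintro ⟨n, m⟩ hnm
    have : n ≠ m := fun h => hnm ⟨n, by simp [h]⟩
    simp [this]

lemma strictMonoOn_quarterLength {β : ℝ} (hβ : β ≠ 0) :
    StrictMonoOn (quarterLength β) (Set.Ico 0 1) := by
  intro x hx y hy hxy
  refine hasSum_lt (i := 1) (fun n => ?_) ?_ (hasSum_quarterLength β x hx.1 hx.2)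
    (hasSum_quarterLength β y hy.1 hy.2)
  · have := pow_le_pow_left₀ hx.1 hxy.le (2 * n)
    have := Real.pi_pos
    dsimp only
    gcongr
  · have h1 := pow_lt_pow_left₀ hxy hx.1 (n := 2 * 1) (by norm_num)
    have : 0 < Real.pi / 2 * Ring.choose β 1 ^ 2 := by
      rw [Ring.choose_one_right]
      have := Real.pi_pos
      positivity
    exact mul_lt_mul_of_pos_left h1 this

lemma convexOn_quarterLength (β : ℝ) : ConvexOn ℝ (Set.Ico 0 1) (quarterLength β) := by
  refine ⟨convex_Ico 0 1, fun x hx y hy s t hs ht hst => ?_⟩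
  have hw := convex_Ico (0 : ℝ) 1 hx hy hs ht hst
  refine hasSum_le (fun n => ?_) (hasSum_quarterLength β _ hw.1 hw.2)
    (((hasSum_quarterLength β x hx.1 hx.2).const_smul s).add
      ((hasSum_quarterLength β y hy.1 hy.2).const_smul t))
  have h := (convexOn_pow (2 * n)).2 (x := x) hx.1 (y := y) hy.1 hs ht hst
  have hc : 0 ≤ Real.pi / 2 * Ring.choose β n ^ 2 := by positivity
  have := mul_le_mul_of_nonneg_left h hc
  simp only [smul_eq_mul] at this ⊢
  linarith

lemma quarterLength_le_quarterLength_one {β : ℝ} (hβ : β < 0) (hβ' : -1 / 2 < β) {x : ℝ}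
    (hx0 : 0 ≤ x) (hx1 : x < 1) : quarterLength β x ≤ quarterLength β 1 := by
  have hlim : Tendsto (quarterLength β) (𝓝[<] 1) (𝓝 (quarterLength β 1)) := by
    refine intervalIntegral.tendsto_integral_filter_of_dominated_convergence
      (fun φ => (2 / Real.pi) ^ (2 * β) * (Real.pi / 2 - φ) ^ (2 * β)) ?_ ?_ ?_ ?_
    · exact Eventually.of_forall fun y => Measurable.aestronglyMeasurable (by fun_prop)
    · filter_upwards [Ioo_mem_nhdsLT (zero_lt_one (α := ℝ))] with y hy
      filter_upwards [MeasureTheory.Measure.ae_ne MeasureTheory.volume (Real.pi / 2)] with φ hne hφ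
      rw [Set.uIoc_of_le (by positivity)] at hφ
      have hlt : φ < Real.pi / 2 := lt_of_le_of_ne hφ.2 hne
      have hd : 0 < Real.pi / 2 - φ := sub_pos.2 hlt
      have hpi : 0 < 2 / Real.pi := by positivity
      have hcos : 2 / Real.pi * (Real.pi / 2 - φ) ≤ Real.cos φ := by
        rw [← Real.sin_pi_div_two_sub]
        exact Real.mul_le_sin hd.le (by linarith [hφ.1])
      have hsq : (2 / Real.pi * (Real.pi / 2 - φ)) ^ 2 ≤ Real.cos φ ^ 2 :=
        pow_le_pow_left₀ (by positivity) hcos 2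
      have hC1 := Real.cos_sq_le_one φ
      have hbase : Real.cos φ ^ 2 ≤ (1 - y) ^ 2 + 4 * y * Real.cos φ ^ 2 := by
        nlinarith [mul_nonneg (sub_nonneg.2 hC1) (sq_nonneg (1 - y)),
          mul_nonneg (sq_nonneg (Real.cos φ)) hy.1.le,
          mul_nonneg (sq_nonneg (Real.cos φ)) (sq_nonneg y)]
      have hpos : 0 < (2 / Real.pi * (Real.pi / 2 - φ)) ^ 2 := by positivity
      rw [Real.norm_of_nonneg (Real.rpow_nonneg (by linarith) _)]
      refine (Real.rpow_le_rpow_of_nonpos hpos (hsq.trans hbase) hβ.le).trans_eq ?_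
      rw [← Real.rpow_natCast, ← Real.rpow_mul (by positivity),
        Real.mul_rpow hpi.le hd.le]
      norm_num
    · have h := (intervalIntegral.intervalIntegrable_rpow' (a := Real.pi / 2) (b := 0)
        (r := 2 * β) (by linarith)).comp_sub_left (Real.pi / 2)
      simp only [sub_self, sub_zero] at h
      exact h.const_mul _
    · filter_upwards [MeasureTheory.Measure.ae_ne MeasureTheory.volume (Real.pi / 2)] with φ hne hφ
      rw [Set.uIoc_of_le (by positivity)] at hφ
      have hlt : φ < Real.pi / 2 := lt_of_le_of_ne hφ.2 hne
      have hcos : 0 < Real.cos φ := Real.cos_pos_of_mem_Ioo ⟨by linarith [hφ.1, Real.pi_pos], hlt⟩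
      have hcont : ContinuousAt
          (fun y : ℝ => ((1 - y) ^ 2 + 4 * y * Real.cos φ ^ 2) ^ β) 1 :=
        ContinuousAt.rpow_const (by fun_prop) (Or.inl (by simp [hcos.ne']))
      exact hcont.tendsto.mono_left nhdsWithin_le_nhds
  refine ge_of_tendsto hlim ?_
  filter_upwards [Ioo_mem_nhdsLT hx1] with y hy
  exact (strictMonoOn_quarterLength hβ.ne).monotoneOn ⟨hx0, hx1⟩
    ⟨hx0.trans hy.1.le, hy.2⟩ hy.1.le

lemma four_mul_quarterLength (β x : ℝ) (hx0 : 0 ≤ x) :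
    4 / (1 + x) ^ (-2 * β) * ∫ φ in (0 : ℝ)..(Real.pi / 2),
      (1 - 4 * x / (1 + x) ^ 2 * Real.sin φ ^ 2) ^ β = 4 * quarterLength β x := by
  have h1 : 0 < 1 + x := by linarith
  rw [quarterLength, ← intervalIntegral.integral_const_mul, ← intervalIntegral.integral_const_mul]
  congr 1
  ext φ
  have hkey : (1 - x) ^ 2 + 4 * x * Real.cos φ ^ 2 =
      (1 + x) ^ 2 * (1 - 4 * x / (1 + x) ^ 2 * Real.sin φ ^ 2) := by
    field_simp
    linear_combination 4 * x * Real.sin_sq_add_cos_sq φ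
  have hnonneg : 0 ≤ 1 - 4 * x / (1 + x) ^ 2 * Real.sin φ ^ 2 := by
    have : 0 ≤ (1 + x) ^ 2 * (1 - 4 * x / (1 + x) ^ 2 * Real.sin φ ^ 2) := by
      rw [← hkey]; positivity
    exact nonneg_of_mul_nonneg_right this (by positivity)
  rw [hkey, Real.mul_rpow (by positivity) hnonneg, ← Real.rpow_natCast (1 + x) 2,
    ← Real.rpow_mul h1.le, neg_mul, Real.rpow_neg h1.le]
  push_cast
  rw [div_inv_eq_mul, mul_assoc]

/-- Fix `k ≥ 2` and let `g a` be the total length of the regular lemniscate `C_{a,k}` for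
`0 ≤ a ≤ 1` (Matz trigonometric form).  Then `g` is strictly increasing and convex on
`[0,1)`, attains its maximum on `[0,1]` at `a = 1`, and for `a > 1` the length
`a^{-(k-1)}·g(1/a)` of `C_{a,k}` is also at most `g 1`:  the Erdős lemniscate `C_{1,k}` is
the longest curve in the family. -/
theorem stmt_17 (k : ℕ) (hk : 2 ≤ k) (g : ℝ → ℝ)
    (hg : ∀ a : ℝ, 0 ≤ a → a ≤ 1 → g a =
      (4 / (1 + a ^ k) ^ (((k : ℝ) - 1) / (k : ℝ))) *
        ∫ φ in (0:ℝ)..(Real.pi / 2),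
          (1 - (4 * a ^ k / (1 + a ^ k) ^ 2) * Real.sin φ ^ 2) ^
            (-(((k : ℝ) - 1) / (2 * (k : ℝ))))) :
    StrictMonoOn g (Set.Ico (0:ℝ) 1) ∧
    ConvexOn ℝ (Set.Ico (0:ℝ) 1) g ∧
    (∀ a ∈ Set.Icc (0:ℝ) 1, g a ≤ g 1) ∧
    (∀ a : ℝ, 1 < a → a ^ (-((k : ℝ) - 1)) * g (1 / a) ≤ g 1) := by
  have hk0 : k ≠ 0 := by omega
  have hkR : (2 : ℝ) ≤ k := by exact_mod_cast hk
  set β : ℝ := -(((k : ℝ) - 1) / (2 * (k : ℝ))) with hβdef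
  have hexp : ((k : ℝ) - 1) / (k : ℝ) = -2 * β := by
    rw [hβdef]
    field_simp
  have hβ : β < 0 := neg_lt_zero.2 (div_pos (by linarith) (by linarith))
  have hβ' : -1 / 2 < β := by
    rw [hβdef, neg_div, neg_lt_neg_iff, div_lt_div_iff₀ (by linarith) (by norm_num)]
    linarith
  have hgF : ∀ a : ℝ, 0 ≤ a → a ≤ 1 → g a = 4 * quarterLength β (a ^ k) := fun a h0 h1 => by
    rw [hg a h0 h1, hexp, four_mul_quarterLength β _ (pow_nonneg h0 k)]
  have hmem : ∀ a ∈ Set.Ico (0 : ℝ) 1, a ^ k ∈ Set.Ico (0 : ℝ) 1 := fun a ha =>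
    ⟨pow_nonneg ha.1 k, pow_lt_one₀ ha.1 ha.2 hk0⟩
  have hmono := strictMonoOn_quarterLength hβ.ne
  have hmax : ∀ a ∈ Set.Icc (0 : ℝ) 1, g a ≤ g 1 := by
    intro a ha
    rcases ha.2.eq_or_lt with rfl | hlt
    · exact le_rfl
    · rw [hgF a ha.1 ha.2, hgF 1 zero_le_one le_rfl, one_pow]
      have := hmem a ⟨ha.1, hlt⟩
      linarith [quarterLength_le_quarterLength_one hβ hβ' this.1 this.2]
  refine ⟨fun a ha b hb hab => ?_, ⟨convex_Ico 0 1, fun a ha b hb s t hs ht hst => ?_⟩, hmax,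
    fun a ha => ?_⟩
  · rw [hgF a ha.1 ha.2.le, hgF b hb.1 hb.2.le]
    linarith [hmono (hmem a ha) (hmem b hb) (pow_lt_pow_left₀ hab ha.1 hk0)]
  · have hw := convex_Ico (0 : ℝ) 1 ha hb hs ht hst
    rw [hgF _ hw.1 hw.2.le, hgF a ha.1 ha.2.le, hgF b hb.1 hb.2.le]
    have hpow := (convexOn_pow k).2 (x := a) ha.1 (y := b) hb.1 hs ht hst
    have hle := hmono.monotoneOn (hmem _ hw)
      (convex_Ico (0 : ℝ) 1 (hmem a ha) (hmem b hb) hs ht hst) hpow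
    have hconv := (convexOn_quarterLength β).2 (hmem a ha) (hmem b hb) hs ht hst
    simp only [smul_eq_mul] at hle hconv ⊢
    linarith
  · have h0 : 0 < a := by linarith
    have hinv : 1 / a ∈ Set.Icc (0 : ℝ) 1 := ⟨by positivity, (div_le_one h0).2 ha.le⟩
    have hnonneg : 0 ≤ g (1 / a) := by
      rw [hgF _ hinv.1 hinv.2]
      refine mul_nonneg (by norm_num) (intervalIntegral.integral_nonneg (by positivity) ?_)
      intro φ _
      positivity
    exact (mul_le_of_le_one_left hnonneg
      (Real.rpow_le_one_of_one_le_of_nonpos ha.le (by linarith))).trans (hmax _ hinv)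
end
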